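/- Let G be a digraph satisfying none of the conditions C_∞, K1, K2, K3, K4, K5, L1, L2, L3, L4. If C_dual(G) ≥ 4, then G is (≤6)-half-reconstructible. -/

import Mathlib

universe u v

/-- A digraph: an irreflexive binary relation on a vertex type. -/
structure Dgraph (V : Type u) where
  Arc : V → V → Prop
  irrefl : ∀ x, ¬ Arc x x

namespace Dgraph

variable {V : Type u} {W : Type v}

/-- The dual digraph. -/
def dual (G : Dgraph V) : Dgraph V :=
  ⟨fun x y => G.Arc y x, fun x h => G.irrefl x h⟩

/-- Subdigraph induced by a set of vertices. -/
def ind (G : Dgraph V) (X : Set V) : Dgraph X :=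
  ⟨fun x y => G.Arc x y, fun x h => G.irrefl x h⟩

/-- Isomorphism of digraphs. -/
def Iso (G : Dgraph V) (G' : Dgraph W) : Prop :=
  ∃ e : V ≃ W, ∀ x y, G.Arc x y ↔ G'.Arc (e x) (e y)

/-- `G` and `G'` are hemimorphic: `G'` is isomorphic to `G` or to its dual. -/
def Hemi (G : Dgraph V) (G' : Dgraph W) : Prop :=
  Iso G G' ∨ Iso G.dual G'

/-- Self-dual digraph. -/
def SelfDual (G : Dgraph V) : Prop := Iso G G.dual

/-- `{x,y}` is a directed pair. -/
def Dir (G : Dgraph V) (x y : V) : Prop :=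
  (G.Arc x y ∧ ¬ G.Arc y x) ∨ (G.Arc y x ∧ ¬ G.Arc x y)

/-- `{x,y}` is a neutral pair (full or void). -/
def Neutral (G : Dgraph V) (x y : V) : Prop :=
  x ≠ y ∧ ¬ G.Dir x y

/-- Interval of a digraph. -/
def IsInterval (G : Dgraph V) (I : Set V) : Prop :=
  ∀ x ∉ I,
    (∀ y ∈ I, G.Arc x y ∧ ¬ G.Arc y x) ∨ (∀ y ∈ I, G.Arc y x ∧ ¬ G.Arc x y) ∨
    (∀ y ∈ I, G.Arc x y ∧ G.Arc y x) ∨ (∀ y ∈ I, ¬ G.Arc x y ∧ ¬ G.Arc y x)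

/-- The arc-connectivity equivalence relation. -/
def ACRel (G : Dgraph V) : V → V → Prop := Relation.ReflTransGen G.Dir

/-- Arc-connected components. -/
def IsACComponent (G : Dgraph V) (D : Set V) : Prop :=
  ∃ x, D = {y | G.ACRel x y}

/-- Arc-connected digraph (at most one arc-connected component). -/
def ArcConnected (G : Dgraph V) : Prop := ∀ x y, G.ACRel x y

/-- Tournament. -/
def IsTournament (G : Dgraph V) : Prop := ∀ x y, x ≠ y → G.Dir x y

/-- Chain (transitive tournament). -/
def IsChainD (G : Dgraph V) : Prop :=
  G.IsTournament ∧ ∀ x y z, G.Arc x y → G.Arc y z → G.Arc x z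

/-- Dgraph from a relation, with forced irreflexivity. -/
def ofRel (r : V → V → Prop) : Dgraph V := ⟨fun x y => x ≠ y ∧ r x y, fun x h => h.1 rfl⟩

/-- The model flag. -/
def flagD : Dgraph (Fin 3) :=
  ofRel (fun x y => (x = 0 ∧ y = 1) ∨ (x = 1 ∧ y = 2) ∨ (x = 2 ∧ y = 1))

/-- First model peak. -/
def peakD1 : Dgraph (Fin 3) :=
  ofRel (fun x y => (x = 0 ∧ y = 1) ∨ (x = 0 ∧ y = 2) ∨ (x = 1 ∧ y = 2) ∨ (x = 2 ∧ y = 1))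

/-- Second model peak. -/
def peakD2 : Dgraph (Fin 3) :=
  ofRel (fun x y => (x = 0 ∧ y = 1) ∨ (x = 0 ∧ y = 2))

/-- The model diamond. -/
def diamondD : Dgraph (Fin 4) :=
  ofRel (fun x y => (x = 0 ∧ y = 1) ∨ (x = 0 ∧ y = 2) ∨ (x = 0 ∧ y = 3) ∨
    (x = 1 ∧ y = 2) ∨ (x = 2 ∧ y = 3) ∨ (x = 3 ∧ y = 1))

/-- A flag is a digraph hemimorphic to the model flag. -/
def IsFlag (G : Dgraph V) : Prop := Hemi G flagD

/-- A peak is a digraph hemimorphic to one of the two model peaks. -/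
def IsPeak (G : Dgraph V) : Prop := Hemi G peakD1 ∨ Hemi G peakD2

/-- A diamond is a digraph hemimorphic to the model diamond. -/
def IsDiamond (G : Dgraph V) : Prop := Hemi G diamondD

/-- Prechain: embeds no peak, no diamond, no two adjacent neutral pairs. -/
def IsPrechain (G : Dgraph V) : Prop :=
  (∀ X : Set V, ¬ IsPeak (G.ind X)) ∧ (∀ X : Set V, ¬ IsDiamond (G.ind X)) ∧
  ¬ ∃ x y z : V, y ≠ z ∧ G.Neutral x y ∧ G.Neutral x z

/-- Proper prechain: a prechain which is not a chain. -/
def ProperPrechain (G : Dgraph V) : Prop := G.IsPrechain ∧ ¬ G.IsChainD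

/-- Diamond-free tournament. -/
def DiamondFreeTournament (G : Dgraph V) : Prop :=
  G.IsTournament ∧ ∀ X : Set V, ¬ IsDiamond (G.ind X)

/-- Non-tournament prechain. -/
def NonTournamentPrechain (G : Dgraph V) : Prop := G.IsPrechain ∧ ¬ G.IsTournament

/-- Model finite consecutivity on `n` vertices (`full` decides whether the
non-consecutive pairs are all full or all void). -/
def consecFin (n : ℕ) (full : Bool) : Dgraph (Fin n) :=
  ofRel (fun i j => i.1 + 1 = j.1 ∨ (full = true ∧ (i.1 + 1 < j.1 ∨ j.1 + 1 < i.1)))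

/-- Model consecutivity of type ω. -/
def consecNat (full : Bool) : Dgraph ℕ :=
  ofRel (fun i j => i + 1 = j ∨ (full = true ∧ (i + 1 < j ∨ j + 1 < i)))

/-- Model consecutivity of type ω*+ω. -/
def consecInt (full : Bool) : Dgraph ℤ :=
  ofRel (fun i j => i + 1 = j ∨ (full = true ∧ (i + 1 < j ∨ j + 1 < i)))

/-- One-end infinite consecutivity (obtained from ω or ω*). -/
def OneEndInfiniteConsecutivity (G : Dgraph V) : Prop :=
  ∃ full, Iso G (consecNat full) ∨ Iso G (consecNat full).dual

/-- Consecutivity. -/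
def IsConsecutivity (G : Dgraph V) : Prop :=
  (∃ n, 3 ≤ n ∧ ∃ full, Iso G (consecFin n full)) ∨
  G.OneEndInfiniteConsecutivity ∨ (∃ full, Iso G (consecInt full))

/-- Model cycle on `n ≥ 3` vertices obtained from the finite consecutivity by
replacing the neutral pair `{0, n-1}` by the arc `(n-1, 0)`. -/
def cycleD (n : ℕ) (full : Bool) : Dgraph (Fin n) :=
  ofRel (fun i j => i.1 + 1 = j.1 ∨ (i.1 = n - 1 ∧ j.1 = 0) ∨
    (full = true ∧ (i.1 + 1 < j.1 ∨ j.1 + 1 < i.1) ∧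
      ¬ (i.1 = 0 ∧ j.1 = n - 1) ∧ ¬ (i.1 = n - 1 ∧ j.1 = 0)))

/-- Cycle. -/
def IsCycle (G : Dgraph V) : Prop := ∃ n, 3 ≤ n ∧ ∃ full, Iso G (cycleD n full)

/-- Near-chain: obtained from a chain by exchanging the directed pair formed
by its extremities. -/
def IsNearChain (G : Dgraph V) : Prop :=
  ∃ (H : Dgraph V) (m M : V), H.IsChainD ∧ m ≠ M ∧
    (∀ x, x ≠ m → H.Arc m x) ∧ (∀ x, x ≠ M → H.Arc x M) ∧
    (∀ x y, G.Arc x y ↔ ((H.Arc x y ∧ ¬ (x = m ∧ y = M)) ∨ (x = M ∧ y = m)))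

/-- `{k}`-hypomorphy. -/
def KHypo (k : ℕ) (G G' : Dgraph V) : Prop :=
  ∀ X : Set V, X.Finite → X.ncard = k → Iso (G.ind X) (G'.ind X)

/-- `(≤ k)`-hypomorphy. -/
def LeHypo (k : ℕ) (G G' : Dgraph V) : Prop :=
  ∀ j, 1 ≤ j → j ≤ k → KHypo j G G'

/-- `{k}`-hemimorphy. -/
def KHemi (k : ℕ) (G G' : Dgraph V) : Prop :=
  ∀ X : Set V, X.Finite → X.ncard = k → Hemi (G.ind X) (G'.ind X)

/-- `(≤ k)`-hemimorphy. -/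
def LeHemi (k : ℕ) (G G' : Dgraph V) : Prop :=
  ∀ j, 1 ≤ j → j ≤ k → KHemi j G G'

/-- `(≤ k)`-half-reconstructibility. -/
def HalfRecon (k : ℕ) (G : Dgraph V) : Prop :=
  ∀ G' : Dgraph V, LeHemi k G G' → Hemi G G'

/-- One step of the difference relation. -/
def DiffStep (G G' : Dgraph V) (x y : V) : Prop := G.Arc x y ↔ ¬ G'.Arc x y

/-- The difference relation `𝔇_{G,G'}`. -/
def DiffRel (G G' : Dgraph V) (x y : V) : Prop :=
  x = y ∨ Relation.TransGen (DiffStep G G') x y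

/-- Difference classes: `C ∈ D_{G,G'}`. -/
def DiffClass (G G' : Dgraph V) (C : Set V) : Prop :=
  ∃ x, C = {y | DiffRel G G' x y}

/-- The difference relation has at least two equivalence classes. -/
def AtLeastTwoDiffClasses (G G' : Dgraph V) : Prop :=
  ∃ C₁ C₂ : Set V, DiffClass G G' C₁ ∧ DiffClass G G' C₂ ∧ C₁ ≠ C₂

/-- `C_dual(G)`: the smallest cardinality of a finite set of vertices inducing a
non-self-dual subdigraph (`⊤` if there is none). -/
noncomputable def Cdual (G : Dgraph V) : ℕ∞ :=
  sInf {n : ℕ∞ | ∃ X : Set V, X.Finite ∧ ¬ SelfDual (G.ind X) ∧ n = (X.ncard : ℕ∞)}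

/-- The contracted digraph `G_I` (the vertex `none` plays the role of `I`). -/
def contract (G : Dgraph V) (I : Set V) : Dgraph (Option {x : V // x ∉ I}) where
  Arc := fun a b =>
    match a, b with
    | some x, some y => G.Arc x.1 y.1
    | some x, none => ∃ z ∈ I, G.Arc x.1 z
    | none, some y => ∃ z ∈ I, G.Arc z y.1
    | none, none => False
  irrefl := by
    rintro (_ | ⟨x, hx⟩)
    · simp
    · exact G.irrefl x

/-- There is an isomorphism `f` from `G_I` onto `G'_I` with `f(I) = I`. -/
def ContractIsoFix (G G' : Dgraph V) (I : Set V) : Prop :=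
  ∃ e : Option {x : V // x ∉ I} ≃ Option {x : V // x ∉ I},
    e none = none ∧ ∀ a b, (G.contract I).Arc a b ↔ (G'.contract I).Arc (e a) (e b)

/-- `D` is disjoint from every flag of `G`. -/
def FlagDisjoint (G : Dgraph V) (D : Set V) : Prop :=
  ∀ F : Set V, IsFlag (G.ind F) → D ∩ F = ∅

/-- `D` contains a vertex `a` of a flag `{a,b,c}` of `G` with `b, c ∉ D` and
`{b,c}` the directed pair of the flag. -/
def FlagVertexCond (G : Dgraph V) (D : Set V) : Prop :=
  ∃ a ∈ D, ∃ b c : V, b ∉ D ∧ c ∉ D ∧ IsFlag (G.ind {a, b, c}) ∧ G.Dir b c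

/-- Condition `C_∞`. -/
def CondCinf (G : Dgraph V) : Prop :=
  (∃ I : Set V, I.Infinite ∧ G.IsInterval I ∧ (G.ind I).IsChainD) ∨
  (∃ I J : Set V, I ≠ J ∧ G.IsInterval I ∧ G.IsInterval J ∧
     (G.ind I).OneEndInfiniteConsecutivity ∧ (G.ind J).OneEndInfiniteConsecutivity) ∨
  (∃ I : Set V, G.IsInterval I ∧ (G.ind I).OneEndInfiniteConsecutivity ∧
     (∀ J : Set V, G.IsInterval J → (G.ind J).OneEndInfiniteConsecutivity → J = I) ∧
     ¬ ContractIsoFix G G.dual I)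

/-- The kind of component occurring in conditions `K1` and `K2`. -/
def K12Kind (G : Dgraph V) (D : Set V) : Prop :=
  DiamondFreeTournament (G.ind D) ∨ (NonTournamentPrechain (G.ind D) ∧ G.FlagDisjoint D)

/-- Condition `K1`. -/
def CondK1 (G : Dgraph V) : Prop :=
  G.Cdual = 3 ∧ ∃ D₁ D₂ : Set V, D₁ ≠ D₂ ∧
    (G.IsACComponent D₁ ∧ ¬ SelfDual (G.ind D₁) ∧ G.IsInterval D₁ ∧ G.K12Kind D₁) ∧
    (G.IsACComponent D₂ ∧ ¬ SelfDual (G.ind D₂) ∧ G.IsInterval D₂ ∧ G.K12Kind D₂)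

/-- Condition `K2`. -/
def CondK2 (G : Dgraph V) : Prop :=
  G.Cdual = 3 ∧ ∃ D₀ : Set V, G.IsACComponent D₀ ∧ ¬ SelfDual (G.ind D₀) ∧
    (∀ D, G.IsACComponent D → ¬ SelfDual (G.ind D) → D = D₀) ∧
    G.K12Kind D₀ ∧ ¬ ContractIsoFix G G.dual D₀

/-- Condition `K3`. -/
def CondK3 (G : Dgraph V) : Prop :=
  G.Cdual = 4 ∧ ∃ D₁ D₂ : Set V, D₁ ≠ D₂ ∧
    (G.IsACComponent D₁ ∧ ¬ SelfDual (G.ind D₁) ∧ G.IsInterval D₁) ∧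
    (G.IsACComponent D₂ ∧ ¬ SelfDual (G.ind D₂) ∧ G.IsInterval D₂)

/-- Condition `K4`. -/
def CondK4 (G : Dgraph V) : Prop :=
  G.Cdual = 5 ∧ ∃ D₁ D₂ : Set V, D₁ ≠ D₂ ∧
    (G.IsACComponent D₁ ∧ ¬ SelfDual (G.ind D₁) ∧ G.IsInterval D₁ ∧ IsPrechain (G.ind D₁)) ∧
    (G.IsACComponent D₂ ∧ ¬ SelfDual (G.ind D₂) ∧ G.IsInterval D₂ ∧ IsPrechain (G.ind D₂))

/-- Condition `K5`. -/
def CondK5 (G : Dgraph V) : Prop :=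
  G.Cdual = 6 ∧ ∃ D₁ D₂ : Set V, D₁ ≠ D₂ ∧
    (G.IsACComponent D₁ ∧ ¬ SelfDual (G.ind D₁) ∧ G.IsInterval D₁ ∧
      DiamondFreeTournament (G.ind D₁)) ∧
    (G.IsACComponent D₂ ∧ ¬ SelfDual (G.ind D₂) ∧ G.IsInterval D₂ ∧
      DiamondFreeTournament (G.ind D₂))

/-- The kind of interval occurring in conditions `L1` and `L2`. -/
def L12Int (G : Dgraph V) (I : Set V) : Prop :=
  G.IsInterval I ∧ DiamondFreeTournament (G.ind I) ∧ ¬ SelfDual (G.ind I) ∧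
    ¬ G.IsACComponent I

/-- Condition `L1`. -/
def CondL1 (G : Dgraph V) : Prop :=
  ∃ I₁ I₂ : Set V, I₁ ≠ I₂ ∧ G.L12Int I₁ ∧ G.L12Int I₂

/-- Condition `L2`. -/
def CondL2 (G : Dgraph V) : Prop :=
  ∃ I₀ : Set V, G.L12Int I₀ ∧ (∀ I, G.L12Int I → I = I₀) ∧ ¬ ContractIsoFix G G.dual I₀

/-- Condition `L3`. -/
def CondL3 (G : Dgraph V) : Prop :=
  G.Cdual = 3 ∧ ∃ D₁ D₂ : Set V, D₁ ≠ D₂ ∧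
    (G.IsACComponent D₁ ∧ ¬ SelfDual (G.ind D₁) ∧ G.IsInterval D₁) ∧
    (G.IsACComponent D₂ ∧ ¬ SelfDual (G.ind D₂) ∧ G.IsInterval D₂) ∧
    ((G.FlagDisjoint D₁ ∧ Cdual (G.ind D₁) = 4 ∧ G.FlagDisjoint D₂ ∧ Cdual (G.ind D₂) = 4) ∨
     (NonTournamentPrechain (G.ind D₁) ∧ G.FlagVertexCond D₁ ∧
      NonTournamentPrechain (G.ind D₂) ∧ G.FlagVertexCond D₂))

/-- Condition `L4`. -/
def CondL4 (G : Dgraph V) : Prop :=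
  G.Cdual = 3 ∧ ∃ D₀ : Set V, G.IsACComponent D₀ ∧ ¬ SelfDual (G.ind D₀) ∧
    (∀ D, G.IsACComponent D → ¬ SelfDual (G.ind D) → D = D₀) ∧
    G.IsInterval D₀ ∧
    ((G.FlagDisjoint D₀ ∧ Cdual (G.ind D₀) = 4) ∨
     (NonTournamentPrechain (G.ind D₀) ∧ G.FlagVertexCond D₀)) ∧
    ¬ ContractIsoFix G G.dual D₀

end Dgraph

universe w

namespace Dgraph

open Function Set

variable {V : Type u} {W : Type v} {U : Type w}

/-! ### Arcs that are not reciprocated -/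

/-- `x → y`: there is an arc from `x` to `y` and none back. -/
def To (G : Dgraph V) (x y : V) : Prop := G.Arc x y ∧ ¬ G.Arc y x

theorem To.asymm {G : Dgraph V} {x y : V} (h : G.To x y) : ¬ G.To y x := fun h' => h.2 h'.1

theorem To.ne {G : Dgraph V} {x y : V} (h : G.To x y) : x ≠ y := by
  rintro rfl; exact h.2 h.1

theorem not_to_self (G : Dgraph V) (x : V) : ¬ G.To x x := fun h => h.2 h.1

theorem dir_iff {G : Dgraph V} {x y : V} : G.Dir x y ↔ G.To x y ∨ G.To y x := Iff.rfl

theorem Dir.symm {G : Dgraph V} {x y : V} (h : G.Dir x y) : G.Dir y x := Or.symm h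

theorem Dir.ne {G : Dgraph V} {x y : V} (h : G.Dir x y) : x ≠ y :=
  h.elim (fun h => To.ne h) (fun h => (To.ne h).symm)

theorem arc_comm_of_not_dir {G : Dgraph V} {x y : V} (h : ¬ G.Dir x y) :
    G.Arc x y ↔ G.Arc y x := by
  unfold Dir at h; tauto

/-! ### Isomorphisms -/

theorem Iso.refl (G : Dgraph V) : Iso G G := ⟨Equiv.refl V, fun _ _ => Iff.rfl⟩

theorem Iso.symm {G : Dgraph V} {H : Dgraph W} : Iso G H → Iso H G := by
  rintro ⟨e, he⟩
  exact ⟨e.symm, fun x y => by rw [he]; simp⟩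

theorem Iso.trans {G : Dgraph V} {H : Dgraph W} {K : Dgraph U} :
    Iso G H → Iso H K → Iso G K := by
  rintro ⟨e, he⟩ ⟨f, hf⟩
  exact ⟨e.trans f, fun x y => by rw [he, hf]; rfl⟩

theorem Iso.dual {G : Dgraph V} {H : Dgraph W} : Iso G H → Iso G.dual H.dual := by
  rintro ⟨e, he⟩
  exact ⟨e, fun x y => he y x⟩

theorem SelfDual.of_iso {G : Dgraph V} {H : Dgraph W} (h : Iso G H) (hH : SelfDual H) :
    SelfDual G := (h.trans hH).trans h.symm.dual

theorem SelfDual.dual {G : Dgraph V} (h : SelfDual G) : SelfDual G.dual := h.symm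

theorem Hemi.symm {G : Dgraph V} {H : Dgraph W} : Hemi G H → Hemi H G := by
  rintro (h | h)
  · exact Or.inl h.symm
  · exact Or.inr h.dual.symm

theorem Hemi.dual_right {G : Dgraph V} {H : Dgraph W} : Hemi G H → Hemi G H.dual := by
  rintro (h | h)
  · exact Or.inr h.dual
  · exact Or.inl h.dual

theorem Hemi.congr {V' : Type*} {W' : Type*} {G : Dgraph V} {H : Dgraph W} {G' : Dgraph V'}
    {H' : Dgraph W'} (hG : Iso G G') (hH : Iso H H') : Hemi G H → Hemi G' H' := by
  rintro (h | h)
  · exact Or.inl ((hG.symm.trans h).trans hH)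
  · exact Or.inr ((hG.dual.symm.trans h).trans hH)

theorem ind_ind_iso (G : Dgraph V) (X : Set V) (Y : Set X) :
    Iso ((G.ind X).ind Y) (G.ind (Subtype.val '' Y)) := by
  refine ⟨Equiv.Set.image _ Y Subtype.val_injective, fun x y => Iff.rfl⟩

theorem ind_univ_iso (G : Dgraph V) : Iso (G.ind univ) G :=
  ⟨Equiv.Set.univ V, fun _ _ => Iff.rfl⟩

/-! ### Small induced subdigraphs -/

/-- Every induced subdigraph with at most `n` vertices is self-dual. -/
def Small (n : ℕ) (G : Dgraph V) : Prop :=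
  ∀ X : Set V, X.Finite → X.ncard ≤ n → SelfDual (G.ind X)

theorem Small.mono {G : Dgraph V} {m n : ℕ} (h : Small n G) (hmn : m ≤ n) : Small m G :=
  fun X hX hc => h X hX (hc.trans hmn)

theorem Small.dual {G : Dgraph V} {n : ℕ} (h : Small n G) : Small n G.dual :=
  fun X hX hc => (h X hX hc).dual

theorem Small.ind {G : Dgraph V} {n : ℕ} (h : Small n G) (X : Set V) : Small n (G.ind X) := by
  intro Y hY hc
  refine SelfDual.of_iso (ind_ind_iso G X Y) (h _ (hY.image _) ?_)
  rwa [ncard_image_of_injective _ Subtype.val_injective]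

theorem Small.selfDual {G : Dgraph V} {n : ℕ} (h : Small n G) [Finite V] (hc : Nat.card V ≤ n) :
    SelfDual G :=
  SelfDual.of_iso (ind_univ_iso G).symm (h univ finite_univ (by rwa [ncard_univ]))

theorem small_of_le_cdual {G : Dgraph V} {n : ℕ} (h : ((n + 1 : ℕ) : ℕ∞) ≤ G.Cdual) :
    Small n G := by
  intro X hX hc
  by_contra hsd
  have h1 : G.Cdual ≤ (X.ncard : ℕ∞) := sInf_le ⟨X, hX, hsd, rfl⟩
  have h2 := h.trans h1
  have h3 : n + 1 ≤ X.ncard := by exact_mod_cast h2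
  omega

theorem iso_ind_range {n : ℕ} {G : Dgraph V} {G' : Dgraph W} {p : Fin n → V} {q : Fin n → W}
    (hp : Injective p) (hq : Injective q) (h : Iso (G.ind (range p)) (G'.ind (range q))) :
    ∃ σ : Fin n → Fin n, Injective σ ∧
      ∀ i j, G.Arc (p i) (p j) ↔ G'.Arc (q (σ i)) (q (σ j)) := by
  obtain ⟨e, he⟩ := h
  let f := ((Equiv.ofInjective p hp).trans e).trans (Equiv.ofInjective q hq).symm
  refine ⟨f, f.injective, fun i j => ?_⟩
  have hf : ∀ i, q (f i) = (e ⟨p i, i, rfl⟩ : W) := fun i =>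
    Equiv.apply_ofInjective_symm hq _
  rw [hf, hf]
  exact he ⟨p i, i, rfl⟩ ⟨p j, j, rfl⟩

theorem ncard_range_fin {n : ℕ} {p : Fin n → V} (hp : Injective p) : (range p).ncard = n := by
  rw [← image_univ, ncard_image_of_injective _ hp, ncard_univ, Nat.card_fin]

theorem Small.exists_anti {n : ℕ} {G : Dgraph V} (h : Small n G) {p : Fin n → V}
    (hp : Injective p) : ∃ σ : Fin n → Fin n, Injective σ ∧
      ∀ i j, G.Arc (p i) (p j) ↔ G.Arc (p (σ j)) (p (σ i)) :=
  iso_ind_range (G' := G.dual) hp hp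
    (h (range p) (finite_range p) (ncard_range_fin hp).le)

/-- The relation `→` restricted to the points `p i` is given by the Boolean matrix `m`. -/
structure Model {n : ℕ} (G : Dgraph V) (p : Fin n → V) (m : Fin n → Fin n → Bool) : Prop where
  inj : Injective p
  to_iff : ∀ i j, G.To (p i) (p j) ↔ m i j = true

theorem Small.model_anti {n : ℕ} {G : Dgraph V} (h : Small n G) {p : Fin n → V}
    {m : Fin n → Fin n → Bool} (hm : Model G p m) :
    ∃ σ : Fin n → Fin n, Injective σ ∧ ∀ i j, m i j = m (σ j) (σ i) := by
  obtain ⟨σ, hσ, hσ'⟩ := h.exists_anti hm.inj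
  refine ⟨σ, hσ, fun i j => ?_⟩
  rw [Bool.eq_iff_iff, ← hm.to_iff, ← hm.to_iff]
  unfold To
  rw [hσ' i j, hσ' j i]

theorem injective_three {x y z : V} (h1 : x ≠ y) (h2 : x ≠ z) (h3 : y ≠ z) :
    Injective ![x, y, z] := by
  intro i j
  fin_cases i <;> fin_cases j <;> simp [h1, h2, h3, h1.symm, h2.symm, h3.symm]

theorem Small.no_peak_out {G : Dgraph V} (h : Small 3 G) {x y z : V} (hyz : y ≠ z)
    (h1 : G.To x y) (h2 : G.To x z) : G.Dir y z := by
  by_contra hn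
  have hn' := fun h => hn (dir_iff.2 h)
  have hmod : Model G ![x, y, z] ![![false, true, true], ![false, false, false],
      ![false, false, false]] := by
    refine ⟨injective_three h1.ne h2.ne hyz, fun i j => ?_⟩
    fin_cases i <;> fin_cases j <;>
      simp [h1, h2, h1.asymm, h2.asymm, not_to_self] <;> tauto
  obtain ⟨σ, hσ, hσ'⟩ := h.model_anti hmod
  revert hσ'
  have key : ∀ a b c : Fin 3, a ≠ b → a ≠ c → b ≠ c →
      ¬ ((![![false, true, true], ![false, false, false], ![false, false, false]] :
        Fin 3 → Fin 3 → Bool) b a = true ∧ (![![false, true, true], ![false, false, false],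
        ![false, false, false]] : Fin 3 → Fin 3 → Bool) c a = true) := by decide
  intro hσ'
  refine key (σ 0) (σ 1) (σ 2) (hσ.ne (by decide)) (hσ.ne (by decide)) (hσ.ne (by decide)) ⟨?_, ?_⟩
  · rw [← hσ']; rfl
  · rw [← hσ']; rfl

theorem Small.no_peak_in {G : Dgraph V} (h : Small 3 G) {x y z : V} (hyz : y ≠ z)
    (h1 : G.To y x) (h2 : G.To z x) : G.Dir y z :=
  (h.dual.no_peak_out hyz h1 h2).symm

theorem Small.no_flag {G : Dgraph V} (h : Small 3 G) {x y z : V} (hyz : G.Dir y z)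
    (h1 : ¬ G.Dir x y) (h2 : ¬ G.Dir x z) (hxy : x ≠ y) (hxz : x ≠ z) :
    G.Arc x y ↔ G.Arc x z := by
  obtain ⟨σ, hσ, hσ'⟩ := h.exists_anti (injective_three hxy hxz hyz.ne)
  have h01 := hσ' 0 1
  have h02 := hσ' 0 2
  have h10 := hσ' 1 0
  have h20 := hσ' 2 0
  have h12 := hσ' 1 2
  have h21 := hσ' 2 1
  have n01 := hσ.ne (show (0 : Fin 3) ≠ 1 by decide)
  have n02 := hσ.ne (show (0 : Fin 3) ≠ 2 by decide)
  have n12 := hσ.ne (show (1 : Fin 3) ≠ 2 by decide)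
  generalize σ 0 = a at *
  generalize σ 1 = b at *
  generalize σ 2 = c at *
  unfold Dir at hyz h1 h2
  fin_cases a <;> fin_cases b <;> fin_cases c <;> simp at * <;> tauto

/-- The Boolean matrix of a list of arcs. -/
def edges {n : ℕ} (l : List (Fin n × Fin n)) (i j : Fin n) : Bool := decide ((i, j) ∈ l)

theorem Model.of_edges {n : ℕ} {G : Dgraph V} {p : Fin n → V} (l : List (Fin n × Fin n))
    (N : List (Fin n × Fin n))
    (hl : ∀ i j, i ≠ j → (i, j) ∈ l ∨ (j, i) ∈ l ∨ (i, j) ∈ N ∨ (j, i) ∈ N)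
    (h : ∀ e ∈ l, G.To (p e.1) (p e.2))
    (hN : ∀ e ∈ N, p e.1 ≠ p e.2 ∧ ¬ G.Dir (p e.1) (p e.2)) : Model G p (edges l) where
  inj i j hij := by
    by_contra hne
    rcases hl i j hne with h1 | h1 | h1 | h1
    · exact (h _ h1).ne hij
    · exact (h _ h1).ne hij.symm
    · exact (hN _ h1).1 hij
    · exact (hN _ h1).1 hij.symm
  to_iff i j := by
    refine ⟨fun hto => ?_, fun h1 => h (i, j) (by simpa [edges] using h1)⟩
    have hne : i ≠ j := by rintro rfl; exact not_to_self _ _ hto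
    rcases hl i j hne with h1 | h1 | h1 | h1
    · simpa [edges] using h1
    · exact absurd (h _ h1) hto.asymm
    · exact absurd (Or.inl hto) (hN _ h1).2
    · exact absurd (Or.inr hto) (hN _ h1).2

/-- `x → y → z → x`. -/
def Cyc (G : Dgraph V) (x y z : V) : Prop := G.To x y ∧ G.To y z ∧ G.To z x

theorem Cyc.rot {G : Dgraph V} {x y z : V} (h : G.Cyc x y z) : G.Cyc y z x := ⟨h.2.1, h.2.2, h.1⟩

theorem Cyc.dual {G : Dgraph V} {x y z : V} (h : G.Cyc x y z) : G.dual.Cyc z y x :=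
  ⟨h.2.1, h.1, h.2.2⟩

/-- `d` dominates the three points `a`, `b`, `c`. -/
def Dom (G : Dgraph V) (d a b c : V) : Prop := G.To d a ∧ G.To d b ∧ G.To d c

set_option maxRecDepth 100000 in
theorem Small.no_diamond {G : Dgraph V} (h : Small 4 G) {d a b c : V} (hc : G.Cyc a b c)
    (hd : G.Dom d a b c) : False := by
  have hmod : Model G ![d, a, b, c] (edges [(0, 1), (0, 2), (0, 3), (1, 2), (2, 3), (3, 1)]) :=
    Model.of_edges _ [] (by decide) (by
      obtain ⟨h1, h2, h3⟩ := hc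
      obtain ⟨h4, h5, h6⟩ := hd
      simp [*]) (by simp)
  obtain ⟨σ, -, hσ⟩ := h.model_anti hmod
  have key : ∀ s0 s1 s2 s3 : Fin 4,
      let m : Fin 4 → Fin 4 → Bool := edges [(0, 1), (0, 2), (0, 3), (1, 2), (2, 3), (3, 1)]
      ¬ (m s1 s0 = true ∧ m s2 s0 = true ∧ m s3 s0 = true ∧ m s2 s1 = true ∧ m s3 s2 = true) := by
    decide
  refine key (σ 0) (σ 1) (σ 2) (σ 3) ?_
  simp only [← hσ]
  decide

theorem Small.no_diamond' {G : Dgraph V} (h : Small 4 G) {d a b c : V} (hc : G.Cyc a b c)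
    (h1 : G.To a d) (h2 : G.To b d) (h3 : G.To c d) : False :=
  h.dual.no_diamond hc.dual ⟨h3, h2, h1⟩

set_option maxRecDepth 100000 in
theorem Small.no_tail {G : Dgraph V} (h : Small 4 G) {x a b c : V} (hab : G.To a b)
    (hac : G.To a c) (hbc : G.To b c) (hxa : G.To x a) (hxb : ¬ G.Dir x b)
    (hxc : ¬ G.Dir x c) : False := by
  have h1 : x ≠ b := by rintro rfl; exact hxa.asymm hab
  have h2 : x ≠ c := by rintro rfl; exact hxa.asymm hac
  have hmod : Model G ![x, a, b, c] (edges [(0, 1), (1, 2), (1, 3), (2, 3)]) :=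
    Model.of_edges _ [(0, 2), (0, 3)] (by decide) (by simp [*]) (by simp [*])
  obtain ⟨σ, -, hσ⟩ := h.model_anti hmod
  have key : ∀ s0 s1 s2 s3 : Fin 4,
      let m : Fin 4 → Fin 4 → Bool := edges [(0, 1), (1, 2), (1, 3), (2, 3)]
      ¬ (m s1 s0 = true ∧ m s2 s1 = true ∧ m s3 s1 = true ∧ m s3 s2 = true) := by
    decide
  refine key (σ 0) (σ 1) (σ 2) (σ 3) ?_
  simp only [← hσ]
  decide

theorem Small.no_tail' {G : Dgraph V} (h : Small 4 G) {x a b c : V} (hab : G.To a b)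
    (hac : G.To a c) (hbc : G.To b c) (hcx : G.To c x) (hxa : ¬ G.Dir x a)
    (hxb : ¬ G.Dir x b) : False :=
  h.dual.no_tail (x := x) (a := c) (b := b) (c := a) hbc hac hab hcx
    (fun h => hxb h.symm) (fun h => hxa h.symm)

set_option maxRecDepth 100000 in
/-- A neutral pair `u, v` with two points on one side both preceded by a point on the other. -/
theorem Small.no_unbalanced {G : Dgraph V} (h : Small 5 G) {u v a a' b : V} (huv : u ≠ v)
    (hn : ¬ G.Dir u v) (hua : G.To u a) (hav : G.To a v) (hua' : G.To u a') (hav' : G.To a' v)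
    (haa' : G.To a a') (hvb : G.To v b) (hbu : G.To b u) (hba : G.To b a) (hba' : G.To b a') :
    False := by
  have hmod : Model G ![u, v, a, a', b] (edges [(0, 2), (2, 1), (0, 3), (3, 1), (2, 3), (1, 4),
      (4, 0), (4, 2), (4, 3)]) :=
    Model.of_edges _ [(0, 1)] (by decide) (by simp [*]) (by simp [*])
  obtain ⟨σ, -, hσ⟩ := h.model_anti hmod
  have key : ∀ s4 s2 : Fin 5,
      let m : Fin 5 → Fin 5 → Bool := edges [(0, 2), (2, 1), (0, 3), (3, 1), (2, 3), (1, 4),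
        (4, 0), (4, 2), (4, 3)]
      m s2 s4 = true → ∀ s0, m s0 s4 = true → m s2 s0 = true → ∀ s3, m s3 s4 = true →
      m s3 s0 = true → m s3 s2 = true →
      ∀ s1, ¬ (m s1 s2 = true ∧ m s1 s3 = true ∧ m s4 s1 = true) := by
    decide
  refine key (σ 4) (σ 2) ?_ (σ 0) ?_ ?_ (σ 3) ?_ ?_ ?_ (σ 1) ?_
  all_goals
    simp only [← hσ]
    decide

theorem Small.no_unbalanced' {G : Dgraph V} (h : Small 5 G) {u v a a' b : V} (huv : u ≠ v)
    (hn : ¬ G.Dir u v) (hua : G.To u a) (hav : G.To a v) (hua' : G.To u a') (hav' : G.To a' v)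
    (haa' : G.To a a') (hvb : G.To v b) (hbu : G.To b u) (hab : G.To a b) (hab' : G.To a' b) :
    False :=
  h.dual.no_unbalanced (u := v) (v := u) (a := a') (a' := a) (b := b) huv.symm hn hav' hua' hav
    hua haa' hbu hvb hab' hab

set_option maxRecDepth 100000 in
/-- The lexicographic sum of chains with `3`, `2` and `1` points over a `3`-cycle. -/
theorem Small.no_blowup {G : Dgraph V} (h : Small 6 G) {p p' p'' q q' r : V}
    (h1 : G.To p p') (h2 : G.To p p'') (h3 : G.To p' p'') (h4 : G.To q q')
    (h5 : G.To p q) (h6 : G.To p q') (h7 : G.To p' q) (h8 : G.To p' q')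
    (h9 : G.To p'' q) (h10 : G.To p'' q') (h11 : G.To q r) (h12 : G.To q' r)
    (h13 : G.To r p) (h14 : G.To r p') (h15 : G.To r p'') : False := by
  have hmod : Model G ![p, p', p'', q, q', r] (edges [(0, 1), (0, 2), (1, 2), (3, 4), (0, 3),
      (0, 4), (1, 3), (1, 4), (2, 3), (2, 4), (3, 5), (4, 5), (5, 0), (5, 1), (5, 2)]) :=
    Model.of_edges _ [] (by decide) (by simp [*]) (by simp)
  obtain ⟨σ, -, hσ⟩ := h.model_anti hmod
  have key : ∀ s0 s1 : Fin 6,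
      let m : Fin 6 → Fin 6 → Bool := edges [(0, 1), (0, 2), (1, 2), (3, 4), (0, 3),
      (0, 4), (1, 3), (1, 4), (2, 3), (2, 4), (3, 5), (4, 5), (5, 0), (5, 1), (5, 2)]
      m s1 s0 = true → ∀ s3, m s3 s0 = true → m s3 s1 = true → ∀ s4, m s4 s0 = true →
      m s4 s1 = true → m s4 s3 = true → ∀ s2, m s2 s0 = true → m s2 s1 = true →
      m s3 s2 = true → m s4 s2 = true → ∀ s5, ¬ (m s5 s3 = true ∧ m s5 s4 = true ∧
      m s0 s5 = true ∧ m s1 s5 = true ∧ m s2 s5 = true) := by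
    decide
  refine key (σ 0) (σ 1) ?_ (σ 3) ?_ ?_ (σ 4) ?_ ?_ ?_ (σ 2) ?_ ?_ ?_ ?_ (σ 5) ?_
  all_goals
    simp only [← hσ]
    decide

theorem Small.no_blowup' {G : Dgraph V} (h : Small 6 G) {p p' p'' q q' r : V}
    (h1 : G.To p p') (h2 : G.To p p'') (h3 : G.To p' p'') (h4 : G.To q q')
    (h5 : G.To q p) (h6 : G.To q' p) (h7 : G.To q p') (h8 : G.To q' p')
    (h9 : G.To q p'') (h10 : G.To q' p'') (h11 : G.To r q) (h12 : G.To r q')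
    (h13 : G.To p r) (h14 : G.To p' r) (h15 : G.To p'' r) : False :=
  h.dual.no_blowup (p := p'') (p' := p') (p'' := p) (q := q') (q' := q) (r := r) h3 h2 h1 h4
    h10 h9 h8 h7 h6 h5 h12 h11 h15 h14 h13

/-! ### Triangles and adjacent neutral pairs -/

/-- Three pairwise directed points. -/
def Tri (G : Dgraph V) (a b c : V) : Prop := G.Dir a b ∧ G.Dir b c ∧ G.Dir a c

theorem Small.dir_of_tri {G : Dgraph V} (h : Small 4 G) {a b c x : V} (ht : G.Tri a b c)
    (hx : G.Dir x a) (hb : x ≠ b) (hc : x ≠ c) : G.Dir x b ∨ G.Dir x c := by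
  by_contra hn
  push Not at hn
  have h3 : Small 3 G := h.mono (by norm_num)
  obtain ⟨hab, hbc, hac⟩ := ht
  rcases hx with hx | hx
  · have hab : G.To a b := hab.resolve_right fun h' => hn.1 (h3.no_peak_in hb hx h')
    have hac : G.To a c := hac.resolve_right fun h' => hn.2 (h3.no_peak_in hc hx h')
    rcases hbc with hbc | hbc
    · exact h.no_tail hab hac hbc hx hn.1 hn.2
    · exact h.no_tail hac hab hbc hx hn.2 hn.1
  · have hab : G.To b a := hab.resolve_left fun h' => hn.1 (h3.no_peak_out hb hx h')
    have hac : G.To c a := hac.resolve_left fun h' => hn.2 (h3.no_peak_out hc hx h')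
    rcases hbc with hbc | hbc
    · exact h.no_tail' hbc hab hac hx hn.1 hn.2
    · exact h.no_tail' hbc hac hab hx hn.2 hn.1


theorem Tri.rot {G : Dgraph V} {a b c : V} (h : G.Tri a b c) : G.Tri b c a :=
  ⟨h.2.1, h.2.2.symm, h.1.symm⟩

/-- `x` is equal to or forms a directed pair with at least two of the points `a`, `b`, `c`
other than itself. -/
def TwoDir (G : Dgraph V) (a b c x : V) : Prop :=
  (G.Dir x a ∧ G.Dir x b) ∨ (G.Dir x b ∧ G.Dir x c) ∨ (G.Dir x a ∧ G.Dir x c)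

theorem Small.twoDir_of_dir {G : Dgraph V} (h : Small 4 G) {a b c : V}
    (ht : G.Tri a b c) {x : V} (hx : G.Dir x a ∨ G.Dir x b ∨ G.Dir x c) :
    G.TwoDir a b c x := by
  have h1 := @Small.dir_of_tri _ _ h a b c x ht
  have h2 := @Small.dir_of_tri _ _ h b c a x ht.rot
  have h3 := @Small.dir_of_tri _ _ h c a b x ht.rot.rot
  obtain ⟨t1, t2, t3⟩ := ht
  have t1' := t1.symm
  have t2' := t2.symm
  have t3' := t3.symm
  unfold TwoDir
  by_cases ea : x = a
  · subst ea; tauto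
  by_cases eb : x = b
  · subst eb; tauto
  by_cases ec : x = c
  · subst ec; tauto
  have h1' := fun h => h1 h eb ec
  have h2' := fun h => h2 h ec ea
  have h3' := fun h => h3 h ea eb
  clear h1 h2 h3
  tauto

theorem Small.twoDir {G : Dgraph V} (h : Small 4 G) (hG : G.ArcConnected) {a b c : V}
    (ht : G.Tri a b c) (x : V) : G.TwoDir a b c x := by
  have hpath : G.ACRel a x := hG a x
  induction hpath with
  | refl => exact h.twoDir_of_dir ht (Or.inr (Or.inl ht.1))
  | @tail y x _ hyx ih =>
    have key : ∀ p q, G.Dir p q → G.Dir y p → G.Dir y q →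
        x = p ∨ x = q ∨ G.Dir x p ∨ G.Dir x q := by
      intro p q hpq hp hq
      by_cases ep : x = p
      · exact Or.inl ep
      by_cases eq : x = q
      · exact Or.inr (Or.inl eq)
      exact Or.inr (Or.inr (h.dir_of_tri ⟨hp, hpq, hq⟩ hyx.symm ep eq))
    have tri := ht
    obtain ⟨t1, t2, t3⟩ := ht
    apply h.twoDir_of_dir tri
    have t1' := t1.symm
    have t2' := t2.symm
    have t3' := t3.symm
    have k1 := key a b t1
    have k2 := key b c t2
    have k3 := key a c t3
    by_cases ea : x = a
    · subst ea; tauto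
    by_cases eb : x = b
    · subst eb; tauto
    by_cases ec : x = c
    · subst ec; tauto
    unfold TwoDir at ih
    tauto

/-- No vertex belongs to two neutral pairs. -/
def NeutralMatching (G : Dgraph V) : Prop := ∀ x y z, x ≠ y → x ≠ z → y ≠ z →
  G.Dir x y ∨ G.Dir x z

theorem Small.neutralMatching_of_tri {G : Dgraph V} (h : Small 4 G) (hG : G.ArcConnected)
    {a b c : V} (ht : G.Tri a b c) : G.NeutralMatching := by
  intro x y z hxy hxz hyz
  by_contra hn
  push Not at hn
  obtain ⟨nxy, nxz⟩ := hn
  have h3 : Small 3 G := h.mono (by norm_num)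
  have nyz : ¬ G.Dir y z := by
    intro hd
    have key : ∀ w, G.Dir y w → G.Dir z w → False := by
      intro w hyw hzw
      have := h.twoDir hG (show G.Tri y z w from ⟨hd, hzw, hyw⟩) x
      unfold TwoDir at this
      tauto
    have hy := h.twoDir hG ht y
    have hz := h.twoDir hG ht z
    have k1 := key a
    have k2 := key b
    have k3 := key c
    unfold TwoDir at hy hz
    tauto
  have nocommon : ∀ w, G.Dir x w → G.Dir y w → G.Dir z w → False := by
    intro w hx hy hz
    have p1 := fun h1 h2 => nxy (h3.no_peak_in (x := w) hxy h1 h2)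
    have p2 := fun h1 h2 => nxz (h3.no_peak_in (x := w) hxz h1 h2)
    have p3 := fun h1 h2 => nyz (h3.no_peak_in (x := w) hyz h1 h2)
    have q1 := fun h1 h2 => nxy (h3.no_peak_out (x := w) hxy h1 h2)
    have q2 := fun h1 h2 => nxz (h3.no_peak_out (x := w) hxz h1 h2)
    have q3 := fun h1 h2 => nyz (h3.no_peak_out (x := w) hyz h1 h2)
    rw [dir_iff] at hx hy hz
    tauto
  have conf : ∀ w w', G.Dir w w' → G.Dir x w → ¬ G.Dir x w' → G.Dir y w → G.Dir y w' → False := by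
    intro w w' hw h1 h2 h3 h4
    have := h.dir_of_tri (show G.Tri w y w' from ⟨h3.symm, h4, hw⟩) h1 hxy
      (by rintro rfl; exact nxy h4.symm)
    tauto
  have hx := h.twoDir hG ht x
  have hy := h.twoDir hG ht y
  have hz := h.twoDir hG ht z
  obtain ⟨t1, t2, t3⟩ := ht
  have c1 := conf a b t1
  have c2 := conf b a t1.symm
  have c3 := conf b c t2
  have c4 := conf c b t2.symm
  have c5 := conf a c t3
  have c6 := conf c a t3.symm
  have n1 := nocommon a
  have n2 := nocommon b
  have n3 := nocommon c
  unfold TwoDir at hx hy hz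
  clear conf nocommon nxy nxz nyz hxy hxz hyz t1 t2 t3 h3 h hG
  generalize G.Dir x a = xa, G.Dir x b = xb, G.Dir x c = xc, G.Dir y a = ya, G.Dir y b = yb,
    G.Dir y c = yc, G.Dir z a = za, G.Dir z b = zb, G.Dir z c = zc at *
  rcases hx with hx | hx | hx <;> rcases hy with hy | hy | hy <;>
    rcases hz with hz | hz | hz <;> grind

/-- Every vertex has at most one successor and at most one predecessor. -/
def Linear (G : Dgraph V) : Prop :=
  (∀ x y z, G.To x y → G.To x z → y = z) ∧ ∀ x y z, G.To y x → G.To z x → y = z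

theorem Small.linear {G : Dgraph V} (h : Small 4 G) (hG : G.ArcConnected)
    (hn : ¬ G.NeutralMatching) : G.Linear := by
  have h3 : Small 3 G := h.mono (by norm_num)
  constructor
  · intro x y z hy hz
    by_contra hne
    exact hn (h.neutralMatching_of_tri hG ⟨Or.inl hy, h3.no_peak_out hne hy hz, Or.inl hz⟩)
  · intro x y z hy hz
    by_contra hne
    exact hn (h.neutralMatching_of_tri hG ⟨Or.inr hy, h3.no_peak_in hne hy hz, Or.inr hz⟩)

theorem Linear.dual {G : Dgraph V} (h : G.Linear) : G.dual.Linear :=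
  ⟨fun x y z hy hz => h.2 x y z hy hz, fun x y z hy hz => h.1 x y z hy hz⟩

/-! ### Digraphs with at most one successor and one predecessor -/

theorem arc_zpow {G : Dgraph V} {f : Equiv.Perm V} (hf : ∀ x y, G.Arc x y ↔ G.Arc (f x) (f y))
    (k : ℤ) : ∀ x y, G.Arc x y ↔ G.Arc ((f ^ k) x) ((f ^ k) y) := by
  induction k using Int.induction_on with
  | zero => simp
  | succ i ih =>
    intro x y
    rw [ih x y, hf, zpow_add_one, (Commute.self_zpow f (i : ℤ)).eq.symm, Equiv.Perm.mul_apply,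
      Equiv.Perm.mul_apply]
  | pred i ih =>
    intro x y
    rw [ih x y, hf (((f ^ (-(i : ℤ) - 1)) x)), ← Equiv.Perm.mul_apply, ← Equiv.Perm.mul_apply,
      ← zpow_one_add, add_sub_cancel]

/-- A digraph with a transitive cyclic group of automorphisms is self-dual. -/
theorem selfDual_of_transitive {G : Dgraph V} {f : Equiv.Perm V}
    (hf : ∀ x y, G.Arc x y ↔ G.Arc (f x) (f y)) (s : V) (hs : ∀ y, ∃ k : ℤ, (f ^ k) s = y) :
    SelfDual G := by
  choose κ hκ using hs
  have hneg : ∀ m n : ℤ, (f ^ m) s = (f ^ n) s → (f ^ (-m)) s = (f ^ (-n)) s := by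
    intro m n h
    have h1 := congrArg (f ^ (-m - n)) h
    simp only [← Equiv.Perm.mul_apply, ← zpow_add] at h1
    ring_nf at h1
    rw [← h1]
  have hinv : Involutive fun y => (f ^ (-κ y)) s := by
    intro y
    have := hneg _ _ (hκ ((f ^ (-κ y)) s))
    simp only [this, neg_neg, hκ]
  refine ⟨hinv.toPerm, fun x y => ?_⟩
  change _ ↔ G.Arc ((f ^ (-κ y)) s) ((f ^ (-κ x)) s)
  rw [arc_zpow hf (-κ x - κ y)]
  conv_lhs => rw [← hκ x, ← hκ y]
  simp only [← Equiv.Perm.mul_apply, ← zpow_add]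
  rw [hκ, hκ]
  ring_nf

theorem Linear.selfDual_of_bi {G : Dgraph V} (hl : G.Linear) (h : Small 3 G)
    (hG : G.ArcConnected) (hn : ¬ G.NeutralMatching) (hs : ∀ x, ∃ y, G.To x y)
    (hp : ∀ x, ∃ y, G.To y x) : SelfDual G := by
  choose s hs using hs
  choose p hp using hp
  let f : Equiv.Perm V :=
    ⟨s, p, fun x => hl.2 _ _ _ (hp _) (hs _), fun x => hl.1 _ _ _ (hs _) (hp _)⟩
  have hto : ∀ x y, G.To x y ↔ y = f x := fun x y =>
    ⟨fun h => hl.1 _ _ _ h (hs x), fun h => h ▸ hs x⟩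
  have hdir : ∀ x y, G.Dir x y ↔ y = f x ∨ x = f y := fun x y => by
    rw [dir_iff, hto, hto]
  have step : ∀ x y, x ≠ y → ¬ G.Dir x y → x ≠ f (f y) → (G.Arc x y ↔ G.Arc (f x) (f y)) := by
    intro x y hxy hd hne
    have e1 : ¬ G.Dir x (f y) := by
      rw [hdir]; simp only [EmbeddingLike.apply_eq_iff_eq]; tauto
    have e2 : ¬ G.Dir (f x) (f y) := by
      rw [hdir] at hd ⊢; simp only [EmbeddingLike.apply_eq_iff_eq]; exact hd
    have e3 : x ≠ f y := fun h' => hd ((hdir _ _).2 (Or.inr h'))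
    have hsf : ∀ x, G.To x (f x) := hs
    rw [h.no_flag (Or.inl (hsf y)) hd e1 hxy e3, arc_comm_of_not_dir e1,
      h.no_flag (Or.inl (hsf x)) (fun h' => e1 h'.symm) (fun h' => e2 h'.symm) e3.symm
        (fun h' => hxy (f.injective h').symm)]
    exact arc_comm_of_not_dir (fun h' => e2 h'.symm)
  have conn : ∀ x y, ∃ k : ℤ, (f ^ k) x = y := by
    intro x y
    induction hG x y with
    | refl => exact ⟨0, rfl⟩
    | @tail y z _ hyz ih =>
      obtain ⟨k, rfl⟩ := ih
      rcases (hdir _ _).1 hyz with h | h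
      · exact ⟨1 + k, by rw [h, zpow_one_add]; rfl⟩
      · refine ⟨-1 + k, ?_⟩
        rw [zpow_add, Equiv.Perm.mul_apply, h]
        simp
  have hauto : ∀ x y, G.Arc x y ↔ G.Arc (f x) (f y) := by
    intro x y
    by_cases hxy : x = y
    · subst hxy; simp [G.irrefl]
    by_cases hd : G.Dir x y
    · rcases (hdir x y).1 hd with rfl | rfl
      · exact iff_of_true (hs x).1 (hs _).1
      · exact iff_of_false (hs y).2 (hs _).2
    by_cases hx : x = f (f y)
    · by_cases hy : y = f (f x)
      · exfalso
        apply hn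
        have hall : ∀ w, w = x ∨ w = f x ∨ w = f (f x) ∨ w = f (f (f x)) := by
          intro w
          induction hG x w with
          | refl => exact Or.inl rfl
          | @tail w z _ hwz ih =>
            have h4 : f (f (f (f x))) = x := by rw [← hy]; exact hx.symm
            rcases (hdir _ _).1 hwz with rfl | h
            · rcases ih with rfl | rfl | rfl | rfl <;> simp [h4]
            · rcases ih with h' | h' | h' | h'
              · have : z = f (f (f x)) := by apply f.injective; rw [← h, h', h4]
                simp [this]
              · have : z = x := f.injective (by rw [← h, h'])
                simp [this]
              · have : z = f x := f.injective (by rw [← h, h'])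
                simp [this]
              · have : z = f (f x) := f.injective (by rw [← h, h'])
                simp [this]
        have h4 : f (f (f (f x))) = x := by rw [← hy]; exact hx.symm
        intro a b c
        simp only [hdir]
        rcases hall a with rfl | rfl | rfl | rfl <;> rcases hall b with rfl | rfl | rfl | rfl <;>
          rcases hall c with rfl | rfl | rfl | rfl <;> simp [h4]
      · rw [arc_comm_of_not_dir hd, step y x (Ne.symm hxy) (fun h' => hd h'.symm) hy]
        refine arc_comm_of_not_dir fun h' => hd ?_
        rw [hdir] at h' ⊢
        simp only [EmbeddingLike.apply_eq_iff_eq] at h'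
        tauto
    · exact step x y hxy hd hx
  rcases isEmpty_or_nonempty V with he | ⟨⟨x⟩⟩
  · exact ⟨Equiv.refl V, fun x => he.elim x⟩
  · exact selfDual_of_transitive hauto x (conn x)

/-- The arcs of a path `g` indexed by an initial segment of `ℕ` starting at a source. -/
theorem Linear.path_arc {G : Dgraph V} (hl : G.Linear) (h : Small 3 G) {g : ℕ → V} {S : Set ℕ}
    (hS : ∀ i j, i ≤ j → j ∈ S → i ∈ S) (hg : ∀ i, i + 1 ∈ S → G.To (g i) (g (i + 1)))
    (h0 : ∀ x, ¬ G.To x (g 0)) :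
    InjOn g S ∧ ∀ i ∈ S, ∀ j ∈ S, G.Arc (g i) (g j) ↔
      j = i + 1 ∨ (G.Arc (g 0) (g 2) ∧ (i + 1 < j ∨ j + 1 < i)) := by
  have hinj : ∀ i ∈ S, ∀ j ∈ S, g i = g j → i = j := by
    intro i
    induction i with
    | zero =>
      intro _ j hj hij
      cases j with
      | zero => rfl
      | succ j => exact absurd (hij ▸ hg j hj) (h0 _)
    | succ i ih =>
      intro hi j hj hij
      cases j with
      | zero => exact absurd (hij ▸ hg i hi) (h0 _)
      | succ j =>
        rw [ih (hS _ _ (by omega) hi) j (hS _ _ (by omega) hj)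
          (hl.2 _ _ _ (hg i hi) (hij ▸ hg j hj))]
  have hto : ∀ i ∈ S, ∀ j ∈ S, G.To (g i) (g j) → j = i + 1 := by
    intro i hi j hj hij
    cases j with
    | zero => exact absurd hij (h0 _)
    | succ j =>
      rw [hinj i hi j (hS _ _ (by omega) hj) (hl.2 _ _ _ hij (hg j hj))]
  have hnd : ∀ i j, i + 2 ≤ j → j ∈ S → ¬ G.Dir (g i) (g j) := by
    intro i j hij hj hd
    have hi : i ∈ S := hS _ _ (by omega) hj
    rcases hd with hd | hd
    · have := hto i hi j hj hd; omega
    · have := hto j hj i hi hd; omega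
  have hne : ∀ i j, i + 2 ≤ j → j ∈ S → g i ≠ g j := by
    intro i j hij hj he
    have := hinj i (hS _ _ (by omega) hj) j hj he
    omega
  have right : ∀ i j, i + 2 ≤ j → j + 1 ∈ S → (G.Arc (g i) (g j) ↔ G.Arc (g i) (g (j + 1))) := by
    intro i j hij hj
    have hj' := hS j _ (by omega) hj
    exact h.no_flag (Or.inl (hg j hj)) (hnd _ _ hij hj') (hnd _ _ (by omega) hj)
      (hne _ _ hij hj') (hne _ _ (by omega) hj)
  have left : ∀ i j, i + 3 ≤ j → j ∈ S → (G.Arc (g i) (g j) ↔ G.Arc (g (i + 1)) (g j)) := by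
    intro i j hij hj
    have h1 := hnd i j (by omega) hj
    have h2 := hnd (i + 1) j (by omega) hj
    rw [arc_comm_of_not_dir h1, arc_comm_of_not_dir h2]
    exact h.no_flag (Or.inl (hg i (hS _ _ (by omega) hj))) (fun h' => h1 h'.symm)
      (fun h' => h2 h'.symm) (hne _ _ (by omega) hj).symm (hne _ _ (by omega) hj).symm
  have base : ∀ i, i + 2 ∈ S → (G.Arc (g i) (g (i + 2)) ↔ G.Arc (g 0) (g 2)) := by
    intro i
    induction i with
    | zero => intro _; rfl
    | succ i ih =>
      intro hi
      rw [← ih (hS _ _ (by omega) hi), ← left i (i + 1 + 2) (by omega) hi]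
      exact (right i (i + 2) le_rfl hi).symm
  have far : ∀ k i, i + 2 + k ∈ S → (G.Arc (g i) (g (i + 2 + k)) ↔ G.Arc (g 0) (g 2)) := by
    intro k
    induction k with
    | zero => exact base
    | succ k ih =>
      intro i hi
      rw [← ih i (hS _ _ (by omega) hi)]
      exact (right i (i + 2 + k) (by omega) hi).symm
  refine ⟨fun i hi j hj => hinj i hi j hj, fun i hi j hj => ?_⟩
  rcases Nat.lt_trichotomy (i + 1) j with hij | hij | hij
  · obtain ⟨k, rfl⟩ := Nat.exists_eq_add_of_le (show i + 2 ≤ j by omega)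
    rw [far k i hj]
    have : i + 1 < i + 2 + k := by omega
    have h' : i + 2 + k ≠ i + 1 := by omega
    simp [this, h']
  · subst hij
    simp [(hg i hj).1]
  · rcases Nat.lt_trichotomy (j + 1) i with hji | hji | hji
    · obtain ⟨k, rfl⟩ := Nat.exists_eq_add_of_le (show j + 2 ≤ i by omega)
      rw [← arc_comm_of_not_dir (hnd j (j + 2 + k) (by omega) hi), far k j hi]
      have : j + 1 < j + 2 + k := by omega
      have h' : j ≠ j + 2 + k + 1 := by omega
      simp [this, h']
    · subst hji
      refine iff_of_false (hg j hi).2 ?_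
      omega
    · have : i = j := by omega
      subst this
      refine iff_of_false (G.irrefl _) ?_
      omega

theorem Linear.of_source {G : Dgraph V} (hl : G.Linear) (h : Small 3 G) (hG : G.ArcConnected)
    {s : V} (hs : ∀ x, ¬ G.To x s) : SelfDual G ∨ ∃ full, Iso G (consecNat full) := by
  classical
  let nxt : V → V := fun x => if h : ∃ y, G.To x y then h.choose else x
  have nxt_to : ∀ x, (∃ y, G.To x y) → G.To x (nxt x) := by
    intro x hx
    simp only [nxt, dif_pos hx]
    exact hx.choose_spec
  have nxt_sink : ∀ x, (¬ ∃ y, G.To x y) → nxt x = x := fun x hx => by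
    simp only [nxt, dif_neg hx]
  let g : ℕ → V := fun i => nxt^[i] s
  have gs : ∀ i, g (i + 1) = nxt (g i) := fun i => iterate_succ_apply' _ _ _
  have back : ∀ i z, G.To z (g i) → ∃ j, g j = z := by
    intro i
    induction i with
    | zero => intro z hz; exact absurd hz (hs z)
    | succ i ih =>
      intro z hz
      by_cases hx : ∃ y, G.To (g i) y
      · exact ⟨i, hl.2 _ _ _ (by rw [gs]; exact nxt_to _ hx) hz⟩
      · rw [gs, nxt_sink _ hx] at hz
        exact ih z hz
  have hsurj : ∀ w, ∃ i, g i = w := by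
    intro w
    induction hG s w with
    | refl => exact ⟨0, rfl⟩
    | @tail y z _ hyz ih =>
      obtain ⟨i, rfl⟩ := ih
      rcases hyz with hyz | hyz
      · exact ⟨i + 1, by rw [gs]; exact hl.1 _ _ _ (nxt_to _ ⟨z, hyz⟩) hyz⟩
      · exact back i z hyz
  by_cases hsink : ∃ m, ¬ ∃ y, G.To (g m) y
  · left
    obtain ⟨m, hm, hmin⟩ : ∃ m, (¬ ∃ y, G.To (g m) y) ∧ ∀ i < m, ∃ y, G.To (g i) y :=
      ⟨Nat.find hsink, Nat.find_spec hsink, fun i hi => not_not.1 (Nat.find_min hsink hi)⟩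
    obtain ⟨hinj, harc⟩ := hl.path_arc h (g := g) (S := Iic m) (fun i j hij hj => hij.trans hj)
      (fun i hi => by rw [gs]; exact nxt_to _ (hmin i hi)) hs
    have hconst : ∀ k, g (m + k) = g m := by
      intro k
      induction k with
      | zero => rfl
      | succ k ih => rw [← add_assoc, gs, ih, nxt_sink _ hm]
    have hbij : Bijective fun i : Fin (m + 1) => g i := by
      refine ⟨fun i j hij => Fin.ext (hinj (Nat.lt_succ_iff.1 i.2) (Nat.lt_succ_iff.1 j.2) hij),
        fun w => ?_⟩
      obtain ⟨i, rfl⟩ := hsurj w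
      by_cases hi : i ≤ m
      · exact ⟨⟨i, by omega⟩, rfl⟩
      · obtain ⟨k, rfl⟩ := Nat.exists_eq_add_of_le (not_le.1 hi).le
        exact ⟨⟨m, by omega⟩, (hconst k).symm⟩
    let e := Equiv.ofBijective _ hbij
    refine ⟨(e.symm.trans Fin.revPerm).trans e, fun x y => ?_⟩
    obtain ⟨i, rfl⟩ := e.surjective x
    obtain ⟨j, rfl⟩ := e.surjective y
    have key : ∀ i j : Fin (m + 1), G.Arc (e i) (e j) ↔ (j : ℕ) = i + 1 ∨ (G.Arc (g 0) (g 2) ∧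
        ((i : ℕ) + 1 < j ∨ (j : ℕ) + 1 < i)) := fun i j =>
      harc i (Nat.lt_succ_iff.1 i.2) j (Nat.lt_succ_iff.1 j.2)
    have e' : ∀ i : Fin (m + 1), ((e.symm.trans Fin.revPerm).trans e) (e i) = e i.rev := by simp
    rw [e', e']
    change _ ↔ G.Arc _ _
    rw [key, key, Fin.val_rev, Fin.val_rev]
    have hi := i.2
    have hj := j.2
    refine or_congr ?_ (and_congr_right fun _ => ?_) <;> omega
  · right
    push Not at hsink
    obtain ⟨hinj, harc⟩ := hl.path_arc h (g := g) (S := univ) (fun _ _ _ _ => mem_univ _)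
      (fun i _ => by rw [gs]; exact nxt_to _ (hsink i)) hs
    refine ⟨decide (G.Arc (g 0) (g 2)), Iso.symm ⟨Equiv.ofBijective g
      ⟨fun i j hij => hinj (mem_univ _) (mem_univ _) hij, hsurj⟩, fun i j => ?_⟩⟩
    change _ ↔ G.Arc (g i) (g j)
    rw [harc i (mem_univ _) j (mem_univ _)]
    simp only [consecNat, ofRel, decide_eq_true_eq]
    constructor
    · rintro ⟨-, h | h⟩
      · exact Or.inl h.symm
      · exact Or.inr h
    · rintro (h | h)
      · exact ⟨by omega, Or.inl h.symm⟩
      · exact ⟨by omega, Or.inr h⟩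

theorem ArcConnected.dual {G : Dgraph V} (h : G.ArcConnected) : G.dual.ArcConnected :=
  fun x y => Relation.ReflTransGen.mono (fun _ _ => Dir.symm (G := G)) x y (h x y)

theorem Small.selfDual_or_oneEnd {G : Dgraph V} (h : Small 4 G) (hG : G.ArcConnected)
    (hn : ¬ G.NeutralMatching) : SelfDual G ∨ G.OneEndInfiniteConsecutivity := by
  have hl := h.linear hG hn
  have h3 : Small 3 G := h.mono (by norm_num)
  by_cases hs : ∃ s, ∀ x, ¬ G.To x s
  · obtain ⟨s, hs⟩ := hs
    exact (hl.of_source h3 hG hs).imp id fun ⟨full, hf⟩ => ⟨full, Or.inl hf⟩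
  by_cases ht : ∃ s, ∀ x, ¬ G.To s x
  · obtain ⟨s, ht⟩ := ht
    exact (hl.dual.of_source h3.dual hG.dual ht).imp SelfDual.dual
      fun ⟨full, hf⟩ => ⟨full, Or.inr hf.dual⟩
  · push Not at hs ht
    exact Or.inl (hl.selfDual_of_bi h3 hG hn ht hs)

/-! ### Intervals, gluing and reflections -/

theorem isInterval_iff {G : Dgraph V} {I : Set V} : G.IsInterval I ↔
    ∀ x ∉ I, ∀ y ∈ I, ∀ z ∈ I, (G.Arc x y ↔ G.Arc x z) ∧ (G.Arc y x ↔ G.Arc z x) := by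
  constructor
  · intro h x hx y hy z hz
    rcases h x hx with h | h | h | h <;> simp [h y hy, h z hz]
  · intro h x hx
    rcases I.eq_empty_or_nonempty with rfl | ⟨y, hy⟩
    · simp
    · have h' := fun z hz => h x hx z hz y hy
      by_cases h1 : G.Arc x y <;> by_cases h2 : G.Arc y x
      · exact Or.inr (Or.inr (Or.inl fun z hz => by simp [h' z hz, h1, h2]))
      · exact Or.inl fun z hz => by simp [h' z hz, h1, h2]
      · exact Or.inr (Or.inl fun z hz => by simp [h' z hz, h1, h2])
      · exact Or.inr (Or.inr (Or.inr fun z hz => by simp [h' z hz, h1, h2]))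

/-- Gluing isomorphisms between the classes of a partition into intervals. -/
theorem iso_glue {ι : Type*} {G H : Dgraph V} (c : V → ι)
    (hGH : ∀ x y, c x ≠ c y → (G.Arc x y ↔ H.Arc x y))
    (hH : ∀ x x' y y', c x = c x' → c y = c y' → c x ≠ c y → (H.Arc x y ↔ H.Arc x' y'))
    (h : ∀ i, Iso (G.ind (c ⁻¹' {i})) (H.ind (c ⁻¹' {i}))) : Iso G H := by
  choose e he using h
  have hc : ∀ i (x : c ⁻¹' {i}), c (e i x) = i := fun i x => (e i x).2
  have hcs : ∀ i (x : c ⁻¹' {i}), c ((e i).symm x) = i := fun i x => ((e i).symm x).2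
  have transport : ∀ (x : V) (i : ι) (hi : c x = i), (e (c x) ⟨x, rfl⟩ : V) = e i ⟨x, hi⟩ := by
    rintro x _ rfl; rfl
  have transport' : ∀ (x : V) (i : ι) (hi : c x = i),
      ((e (c x)).symm ⟨x, rfl⟩ : V) = (e i).symm ⟨x, hi⟩ := by
    rintro x _ rfl; rfl
  let f : V ≃ V :=
    { toFun := fun x => e (c x) ⟨x, rfl⟩
      invFun := fun x => (e (c x)).symm ⟨x, rfl⟩
      left_inv := fun x => (transport' _ (c x) (hc _ _)).trans
        (congrArg Subtype.val ((e (c x)).symm_apply_apply _))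
      right_inv := fun x => (transport _ (c x) (hcs _ _)).trans
        (congrArg Subtype.val ((e (c x)).apply_symm_apply _)) }
  have hf : ∀ x, c (f x) = c x := fun x => hc _ _
  refine ⟨f, fun x y => ?_⟩
  by_cases hxy : c x = c y
  · have h1 : f x = e (c y) ⟨x, hxy⟩ := transport _ _ _
    rw [h1]
    exact he (c y) ⟨x, hxy⟩ ⟨y, rfl⟩
  · rw [hGH x y hxy]
    exact hH _ _ _ _ (hf x).symm (hf y).symm hxy

theorem iso_of_subsingleton {G H : Dgraph V} [Subsingleton V] : Iso G H :=
  ⟨Equiv.refl V, fun x y => by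
    rw [Subsingleton.elim y x]; exact iff_of_false (G.irrefl x) (H.irrefl _)⟩

/-- Replacing the structure on an interval by an isomorphic one. -/
theorem iso_replace {G H : Dgraph V} {I : Set V} (hI : H.IsInterval I)
    (hGH : ∀ x y, ¬ (x ∈ I ∧ y ∈ I) → (G.Arc x y ↔ H.Arc x y))
    (h : Iso (G.ind I) (H.ind I)) : Iso G H := by
  classical
  rw [isInterval_iff] at hI
  let c : V → Option V := fun x => if x ∈ I then none else some x
  have cpos : ∀ {x}, x ∈ I → c x = none := fun hx => if_pos hx
  have cneg : ∀ {x}, x ∉ I → c x = some x := fun hx => if_neg hx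
  refine iso_glue c (fun x y hxy => hGH x y ?_) ?_ ?_
  · rintro ⟨hx, hy⟩
    exact hxy (by rw [cpos hx, cpos hy])
  · intro x x' y y' hx hy hxy
    by_cases h1 : x ∈ I <;> by_cases h2 : x' ∈ I <;> by_cases h3 : y ∈ I <;>
      by_cases h4 : y' ∈ I <;> simp only [c, h1, h2, h3, h4, if_true, if_false, reduceCtorEq,
        ne_eq, not_true, not_false_eq_true, Option.some.injEq] at hx hy hxy
    · subst hy; exact (hI y h3 x h1 x' h2).2
    · subst hx; exact (hI x h1 y h3 y' h4).1
    · subst hx hy; rfl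
  · rintro (_ | a)
    · have : c ⁻¹' {none} = I := by ext x; simp [c]
      rw [this]; exact h
    · have : Subsingleton (c ⁻¹' {some a}) := by
        have key : ∀ x, c x = some a → x = a := by
          intro x hx
          by_cases hxI : x ∈ I
          · simp [cpos hxI] at hx
          · simpa [cneg hxI] using hx
        exact ⟨fun x y => Subtype.ext ((key _ x.2).trans (key _ y.2).symm)⟩
      exact iso_of_subsingleton

/-- `e` fixes `I` pointwise and reverses all arcs except those inside `I`. -/
def Flip (G : Dgraph V) (I : Set V) (e : V ≃ V) : Prop :=
  (∀ x ∈ I, e x = x) ∧ ∀ x y, ¬ (x ∈ I ∧ y ∈ I) → (G.Arc x y ↔ G.Arc (e y) (e x))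

theorem Flip.selfDual {G : Dgraph V} {I : Set V} {e : V ≃ V} (he : G.Flip I e)
    (hI : G.IsInterval I) (h : SelfDual (G.ind I)) : SelfDual G := by
  let H : Dgraph V := ⟨fun x y => G.Arc (e y) (e x), fun x hx => G.irrefl _ hx⟩
  have hHG : Iso H G.dual := ⟨e, fun x y => Iff.rfl⟩
  refine Iso.trans (iso_replace (I := I) ?_ he.2 (h.trans ?_)) hHG
  · rw [isInterval_iff] at hI ⊢
    intro x hx y hy z hz
    have := hI x hx y hy z hz
    rw [he.2 x y (fun h => hx h.1), he.2 x z (fun h => hx h.1), he.2 y x (fun h => hx h.2),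
      he.2 z x (fun h => hx h.2)] at this
    exact this
  · refine ⟨Equiv.refl _, fun x y => ?_⟩
    change G.Arc y x ↔ G.Arc (e y) (e x)
    rw [he.1 _ x.2, he.1 _ y.2]

/-! ### Finite chains -/

theorem IsChainD.exists_fin {G : Dgraph V} (h : G.IsChainD) [Finite V] :
    ∃ e : Fin (Nat.card V) ≃ V, ∀ i j, i < j ↔ G.Arc (e i) (e j) := by
  classical
  have hasymm : ∀ a b, G.Arc a b → ¬ G.Arc b a := fun a b h1 h2 => G.irrefl a (h.2 _ _ _ h1 h2)
  have : IsStrictTotalOrder V G.Arc :=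
    { trichotomous := fun a b h1 h2 => by
        by_contra hne
        rcases h.1 a b hne with h' | h'
        · exact h1 h'.1
        · exact h2 h'.1
      irrefl := G.irrefl
      trans := h.2 }
  let : LinearOrder V := linearOrderOfSTO G.Arc
  let := Fintype.ofFinite V
  let e := Fintype.orderIsoFinOfCardEq V (Nat.card_eq_fintype_card).symm
  exact ⟨e.toEquiv, fun i j => (e.lt_iff_lt).symm⟩

theorem IsChainD.iso {G : Dgraph V} {H : Dgraph W} (hG : G.IsChainD) (hH : H.IsChainD)
    [Finite V] [Finite W] (hc : Nat.card V = Nat.card W) : Iso G H := by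
  obtain ⟨e, he⟩ := hG.exists_fin
  obtain ⟨f, hf⟩ := hH.exists_fin
  refine ⟨(e.symm.trans (finCongr hc)).trans f, fun x y => ?_⟩
  obtain ⟨i, rfl⟩ := e.surjective x
  obtain ⟨j, rfl⟩ := e.surjective y
  rw [← he]
  simp only [Equiv.trans_apply, Equiv.symm_apply_apply]
  rw [← hf]
  rfl

theorem IsTournament.dual {G : Dgraph V} (h : G.IsTournament) : G.dual.IsTournament :=
  fun x y hxy => (h x y hxy).symm

theorem IsChainD.dual {G : Dgraph V} (h : G.IsChainD) : G.dual.IsChainD :=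
  ⟨h.1.dual, fun x y z hxy hyz => h.2 z y x hyz hxy⟩

theorem IsChainD.selfDual {G : Dgraph V} (h : G.IsChainD) [Finite V] : SelfDual G :=
  h.iso h.dual rfl

theorem isChainD_of_no_cyc {G : Dgraph V} (h : G.IsTournament) (hc : ∀ x y z, ¬ G.Cyc x y z) :
    G.IsChainD := by
  have hto : ∀ x y, G.Arc x y → x ≠ y → G.To x y ∨ G.To y x := fun x y _ hne => h x y hne
  have hto' : ∀ x y, G.Arc x y → G.To x y := by
    intro x y hxy
    have hne : x ≠ y := by rintro rfl; exact G.irrefl _ hxy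
    exact (h x y hne).resolve_right fun h' => h'.2 hxy
  refine ⟨h, fun x y z hxy hyz => ?_⟩
  by_cases hxz : x = z
  · subst hxz
    exact absurd hxy (hto' _ _ hyz).2
  · rcases h x z hxz with h' | h'
    · exact h'.1
    · exact absurd ⟨hto' _ _ hxy, hto' _ _ hyz, h'⟩ (hc x y z)

/-- Intervals inducing chains are finite. -/
def FiniteChains (G : Dgraph V) : Prop :=
  ∀ I : Set V, G.IsInterval I → (G.ind I).IsChainD → I.Finite

/-- A set of pairwise directed points without `3`-cycle. -/
theorem isChainD_ind {G : Dgraph V} {I : Set V} (h : ∀ x ∈ I, ∀ y ∈ I, x ≠ y → G.Dir x y)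
    (hc : ∀ x ∈ I, ∀ y ∈ I, ∀ z ∈ I, ¬ G.Cyc x y z) : (G.ind I).IsChainD :=
  isChainD_of_no_cyc (fun x y hxy => h x x.2 y y.2 fun hcyc => hxy (Subtype.ext hcyc))
    fun x y z hcyc => hc x x.2 y y.2 z z.2 hcyc

/-! ### Self-duality of explicit finite digraphs -/

theorem Small.selfDual_of_surjective {n : ℕ} {G : Dgraph V} (h : Small n G) {p : Fin n → V}
    (hp : Surjective p) : SelfDual G := by
  have : Finite V := Finite.of_surjective p hp
  exact h.selfDual ((Nat.card_le_card_of_surjective p hp).trans_eq (Nat.card_fin n))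

theorem Model.selfDual {n : ℕ} {G : Dgraph V} {p : Fin n → V} {m : Fin n → Fin n → Bool}
    (hm : Model G p m) (hp : Surjective p) (s : Fin n → Fin n) (hs : ∀ i, s (s i) = i)
    (hms : ∀ i j, m i j = true → m (s j) (s i) = true)
    (hN : ∀ i j, i ≠ j → m i j = false → m j i = false → G.Arc (p i) (p j) →
      G.Arc (p (s j)) (p (s i))) : SelfDual G := by
  have key : ∀ i j, G.Arc (p i) (p j) → G.Arc (p (s j)) (p (s i)) := by
    intro i j hij
    by_cases h1 : m i j = true
    · exact ((hm.to_iff _ _).2 (hms i j h1)).1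
    by_cases h2 : m j i = true
    · exact absurd hij ((hm.to_iff _ _).2 h2).2
    refine hN i j ?_ (by simpa using h1) (by simpa using h2) hij
    rintro rfl
    exact G.irrefl _ hij
  let e := Equiv.ofBijective p ⟨hm.inj, hp⟩
  have hs' : Involutive s := hs
  refine ⟨(e.symm.trans hs'.toPerm).trans e, fun x y => ?_⟩
  obtain ⟨i, rfl⟩ := hp x
  obtain ⟨j, rfl⟩ := hp y
  have e' : ∀ i, ((e.symm.trans hs'.toPerm).trans e) (p i) = p (s i) := fun i => by
    have : e.symm (p i) = i := e.symm_apply_apply i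
    simp only [Equiv.trans_apply, this]
    rfl
  rw [e', e']
  refine ⟨key i j, fun h => ?_⟩
  have := key _ _ h
  rwa [hs, hs] at this

/-! ### Digraphs with a neutral pair and no two adjacent ones -/

/-- `w` lies between `u` and `v`. -/
def Btw (G : Dgraph V) (u v w : V) : Prop := G.To u w ∧ G.To w v

section
variable {G : Dgraph V} {u v : V}

theorem btw_or_btw (h : Small 3 G) (nm : G.NeutralMatching) (huv : u ≠ v) (hn : ¬ G.Dir u v)
    {w : V} (hu : w ≠ u) (hv : w ≠ v) : G.Btw u v w ∨ G.Btw v u w := by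
  have h1 := (nm u v w huv hu.symm hv.symm).resolve_left hn
  have h2 := (nm v u w huv.symm hv.symm hu.symm).resolve_left fun h' => hn h'.symm
  rcases h1 with h1 | h1 <;> rcases h2 with h2 | h2
  · exact absurd (h.no_peak_in huv h1 h2) hn
  · exact Or.inl ⟨h1, h2⟩
  · exact Or.inr ⟨h2, h1⟩
  · exact absurd (h.no_peak_out huv h1 h2) hn

theorem Btw.not_btw {w : V} (h : G.Btw u v w) : ¬ G.Btw v u w := fun h' => h.1.asymm h'.2

theorem btw_dir (h : Small 3 G) {a b : V} (ha : G.Btw u v a) (hb : G.Btw u v b) (hab : a ≠ b) :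
    G.Dir a b := h.no_peak_out hab ha.1 hb.1

theorem isChainD_btw (h : Small 4 G) : (G.ind {w | G.Btw u v w}).IsChainD :=
  isChainD_ind (fun _ hx _ hy => btw_dir (h.mono (by norm_num)) hx hy)
    fun _ hx _ hy _ hz hc => h.no_diamond hc ⟨hx.1, hy.1, hz.1⟩

theorem btw_cross (h : Small 5 G) (nm : G.NeutralMatching) (huv : u ≠ v) (hn : ¬ G.Dir u v)
    {a a' b : V} (ha : G.Btw u v a) (ha' : G.Btw u v a') (haa' : G.To a a')
    (hb : G.Btw v u b) : (G.To a' b ∨ ¬ G.Dir a' b) ∧ (G.To b a ∨ ¬ G.Dir b a) := by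
  have h3 : Small 3 G := h.mono (by norm_num)
  have h4 : Small 4 G := h.mono (by norm_num)
  have n1 : a ≠ b := by rintro rfl; exact ha.not_btw hb
  have n2 : a' ≠ b := by rintro rfl; exact ha'.not_btw hb
  by_cases d1 : G.Dir b a
  · by_cases d2 : G.Dir a' b
    · rcases d1 with d1 | d1 <;> rcases d2 with d2 | d2
      · exact ⟨Or.inl d2, Or.inl d1⟩
      · exact (h.no_unbalanced huv hn ha.1 ha.2 ha'.1 ha'.2 haa' hb.1 hb.2 d1 d2).elim
      · exact (h.no_unbalanced' huv hn ha.1 ha.2 ha'.1 ha'.2 haa' hb.1 hb.2 d1 d2).elim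
      · exact (h4.no_diamond (d := a) ⟨d2, ha'.2, hb.1⟩ ⟨d1, haa', ha.2⟩).elim
    · refine ⟨Or.inr d2, ?_⟩
      rcases d1 with d1 | d1
      · exact Or.inl d1
      · exact absurd (h3.no_peak_out n2 haa' d1) d2
  · refine ⟨?_, Or.inr d1⟩
    rcases (nm b a a' n1.symm n2.symm haa'.ne).resolve_left d1 with d2 | d2
    · exact absurd (h3.no_peak_in n1.symm d2 haa') d1
    · exact Or.inl d2

theorem btw_mid (h : Small 5 G) (nm : G.NeutralMatching) (huv : u ≠ v) (hn : ¬ G.Dir u v)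
    {a a' a'' b : V} (ha : G.Btw u v a) (ha' : G.Btw u v a') (ha'' : G.Btw u v a'')
    (h1 : G.To a a') (h2 : G.To a' a'') (hb : G.Btw v u b) :
    ¬ G.Dir a' b ∧ G.To b a ∧ G.To a'' b := by
  have k1 := btw_cross h nm huv hn ha ha' h1 hb
  have k2 := btw_cross h nm huv hn ha' ha'' h2 hb
  have n0 : ¬ G.Dir a' b := by
    rcases k1.1 with k | k
    · rcases k2.2 with k' | k'
      · exact absurd k k'.asymm
      · exact fun h' => k' h'.symm
    · exact k
  have nb : ∀ {x}, G.Btw u v x → b ≠ x := by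
    rintro x hx rfl; exact hx.not_btw hb
  refine ⟨n0, k1.2.resolve_right fun h' => ?_, k2.1.resolve_right fun h' => ?_⟩
  · exact ((nm b a a' (nb ha) (nb ha') h1.ne).resolve_left h') |>.symm |> n0
  · exact ((nm b a'' a' (nb ha'') (nb ha') h2.ne.symm).resolve_left fun hh => h' hh.symm).symm |> n0

theorem selfDual_of_path (h : Small 5 G) (nm : G.NeutralMatching) (huv : u ≠ v)
    (hn : ¬ G.Dir u v) {a a' a'' b : V} (ha : G.Btw u v a) (ha' : G.Btw u v a')
    (ha'' : G.Btw u v a'') (h1 : G.To a a') (h2 : G.To a' a'') (hb : G.Btw v u b) :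
    SelfDual G := by
  have h3 : Small 3 G := h.mono (by norm_num)
  obtain ⟨n0, t1, t2⟩ := btw_mid h nm huv hn ha ha' ha'' h1 h2 hb
  have h02 : G.To a a'' := by
    have hne : a ≠ a'' := by rintro rfl; exact h1.asymm h2
    refine (btw_dir h3 ha ha'' hne).resolve_right fun h' => ?_
    exact (h.mono (by norm_num : 4 ≤ 5)).no_diamond (d := u) ⟨h1, h2, h'⟩ ⟨ha.1, ha'.1, ha''.1⟩
  have nb : ∀ {x}, G.Btw u v x → b ≠ x := by
    rintro x hx rfl; exact hx.not_btw hb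
  have mid_eq : ∀ {x y z}, G.Btw u v x → G.Btw u v y → G.Btw u v z → G.To x y → G.To y z →
      y = a' := by
    intro x y z hx hy hz hxy hyz
    by_contra hne
    have := (btw_mid h nm huv hn hx hy hz hxy hyz hb).1
    rcases nm b a' y (nb ha') (nb hy) (Ne.symm hne) with h' | h'
    · exact n0 h'.symm
    · exact this h'.symm
  have hmod : Model G ![u, v, a, a', a'', b] (edges [(0, 2), (0, 3), (0, 4), (2, 1), (3, 1),
      (4, 1), (1, 5), (5, 0), (2, 3), (2, 4), (3, 4), (5, 2), (4, 5)]) :=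
    Model.of_edges _ [(0, 1), (3, 5)] (by decide)
      (by simp [ha.1, ha.2, ha'.1, ha'.2, ha''.1, ha''.2, hb.1, hb.2, *])
      (by simp [huv, hn, (nb ha').symm, n0])
  refine hmod.selfDual ?_ ![1, 0, 4, 3, 2, 5] (by decide) (by decide) ?_
  · intro w
    by_cases e1 : w = u
    · exact ⟨0, e1.symm⟩
    by_cases e2 : w = v
    · exact ⟨1, e2.symm⟩
    rcases btw_or_btw h3 nm huv hn e1 e2 with hw | hw
    · by_cases e3 : w = a'
      · exact ⟨3, e3.symm⟩
      by_cases e4 : w = a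
      · exact ⟨2, e4.symm⟩
      by_cases e5 : w = a''
      · exact ⟨4, e5.symm⟩
      exfalso
      rcases btw_dir h3 hw ha' e3 with d | d
      · rcases btw_dir h3 hw ha e4 with d' | d'
        · exact h1.ne (mid_eq hw ha ha' d' h1)
        · exact e3 (mid_eq ha hw ha' d' d)
      · rcases btw_dir h3 hw ha'' e5 with d' | d'
        · exact e3 (mid_eq ha' hw ha'' d d')
        · exact h2.ne (mid_eq ha' ha'' hw h2 d').symm
    · have := (btw_mid h nm huv hn ha ha' ha'' h1 h2 hw).1
      refine ⟨5, ?_⟩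
      by_contra hne
      have nw : a' ≠ w := by rintro rfl; exact ha'.not_btw hw
      rcases nm a' b w (nb ha').symm nw hne with h' | h'
      · exact n0 h'
      · exact this h'
  · have e1 : G.Arc u v ↔ G.Arc v u := arc_comm_of_not_dir hn
    have e2 : G.Arc a' b ↔ G.Arc b a' := arc_comm_of_not_dir n0
    intro i j
    fin_cases i <;> fin_cases j <;> simp [edges, e1, e2]

theorem selfDual_of_hexagon {a a' b b' : V}
    (h1 : G.To u a) (h2 : G.To u a') (h3 : G.To a a') (h4 : G.To a v) (h5 : G.To a' v)
    (h6 : G.To a' b) (h7 : G.To v b) (h8 : G.To v b') (h9 : G.To b b') (h10 : G.To b u)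
    (h11 : G.To b' u) (h12 : G.To b' a) (huv : u ≠ v) (n1 : ¬ G.Dir u v) (hab : a ≠ b)
    (n2 : ¬ G.Dir a b) (hab' : a' ≠ b') (n3 : ¬ G.Dir a' b')
    (hs : ∀ w, w = u ∨ w = a ∨ w = a' ∨ w = v ∨ w = b ∨ w = b') : SelfDual G := by
  have hmod : Model G ![u, a, a', v, b, b'] (edges [(0, 1), (0, 2), (1, 2), (1, 3), (2, 3),
      (2, 4), (3, 4), (3, 5), (4, 5), (4, 0), (5, 0), (5, 1)]) :=
    Model.of_edges _ [(0, 3), (1, 4), (2, 5)] (by decide) (by simp [*]) (by simp [*])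
  have hsurj : Surjective ![u, a, a', v, b, b'] := by
    intro w
    rcases hs w with h | h | h | h | h | h
    · exact ⟨0, h.symm⟩
    · exact ⟨1, h.symm⟩
    · exact ⟨2, h.symm⟩
    · exact ⟨3, h.symm⟩
    · exact ⟨4, h.symm⟩
    · exact ⟨5, h.symm⟩
  have e1 := arc_comm_of_not_dir n1
  have e2 := arc_comm_of_not_dir n2
  have e3 := arc_comm_of_not_dir n3
  by_cases c1 : G.Arc a b ↔ G.Arc a' b'
  · refine hmod.selfDual hsurj ![0, 5, 4, 3, 2, 1] (by decide) (by decide) ?_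
    clear * - e1 e2 e3 c1
    intro i j
    fin_cases i <;> fin_cases j <;> simp [edges] <;> tauto
  by_cases c2 : G.Arc u v ↔ G.Arc a b
  · refine hmod.selfDual hsurj ![1, 0, 5, 4, 3, 2] (by decide) (by decide) ?_
    clear * - e1 e2 e3 c1 c2
    intro i j
    fin_cases i <;> fin_cases j <;> simp [edges] <;> tauto
  · refine hmod.selfDual hsurj ![2, 1, 0, 5, 4, 3] (by decide) (by decide) ?_
    clear * - e1 e2 e3 c1 c2
    intro i j
    fin_cases i <;> fin_cases j <;> simp [edges] <;> tauto

theorem selfDual_of_no_btw (h : Small 4 G) (nm : G.NeutralMatching) (huv : u ≠ v)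
    (hn : ¬ G.Dir u v) (hfin : G.FiniteChains) (hB : ∀ b, ¬ G.Btw v u b) : SelfDual G := by
  classical
  have h3 : Small 3 G := h.mono (by norm_num)
  have hmem : ∀ w, w ∉ {w | G.Btw u v w} → w = u ∨ w = v := by
    intro w hw
    by_contra hne
    push Not at hne
    exact (btw_or_btw h3 nm huv hn hne.1 hne.2).elim hw (hB w)
  have hitv : G.IsInterval {w | G.Btw u v w} := by
    intro x hx
    rcases hmem x hx with rfl | rfl
    · exact Or.inl fun y hy => hy.1
    · exact Or.inr (Or.inl fun y hy => hy.2)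
  have hch := isChainD_btw (u := u) (v := v) h
  have := (hfin _ hitv hch).to_subtype
  refine Flip.selfDual (e := Equiv.swap u v) ⟨fun x hx => ?_, fun x y hxy => ?_⟩ hitv hch.selfDual
  · exact Equiv.swap_apply_of_ne_of_ne hx.1.ne.symm hx.2.ne
  · have hfix : ∀ x, G.Btw u v x → Equiv.swap u v x = x := fun x hx =>
      Equiv.swap_apply_of_ne_of_ne hx.1.ne.symm hx.2.ne
    by_cases hx : G.Btw u v x
    · have hy : ¬ G.Btw u v y := fun hy => hxy ⟨hx, hy⟩
      rw [hfix x hx]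
      rcases hmem y hy with rfl | rfl
      · rw [Equiv.swap_apply_left]
        exact iff_of_false hx.1.2 hx.2.2
      · rw [Equiv.swap_apply_right]
        exact iff_of_true hx.2.1 hx.1.1
    · by_cases hy : G.Btw u v y
      · rw [hfix y hy]
        rcases hmem x hx with rfl | rfl
        · rw [Equiv.swap_apply_left]
          exact iff_of_true hy.1.1 hy.2.1
        · rw [Equiv.swap_apply_right]
          exact iff_of_false hy.2.2 hy.1.2
      · rcases hmem x hx with rfl | rfl <;> rcases hmem y hy with rfl | rfl <;>
          simp [G.irrefl]

theorem selfDual_of_neutral_pair (h : Small 5 G) (nm : G.NeutralMatching) (huv : u ≠ v)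
    (hn : ¬ G.Dir u v) (hfin : G.FiniteChains) : SelfDual G := by
  have h3 : Small 3 G := h.mono (by norm_num)
  have h4 : Small 4 G := h.mono (by norm_num)
  have hn' : ¬ G.Dir v u := fun h' => hn h'.symm
  by_cases hA : ∀ a, ¬ G.Btw u v a
  · exact selfDual_of_no_btw h4 nm huv.symm hn' hfin hA
  by_cases hB : ∀ b, ¬ G.Btw v u b
  · exact selfDual_of_no_btw h4 nm huv hn hfin hB
  push Not at hA hB
  obtain ⟨a, ha⟩ := hA
  obtain ⟨b, hb⟩ := hB
  by_cases pA : ∃ x y z, G.Btw u v x ∧ G.Btw u v y ∧ G.Btw u v z ∧ G.To x y ∧ G.To y z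
  · obtain ⟨x, y, z, hx, hy, hz, hxy, hyz⟩ := pA
    exact selfDual_of_path h nm huv hn hx hy hz hxy hyz hb
  by_cases pB : ∃ x y z, G.Btw v u x ∧ G.Btw v u y ∧ G.Btw v u z ∧ G.To x y ∧ G.To y z
  · obtain ⟨x, y, z, hx, hy, hz, hxy, hyz⟩ := pB
    exact selfDual_of_path h nm huv.symm hn' hx hy hz hxy hyz ha
  have two : ∀ {u v : V}, (¬ ∃ x y z, G.Btw u v x ∧ G.Btw u v y ∧ G.Btw u v z ∧ G.To x y ∧
      G.To y z) → ∀ {x y : V}, G.Btw u v x → G.Btw u v y → G.To x y → ∀ z, G.Btw u v z →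
      z = x ∨ z = y := by
    intro u v hp x y hx hy hxy z hz
    by_contra hne
    push Not at hne
    rcases btw_dir h3 hz hx hne.1 with d | d
    · exact hp ⟨z, x, y, hz, hx, hy, d, hxy⟩
    rcases btw_dir h3 hz hy hne.2 with d' | d'
    · exact hp ⟨x, z, y, hx, hz, hy, d, d'⟩
    · exact hp ⟨x, y, z, hx, hy, hz, hxy, d'⟩
  have two' : ∀ {u v : V}, (¬ ∃ x y z, G.Btw u v x ∧ G.Btw u v y ∧ G.Btw u v z ∧ G.To x y ∧
      G.To y z) → ∀ {x : V}, G.Btw u v x → ∃ y z, ∀ w, G.Btw u v w → w = y ∨ w = z := by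
    intro u v hp x hx
    by_cases hex : ∃ y, G.Btw u v y ∧ y ≠ x
    · obtain ⟨y, hy, hne⟩ := hex
      rcases btw_dir h3 hy hx hne with d | d
      · exact ⟨y, x, two hp hy hx d⟩
      · exact ⟨x, y, two hp hx hy d⟩
    · push Not at hex
      exact ⟨x, x, fun w hw => Or.inl (hex w hw)⟩
  by_cases hA : ∀ x, G.Btw u v x → x = a
  · obtain ⟨y, z, hyz⟩ := two' pB hb
    refine h.selfDual_of_surjective (p := ![u, v, a, y, z]) fun w => ?_
    by_cases e1 : w = u
    · exact ⟨0, e1.symm⟩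
    by_cases e2 : w = v
    · exact ⟨1, e2.symm⟩
    rcases btw_or_btw h3 nm huv hn e1 e2 with hw | hw
    · exact ⟨2, (hA w hw).symm⟩
    · rcases hyz w hw with hw | hw
      · exact ⟨3, hw.symm⟩
      · exact ⟨4, hw.symm⟩
  by_cases hB : ∀ x, G.Btw v u x → x = b
  · obtain ⟨y, z, hyz⟩ := two' pA ha
    refine h.selfDual_of_surjective (p := ![u, v, b, y, z]) fun w => ?_
    by_cases e1 : w = u
    · exact ⟨0, e1.symm⟩
    by_cases e2 : w = v
    · exact ⟨1, e2.symm⟩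
    rcases btw_or_btw h3 nm huv hn e1 e2 with hw | hw
    · rcases hyz w hw with hw | hw
      · exact ⟨3, hw.symm⟩
      · exact ⟨4, hw.symm⟩
    · exact ⟨2, (hB w hw).symm⟩
  have pair : ∀ {u v x : V}, G.Btw u v x → (¬ ∀ y, G.Btw u v y → y = x) →
      ∃ y z, G.Btw u v y ∧ G.Btw u v z ∧ G.To y z := by
    intro u v x hx hne
    push Not at hne
    obtain ⟨y, hy, hne⟩ := hne
    rcases btw_dir h3 hy hx hne with d | d
    · exact ⟨y, x, hy, hx, d⟩
    · exact ⟨x, y, hx, hy, d⟩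
  obtain ⟨a, a', ha, ha', haa'⟩ := pair ha hA
  obtain ⟨b, b', hb, hb', hbb'⟩ := pair hb hB
  have k1 := btw_cross h nm huv hn ha ha' haa' hb
  have k2 := btw_cross h nm huv hn ha ha' haa' hb'
  have k3 := btw_cross h nm huv.symm hn' hb hb' hbb' ha
  have k4 := btw_cross h nm huv.symm hn' hb hb' hbb' ha'
  have ne : ∀ {x y}, G.Btw u v x → G.Btw v u y → x ≠ y := by
    rintro x _ hx hy rfl; exact hx.not_btw hy
  have n1 : ¬ G.Dir a b := by
    rcases k1.2 with k | k
    · rcases k3.2 with k' | k'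
      · exact absurd k k'.asymm
      · exact k'
    · exact fun h' => k h'.symm
  have n2 : ¬ G.Dir a' b' := by
    rcases k2.1 with k | k
    · rcases k4.1 with k' | k'
      · exact absurd k k'.asymm
      · exact fun h' => k' h'.symm
    · exact k
  have t1 : G.To a' b := k1.1.resolve_right fun h' =>
    h' ((nm a' b' b (ne ha' hb') (ne ha' hb) hbb'.ne.symm).resolve_left n2)
  have t2 : G.To b' a := k2.2.resolve_right fun h' =>
    h' ((nm a b b' (ne ha hb) (ne ha hb') hbb'.ne).resolve_left n1).symm
  refine selfDual_of_hexagon ha.1 ha'.1 haa' ha.2 ha'.2 t1 hb.1 hb'.1 hbb' hb.2 hb'.2 t2 huv hn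
    (ne ha hb) n1 (ne ha' hb') n2 fun w => ?_
  by_cases e1 : w = u
  · exact Or.inl e1
  by_cases e2 : w = v
  · simp [e2]
  rcases btw_or_btw h3 nm huv hn e1 e2 with hw | hw
  · rcases two pA ha ha' haa' w hw with hw | hw <;> simp [hw]
  · rcases two pB hb hb' hbb' w hw with hw | hw <;> simp [hw]
end

/-! ### Diamond-free tournaments -/

/-- The vertex set is partitioned into three chains `A → B → C → A`. -/
structure Blowup (G : Dgraph V) (A B C : Set V) : Prop where
  cover : ∀ x, x ∈ A ∨ x ∈ B ∨ x ∈ C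
  ab : ∀ x ∈ A, ∀ y ∈ B, G.To x y
  bc : ∀ x ∈ B, ∀ y ∈ C, G.To x y
  ca : ∀ x ∈ C, ∀ y ∈ A, G.To x y
  na : A.Nonempty
  nb : B.Nonempty
  nc : C.Nonempty

theorem Blowup.rot {G : Dgraph V} {A B C : Set V} (h : G.Blowup A B C) : G.Blowup B C A :=
  ⟨fun x => by have := h.cover x; tauto, h.bc, h.ca, h.ab, h.nb, h.nc, h.na⟩

theorem Blowup.interval {G : Dgraph V} {A B C : Set V} (h : G.Blowup A B C) : G.IsInterval A := by
  intro x hx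
  rcases h.cover x with h' | h' | h'
  · exact absurd h' hx
  · exact Or.inr (Or.inl fun y hy => h.ab y hy x h')
  · exact Or.inl fun y hy => h.ca x h' y hy

theorem Blowup.chain {G : Dgraph V} {A B C : Set V} (h : G.Blowup A B C) (hG : G.IsTournament)
    (hs : Small 4 G) : (G.ind A).IsChainD := by
  obtain ⟨b, hb⟩ := h.nb
  exact isChainD_ind (fun x _ y _ => hG x y) fun x hx y hy z hz hc =>
    hs.no_diamond' hc (h.ab x hx b hb) (h.ab y hy b hb) (h.ab z hz b hb)

theorem Blowup.selfDual_of_path {G : Dgraph V} {A B C : Set V} (h : G.Blowup A B C)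
    (hG : G.IsTournament) (hs : Small 6 G) (hfin : G.FiniteChains) {p p' p'' : V} (hp : p ∈ A)
    (hp' : p' ∈ A) (hp'' : p'' ∈ A) (h1 : G.To p p') (h2 : G.To p' p'') : SelfDual G := by
  classical
  have hs4 : Small 4 G := hs.mono (by norm_num)
  have hch := h.chain hG hs4
  obtain ⟨b, hb⟩ := h.nb
  obtain ⟨c, hc⟩ := h.nc
  have hne : p ≠ p'' := by rintro rfl; exact h1.asymm h2
  have h3 : G.To p p'' := (hG p p'' hne).resolve_right fun h' => hs4.no_diamond' ⟨h1, h2, h'⟩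
    (h.ab _ hp b hb) (h.ab _ hp' b hb) (h.ab _ hp'' b hb)
  have noB : ∀ x ∈ B, ∀ y ∈ B, ¬ G.To x y := fun x hx y hy hxy =>
    hs.no_blowup h1 h3 h2 hxy (h.ab _ hp x hx) (h.ab _ hp y hy) (h.ab _ hp' x hx)
      (h.ab _ hp' y hy) (h.ab _ hp'' x hx) (h.ab _ hp'' y hy) (h.bc x hx c hc) (h.bc y hy c hc)
      (h.ca c hc _ hp) (h.ca c hc _ hp') (h.ca c hc _ hp'')
  have noC : ∀ x ∈ C, ∀ y ∈ C, ¬ G.To x y := fun x hx y hy hxy =>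
    hs.no_blowup' h1 h3 h2 hxy (h.ca x hx _ hp) (h.ca y hy _ hp) (h.ca x hx _ hp')
      (h.ca y hy _ hp') (h.ca x hx _ hp'') (h.ca y hy _ hp'') (h.bc b hb x hx) (h.bc b hb y hy)
      (h.ab _ hp b hb) (h.ab _ hp' b hb) (h.ab _ hp'' b hb)
  have eqB : ∀ x ∈ B, x = b := fun x hx => by
    by_contra hne
    rcases hG x b hne with h' | h'
    · exact noB _ hx _ hb h'
    · exact noB _ hb _ hx h'
  have eqC : ∀ x ∈ C, x = c := fun x hx => by
    by_contra hne
    rcases hG x c hne with h' | h'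
    · exact noC _ hx _ hc h'
    · exact noC _ hc _ hx h'
  have hmem : ∀ x, x ∉ A → x = b ∨ x = c := fun x hx =>
    ((h.cover x).resolve_left hx).imp (eqB x) (eqC x)
  have := (hfin _ h.interval hch).to_subtype
  have hfix : ∀ x ∈ A, Equiv.swap b c x = x := fun x hx =>
    Equiv.swap_apply_of_ne_of_ne (h.ab x hx b hb).ne (h.ca c hc x hx).ne.symm
  refine Flip.selfDual (e := Equiv.swap b c) ⟨hfix, fun x y hxy => ?_⟩ h.interval hch.selfDual
  have arcs : ∀ {x y}, G.To x y → (G.Arc x y ↔ True) ∧ (G.Arc y x ↔ False) := fun h' =>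
    ⟨iff_true_intro h'.1, iff_false_intro h'.2⟩
  by_cases hx : x ∈ A
  · rw [hfix x hx]
    rcases hmem y fun hy => hxy ⟨hx, hy⟩ with rfl | rfl
    · rw [Equiv.swap_apply_left, (arcs (h.ab x hx _ hb)).1, (arcs (h.ca _ hc x hx)).1]
    · rw [Equiv.swap_apply_right, (arcs (h.ab x hx _ hb)).2, (arcs (h.ca _ hc x hx)).2]
  · by_cases hy : y ∈ A
    · rw [hfix y hy]
      rcases hmem x hx with rfl | rfl
      · rw [Equiv.swap_apply_left, (arcs (h.ab y hy _ hb)).2, (arcs (h.ca _ hc y hy)).2]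
      · rw [Equiv.swap_apply_right, (arcs (h.ab y hy _ hb)).1, (arcs (h.ca _ hc y hy)).1]
    · rcases hmem x hx with rfl | rfl <;> rcases hmem y hy with rfl | rfl <;> simp [G.irrefl]

theorem Blowup.selfDual {G : Dgraph V} {A B C : Set V} (h : G.Blowup A B C)
    (hG : G.IsTournament) (hs : Small 6 G) (hfin : G.FiniteChains) : SelfDual G := by
  by_cases pA : ∃ x ∈ A, ∃ y ∈ A, ∃ z ∈ A, G.To x y ∧ G.To y z
  · obtain ⟨x, hx, y, hy, z, hz, h1, h2⟩ := pA
    exact h.selfDual_of_path hG hs hfin hx hy hz h1 h2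
  by_cases pB : ∃ x ∈ B, ∃ y ∈ B, ∃ z ∈ B, G.To x y ∧ G.To y z
  · obtain ⟨x, hx, y, hy, z, hz, h1, h2⟩ := pB
    exact h.rot.selfDual_of_path hG hs hfin hx hy hz h1 h2
  by_cases pC : ∃ x ∈ C, ∃ y ∈ C, ∃ z ∈ C, G.To x y ∧ G.To y z
  · obtain ⟨x, hx, y, hy, z, hz, h1, h2⟩ := pC
    exact h.rot.rot.selfDual_of_path hG hs hfin hx hy hz h1 h2
  have two : ∀ {A : Set V}, A.Nonempty → (¬ ∃ x ∈ A, ∃ y ∈ A, ∃ z ∈ A, G.To x y ∧ G.To y z) →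
      ∃ y z, ∀ w ∈ A, w = y ∨ w = z := by
    rintro A ⟨x, hx⟩ hp
    have key : ∀ x ∈ A, ∀ y ∈ A, G.To x y → ∀ z ∈ A, z = x ∨ z = y := by
      intro x hx y hy hxy z hz
      by_contra hne
      push Not at hne
      rcases hG z x hne.1 with d | d
      · exact hp ⟨z, hz, x, hx, y, hy, d, hxy⟩
      rcases hG z y hne.2 with d' | d'
      · exact hp ⟨x, hx, z, hz, y, hy, d, d'⟩
      · exact hp ⟨x, hx, y, hy, z, hz, hxy, d'⟩
    by_cases hex : ∃ y ∈ A, y ≠ x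
    · obtain ⟨y, hy, hne⟩ := hex
      rcases hG y x hne with d | d
      · exact ⟨y, x, key _ hy _ hx d⟩
      · exact ⟨x, y, key _ hx _ hy d⟩
    · push Not at hex
      exact ⟨x, x, fun w hw => Or.inl (hex w hw)⟩
  obtain ⟨a, a', ha⟩ := two h.na pA
  obtain ⟨b, b', hb⟩ := two h.nb pB
  obtain ⟨c, c', hc⟩ := two h.nc pC
  refine hs.selfDual_of_surjective (p := ![a, a', b, b', c, c']) fun w => ?_
  rcases h.cover w with hw | hw | hw
  · rcases ha w hw with rfl | rfl
    exacts [⟨0, rfl⟩, ⟨1, rfl⟩]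
  · rcases hb w hw with rfl | rfl
    exacts [⟨2, rfl⟩, ⟨3, rfl⟩]
  · rcases hc w hw with rfl | rfl
    exacts [⟨4, rfl⟩, ⟨5, rfl⟩]

/-- The five points `v i` form the circular tournament with `i → i + 1, i + 2`. -/
def Circ (G : Dgraph V) (v : Fin 5 → V) : Prop :=
  ∀ i, G.To (v i) (v (i + 1)) ∧ G.To (v i) (v (i + 2))

theorem Circ.rot {G : Dgraph V} {v : Fin 5 → V} (h : G.Circ v) (k : Fin 5) :
    G.Circ fun i => v (k + i) := fun i => by
  have := h (k + i)
  rwa [add_assoc, add_assoc] at this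

/-- Outside `v i` itself, `x` is related to the points of `v` in the same way as `v i`. -/
def Twin (G : Dgraph V) (v : Fin 5 → V) (i : Fin 5) (x : V) : Prop :=
  G.To x (v (i + 1)) ∧ G.To x (v (i + 2)) ∧ G.To (v (i + 3)) x ∧ G.To (v (i + 4)) x

theorem Twin.rot {G : Dgraph V} {v : Fin 5 → V} {i : Fin 5} {x : V} (k : Fin 5)
    (h : G.Twin v (k + i) x) : G.Twin (fun i => v (k + i)) i x := by
  unfold Twin at h
  simp only [add_assoc] at h
  exact h

section
variable {G : Dgraph V} {v : Fin 5 → V}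

theorem Circ.exists_twin (hv : G.Circ v) (hG : G.IsTournament) (hs : Small 4 G) {x : V}
    (hx : ∀ i, x ≠ v i) : ∃ i, G.Twin v i x := by
  have out : ∀ i, ¬ (G.To x (v i) ∧ G.To x (v (i + 1)) ∧ G.To x (v (i + 3))) := fun i h =>
    hs.no_diamond ⟨(hv i).1, by simpa [add_assoc] using (hv (i + 1)).2,
      by simpa [add_assoc] using (hv (i + 3)).2⟩ h
  have inn : ∀ i, ¬ (G.To (v i) x ∧ G.To (v (i + 1)) x ∧ G.To (v (i + 3)) x) := fun i h =>
    hs.no_diamond' ⟨(hv i).1, by simpa [add_assoc] using (hv (i + 1)).2,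
      by simpa [add_assoc] using (hv (i + 3)).2⟩ h.1 h.2.1 h.2.2
  have key : ∀ i, G.To (v i) x ↔ ¬ G.To x (v i) := fun i =>
    ⟨fun h => h.asymm, fun h => (hG x (v i) (hx i)).resolve_left h⟩
  simp only [key] at inn
  unfold Twin
  simp only [key]
  generalize hP : (fun i => G.To x (v i)) = P
  have hP' : ∀ i, G.To x (v i) ↔ P i := fun i => by rw [← hP]
  simp only [hP'] at out inn ⊢
  clear * - out inn
  classical
  obtain ⟨Q, hQ⟩ : ∃ Q : Fin 5 → Bool, ∀ i, P i ↔ Q i = true :=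
    ⟨fun i => decide (P i), fun i => by simp⟩
  simp only [hQ] at out inn ⊢
  clear hQ
  revert Q
  decide

theorem Circ.not_twin_twin (hv : G.Circ v) (hG : G.IsTournament) (hs : Small 6 G) {x y : V}
    (hx : ∀ i, x ≠ v i) (hy : ∀ i, y ≠ v i) (hxy : x ≠ y) (h1 : G.Twin v 0 x)
    (h2 : G.Twin v 0 y) : False := by
  have hs4 : Small 4 G := hs.mono (by norm_num)
  have a1 : G.To (v 0) (v 1) := (hv 0).1
  have a2 : G.To (v 0) (v 2) := (hv 0).2
  have a3 : G.To (v 1) (v 2) := (hv 1).1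
  have a4 : G.To (v 1) (v 3) := (hv 1).2
  have a5 : G.To (v 2) (v 3) := (hv 2).1
  have a6 : G.To (v 3) (v 0) := (hv 3).2
  obtain ⟨b1, b2, b3, b4⟩ : G.To x (v 1) ∧ G.To x (v 2) ∧ G.To (v 3) x ∧ G.To (v 4) x := h1
  obtain ⟨c1, c2, c3, c4⟩ : G.To y (v 1) ∧ G.To y (v 2) ∧ G.To (v 3) y ∧ G.To (v 4) y := h2
  have key : ∀ {p q r : V}, G.To p q → G.To q r → G.To p (v 1) → G.To q (v 1) → G.To r (v 1) →
      G.To p (v 2) → G.To q (v 2) → G.To r (v 2) → G.To (v 3) p → G.To (v 3) q → G.To (v 3) r →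
      False := by
    intro p q r pq qr p1 q1 r1 p2 q2 r2 p3 q3 r3
    have hne : p ≠ r := by rintro rfl; exact pq.asymm qr
    have pr : G.To p r := (hG p r hne).resolve_right fun h' =>
      hs4.no_diamond' ⟨pq, qr, h'⟩ p1 q1 r1
    exact hs.no_blowup pq pr qr a3 p1 p2 q1 q2 r1 r2 a4 a5 p3 q3 r3
  rcases hG x (v 0) (hx 0) with d1 | d1 <;> rcases hG y (v 0) (hy 0) with d2 | d2 <;>
    rcases hG x y hxy with d3 | d3
  · exact key d3 d2 b1 c1 a1 b2 c2 a2 b3 c3 a6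
  · exact key d3 d1 c1 b1 a1 c2 b2 a2 c3 b3 a6
  · exact key d1 d2 b1 a1 c1 b2 a2 c2 b3 a6 c3
  · exact key d1 d2 b1 a1 c1 b2 a2 c2 b3 a6 c3
  · exact key d2 d1 c1 a1 b1 c2 a2 b2 c3 a6 b3
  · exact key d2 d1 c1 a1 b1 c2 a2 b2 c3 a6 b3
  · exact key d1 d3 a1 b1 c1 a2 b2 c2 a6 b3 c3
  · exact key d2 d3 a1 c1 b1 a2 c2 b2 a6 c3 b3

theorem Circ.not_twin_next (hv : G.Circ v) (hG : G.IsTournament) (hs : Small 6 G) {x y : V}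
    (hx : ∀ i, x ≠ v i) (hy : ∀ i, y ≠ v i) (hxy : x ≠ y) (h1 : G.Twin v 0 x)
    (h2 : G.Twin v 1 y) : False := by
  have hs4 : Small 4 G := hs.mono (by norm_num)
  have a1 : G.To (v 0) (v 1) := (hv 0).1
  have a2 : G.To (v 0) (v 2) := (hv 0).2
  have a3 : G.To (v 1) (v 2) := (hv 1).1
  have a4 : G.To (v 1) (v 3) := (hv 1).2
  have a5 : G.To (v 2) (v 3) := (hv 2).1
  have a6 : G.To (v 3) (v 0) := (hv 3).2
  obtain ⟨b1, b2, b3, b4⟩ : G.To x (v 1) ∧ G.To x (v 2) ∧ G.To (v 3) x ∧ G.To (v 4) x := h1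
  obtain ⟨c1, c2, c3, c4⟩ : G.To y (v 2) ∧ G.To y (v 3) ∧ G.To (v 4) y ∧ G.To (v 0) y := h2
  rcases hG x y hxy with d | d
  · rcases hG y (v 1) (hy 1) with e | e <;> rcases hG x (v 0) (hx 0) with f | f
    · exact hs.no_blowup' e c1 a3 f d c4 b1 a1 b2 a2 b3 a6 c2 a4 a5
    · exact hs.no_blowup' e c1 a3 f c4 d a1 b1 a2 b2 a6 b3 c2 a4 a5
    · exact hs.no_blowup' e a3 c1 f b1 a1 d c4 b2 a2 b3 a6 a4 c2 a5
    · exact hs.no_blowup' e a3 c1 f a1 b1 c4 d a2 b2 a6 b3 a4 c2 a5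
  · exact hs4.no_diamond' ⟨c2, (hv 3).1, c3⟩ d b3 b4

theorem Circ.twin_opp (hv : G.Circ v) (hG : G.IsTournament) (hs : Small 6 G) {x y : V}
    (hx : ∀ i, x ≠ v i) (hy : ∀ i, y ≠ v i) (hxy : x ≠ y) (h1 : G.Twin v 0 x)
    (h2 : G.Twin v 2 y) : G.To y x ∧ G.To x (v 0) ∧ G.To (v 2) y := by
  have hs4 : Small 4 G := hs.mono (by norm_num)
  have a1 : G.To (v 0) (v 1) := (hv 0).1
  have a2 : G.To (v 0) (v 2) := (hv 0).2
  have a3 : G.To (v 1) (v 2) := (hv 1).1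
  have a4 : G.To (v 1) (v 3) := (hv 1).2
  have a5 : G.To (v 2) (v 3) := (hv 2).1
  have a6 : G.To (v 3) (v 0) := (hv 3).2
  obtain ⟨b1, b2, b3, b4⟩ : G.To x (v 1) ∧ G.To x (v 2) ∧ G.To (v 3) x ∧ G.To (v 4) x := h1
  obtain ⟨c1, c2, c3, c4⟩ : G.To y (v 3) ∧ G.To y (v 4) ∧ G.To (v 0) y ∧ G.To (v 1) y := h2
  have h3 : G.To y x := by
    refine (hG x y hxy).resolve_left fun d => ?_
    rcases hG x (v 0) (hx 0) with f | f <;> rcases hG y (v 2) (hy 2) with e | e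
    · exact hs.no_blowup' c4 a3 e f b1 a1 d c3 b2 a2 b3 a6 a4 c1 a5
    · exact hs.no_blowup' a3 c4 e f b1 a1 b2 a2 d c3 b3 a6 a4 a5 c1
    · exact hs.no_blowup' c4 a3 e f a1 b1 c3 d a2 b2 a6 b3 a4 c1 a5
    · exact hs.no_blowup' a3 c4 e f a1 b1 a2 b2 c3 d a6 b3 a4 a5 c1
  refine ⟨h3, (hG x (v 0) (hx 0)).resolve_right fun d => ?_,
    (hG y (v 2) (hy 2)).resolve_left fun d => ?_⟩
  · exact hs4.no_diamond ⟨h3, b1, c4⟩ ⟨c3, d, a1⟩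
  · exact hs4.no_diamond' ⟨b1, c4, h3⟩ b2 a3 d

theorem Circ.twin_sub (hv : G.Circ v) (hG : G.IsTournament) (hs : Small 6 G) {x y : V}
    (hx : ∀ i, x ≠ v i) (hy : ∀ i, y ≠ v i) (hxy : x ≠ y) {i j : Fin 5} (h1 : G.Twin v i x)
    (h2 : G.Twin v j y) : j = i + 2 ∨ i = j + 2 := by
  have key : ∀ i j : Fin 5, j = i + 0 ∨ j = i + 1 ∨ i = j + 1 ∨ j = i + 2 ∨ i = j + 2 := by decide
  rcases key i j with rfl | rfl | rfl | h | h
  · exact ((hv.rot i).not_twin_twin hG hs (fun _ => hx _) (fun _ => hy _) hxy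
      (Twin.rot i (by simpa using h1)) (h2.rot i)).elim
  · exact ((hv.rot i).not_twin_next hG hs (fun _ => hx _) (fun _ => hy _) hxy
      (Twin.rot i (by simpa using h1)) (h2.rot i)).elim
  · exact ((hv.rot j).not_twin_next hG hs (fun _ => hy _) (fun _ => hx _) hxy.symm
      (Twin.rot j (by simpa using h2)) (h1.rot j)).elim
  · exact Or.inl h
  · exact Or.inr h

theorem Circ.selfDual_of_twin (hv : G.Circ v) (hG : G.IsTournament) (hs : Small 6 G) {x y : V}
    (hx : ∀ i, x ≠ v i) (hy : ∀ i, y ≠ v i) (hxy : x ≠ y) (h1 : G.Twin v 0 x)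
    (h2 : G.Twin v 2 y) (hall : ∀ w, (∃ i, w = v i) ∨ w = x ∨ w = y) : SelfDual G := by
  obtain ⟨d1, d2, d3⟩ := hv.twin_opp hG hs hx hy hxy h1 h2
  have a1 : G.To (v 0) (v 1) := (hv 0).1
  have a2 : G.To (v 0) (v 2) := (hv 0).2
  have a3 : G.To (v 1) (v 2) := (hv 1).1
  have a4 : G.To (v 1) (v 3) := (hv 1).2
  have a5 : G.To (v 2) (v 3) := (hv 2).1
  have a6 : G.To (v 2) (v 4) := (hv 2).2
  have a7 : G.To (v 3) (v 4) := (hv 3).1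
  have a8 : G.To (v 3) (v 0) := (hv 3).2
  have a9 : G.To (v 4) (v 0) := (hv 4).1
  have a10 : G.To (v 4) (v 1) := (hv 4).2
  obtain ⟨b1, b2, b3, b4⟩ : G.To x (v 1) ∧ G.To x (v 2) ∧ G.To (v 3) x ∧ G.To (v 4) x := h1
  obtain ⟨c1, c2, c3, c4⟩ : G.To y (v 3) ∧ G.To y (v 4) ∧ G.To (v 0) y ∧ G.To (v 1) y := h2
  have hmod : Model G ![v 0, v 1, v 2, y, v 3, v 4, x] (edges [(0, 1), (0, 2), (0, 3), (1, 2),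
      (1, 3), (1, 4), (2, 3), (2, 4), (2, 5), (3, 4), (3, 5), (3, 6), (4, 5), (4, 6), (4, 0),
      (5, 6), (5, 0), (5, 1), (6, 0), (6, 1), (6, 2)]) :=
    Model.of_edges _ [] (by decide) (by simp [*]) (by simp)
  refine hmod.selfDual (fun w => ?_) ![0, 6, 5, 4, 3, 2, 1] (by decide) (by decide) ?_
  · rcases hall w with ⟨i, rfl⟩ | rfl | rfl
    · fin_cases i
      exacts [⟨0, rfl⟩, ⟨1, rfl⟩, ⟨2, rfl⟩, ⟨4, rfl⟩, ⟨5, rfl⟩]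
    exacts [⟨6, rfl⟩, ⟨3, rfl⟩]
  · intro i j hij e1 e2
    exact absurd ⟨e1, e2⟩ ((by decide : ∀ i j : Fin 7, i ≠ j → ¬ (edges [(0, 1), (0, 2), (0, 3),
      (1, 2), (1, 3), (1, 4), (2, 3), (2, 4), (2, 5), (3, 4), (3, 5), (3, 6), (4, 5), (4, 6),
      (4, 0), (5, 6), (5, 0), (5, 1), (6, 0), (6, 1), (6, 2)] i j = false ∧ edges [(0, 1), (0, 2),
      (0, 3), (1, 2), (1, 3), (1, 4), (2, 3), (2, 4), (2, 5), (3, 4), (3, 5), (3, 6), (4, 5),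
      (4, 6), (4, 0), (5, 6), (5, 0), (5, 1), (6, 0), (6, 1), (6, 2)] j i = false)) i j hij)

theorem Circ.selfDual (hv : G.Circ v) (hG : G.IsTournament) (hs : Small 6 G) : SelfDual G := by
  have hs4 : Small 4 G := hs.mono (by norm_num)
  by_cases h1 : ∃ x y, (∀ i, x ≠ v i) ∧ (∀ i, y ≠ v i) ∧ x ≠ y
  · obtain ⟨x, y, hx, hy, hxy⟩ := h1
    obtain ⟨i, hi⟩ := hv.exists_twin hG hs4 hx
    obtain ⟨j, hj⟩ := hv.exists_twin hG hs4 hy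
    have hall : ∀ w, (∃ i, w = v i) ∨ w = x ∨ w = y := by
      intro w
      by_contra hw
      push Not at hw
      obtain ⟨k, hk⟩ := hv.exists_twin hG hs4 hw.1
      have e1 := hv.twin_sub hG hs hx hy hxy hi hj
      have e2 := hv.twin_sub hG hs hw.1 hx hw.2.1 hk hi
      have e3 := hv.twin_sub hG hs hw.1 hy hw.2.2 hk hj
      clear * - e1 e2 e3
      revert i j k
      decide
    have shift : ∀ k w, (∃ i, w = v i) → ∃ i, w = v (k + i) := by
      rintro k w ⟨i, rfl⟩
      exact ⟨i - k, by rw [add_sub_cancel]⟩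
    rcases hv.twin_sub hG hs hx hy hxy hi hj with rfl | rfl
    · exact (hv.rot i).selfDual_of_twin hG hs (fun _ => hx _) (fun _ => hy _) hxy
        (Twin.rot i (by simpa using hi)) (hj.rot i) fun w => (hall w).imp_left (shift i w)
    · exact (hv.rot j).selfDual_of_twin hG hs (fun _ => hy _) (fun _ => hx _) hxy.symm
        (Twin.rot j (by simpa using hj)) (hi.rot j) fun w => (hall w).imp (shift j w) Or.symm
  push Not at h1
  obtain ⟨x, hx⟩ : ∃ x, ∀ w, (∃ i, w = v i) ∨ w = x := by
    by_cases h2 : ∃ x, ∀ i, x ≠ v i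
    · obtain ⟨x, hx⟩ := h2
      refine ⟨x, fun w => or_iff_not_imp_left.2 fun hw => ?_⟩
      push Not at hw
      exact h1 w x hw hx
    · push Not at h2
      exact ⟨v 0, fun w => Or.inl (h2 w)⟩
  refine hs.selfDual_of_surjective (p := ![v 0, v 1, v 2, v 3, v 4, x]) fun w => ?_
  rcases hx w with ⟨i, rfl⟩ | rfl
  · fin_cases i
    exacts [⟨0, rfl⟩, ⟨1, rfl⟩, ⟨2, rfl⟩, ⟨3, rfl⟩, ⟨4, rfl⟩]
  · exact ⟨5, rfl⟩

end

theorem circ_of_cyc {G : Dgraph V} (hG : G.IsTournament) (hs : Small 4 G) {a b c x y : V}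
    (hc : G.Cyc a b c) (hx : G.To x b ∧ G.To c x) (hy : G.To y c ∧ G.To a y) (hyx : G.To y x) :
    G.Circ ![x, a, b, y, c] := by
  obtain ⟨h1, h2, h3⟩ := hc
  have hby : G.To b y := by
    have hne : b ≠ y := by rintro rfl; exact hyx.asymm hx.1
    exact (hG b y hne).resolve_right fun h' => hs.no_diamond ⟨hx.1, h2, hx.2⟩ ⟨hyx, h', hy.1⟩
  have hxa : G.To x a := by
    have hne : x ≠ a := by rintro rfl; exact hyx.asymm hy.2
    exact (hG x a hne).resolve_right fun h' => hs.no_diamond ⟨hx.1, hby, hyx⟩ ⟨h', h1, hy.2⟩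
  intro i
  fin_cases i
  exacts [⟨hxa, hx.1⟩, ⟨h1, hy.2⟩, ⟨hby, h2⟩, ⟨hy.1, hyx⟩, ⟨hx.2, h3⟩]

/-- A diamond-free tournament whose subdigraphs on at most `6` vertices are self-dual is
self-dual. -/
theorem selfDual_of_isTournament {G : Dgraph V} (hG : G.IsTournament) (hs : Small 6 G)
    (hfin : G.FiniteChains) : SelfDual G := by
  have hs4 : Small 4 G := hs.mono (by norm_num)
  by_cases hcyc : ∃ a b c, G.Cyc a b c
  · obtain ⟨a, b, c, hc⟩ := hcyc
    by_contra hn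
    have fwd : ∀ {a b c : V}, G.Cyc a b c → ∀ x, G.To x b ∧ G.To c x → ∀ y,
        G.To y c ∧ G.To a y → G.To x y := by
      intro a b c hc x hx y hy
      have hne : x ≠ y := by rintro rfl; exact hx.2.asymm hy.1
      exact (hG x y hne).resolve_right fun h' =>
        hn ((circ_of_cyc hG hs4 hc hx hy h').selfDual hG hs)
    have hblow : G.Blowup {x | G.To x b ∧ G.To c x} {x | G.To x c ∧ G.To a x}
        {x | G.To x a ∧ G.To b x} := by
      refine ⟨fun x => ?_, fwd hc, fwd hc.rot, fwd hc.rot.rot, ⟨a, hc.1, hc.2.2⟩,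
        ⟨b, hc.2.1, hc.1⟩, ⟨c, hc.2.2, hc.2.1⟩⟩
      by_cases ea : x = a
      · exact Or.inl ⟨ea ▸ hc.1, ea ▸ hc.2.2⟩
      by_cases eb : x = b
      · exact Or.inr (Or.inl ⟨eb ▸ hc.2.1, eb ▸ hc.1⟩)
      by_cases ec : x = c
      · exact Or.inr (Or.inr ⟨ec ▸ hc.2.2, ec ▸ hc.2.1⟩)
      have k1 := hs4.no_diamond (d := x) hc
      have k2 := hs4.no_diamond' (d := x) hc
      rcases hG x a ea with p | p <;> rcases hG x b eb with q | q <;>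
        rcases hG x c ec with r | r
      · exact (k1 ⟨p, q, r⟩).elim
      · exact Or.inl ⟨q, r⟩
      · exact Or.inr (Or.inr ⟨p, q⟩)
      · exact Or.inr (Or.inr ⟨p, q⟩)
      · exact Or.inr (Or.inl ⟨r, p⟩)
      · exact Or.inl ⟨q, r⟩
      · exact Or.inr (Or.inl ⟨r, p⟩)
      · exact (k2 p q r).elim
    exact hn (hblow.selfDual hG hs hfin)
  · push Not at hcyc
    have hch := isChainD_of_no_cyc hG hcyc
    have hcu : (G.ind univ).IsChainD :=
      ⟨fun x y hxy => hch.1 x y fun h' => hxy (Subtype.ext h'), fun x y z => hch.2 x y z⟩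
    have := Set.finite_univ_iff.1 (hfin univ (fun x hx => absurd (mem_univ x) hx) hcu)
    exact hch.selfDual

/-! ### Pairs of hemimorphic digraphs -/

/-- `G` has no flags or peaks, and `G'` is `(≤ 5)`-hemimorphic to `G`. -/
structure Good (G G' : Dgraph V) : Prop where
  small : Small 3 G
  hemi : ∀ X : Set V, X.Finite → X.ncard ≤ 5 → Hemi (G.ind X) (G'.ind X)

/-- `{x, y}` is directed in opposite ways in `G` and `G'`. -/
def Rev (G G' : Dgraph V) (x y : V) : Prop :=
  (G.To x y ∧ G'.To y x) ∨ (G.To y x ∧ G'.To x y)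

/-- The equivalence relation generated by `Rev`. -/
def RevRel (G G' : Dgraph V) : V → V → Prop := Relation.ReflTransGen (Rev G G')

section
variable {G G' : Dgraph V} {x y z : V}

theorem Rev.symm (h : Rev G G' x y) : Rev G G' y x := Or.symm h

theorem Rev.dual (h : Rev G G' x y) : Rev G.dual G'.dual x y := h.symm

theorem Rev.dir (h : Rev G G' x y) : G.Dir x y := h.imp And.left And.left

theorem Rev.not_rev_dual (h : Rev G G' x y) : ¬ Rev G G'.dual x y := by
  rintro h'
  rcases h with h | h <;> rcases h' with h' | h'
  · exact h.2.asymm h'.2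
  · exact h.1.asymm h'.1
  · exact h.1.asymm h'.1
  · exact h.2.asymm h'.2

theorem Rev.to_iff (h : Rev G G' x y) : G.To x y ↔ G'.To y x := by
  rcases h with h | h
  · exact iff_of_true h.1 h.2
  · exact iff_of_false h.1.asymm h.2.asymm

theorem RevRel.symm (h : RevRel G G' x y) : RevRel G G' y x := by
  have : Std.Symm (Rev G G') := ⟨fun _ _ => Rev.symm⟩
  exact (Relation.ReflTransGen.stdSymm (r := Rev G G')).symm _ _ h

theorem RevRel.dual (h : RevRel G G' x y) : RevRel G.dual G'.dual x y :=
  Relation.ReflTransGen.mono (fun _ _ => Rev.dual) _ _ h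

theorem Good.dual_right (h : Good G G') : Good G G'.dual :=
  ⟨h.small, fun X hX hc => (h.hemi X hX hc).dual_right⟩

theorem Good.dual (h : Good G G') : Good G.dual G'.dual :=
  ⟨h.small.dual, fun X hX hc => (h.hemi X hX hc).imp Iso.dual Iso.dual⟩

theorem Good.symm (h : Good G G') : Good G' G := by
  refine ⟨fun X hX hc => ?_, fun X hX hc => (h.hemi X hX hc).symm⟩
  have hs := h.small X hX hc
  rcases h.hemi X hX (hc.trans (by norm_num)) with h' | h'
  · exact hs.of_iso h'.symm
  · exact hs.dual.of_iso h'.symm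

theorem Good.ind (h : Good G G') (X : Set V) : Good (G.ind X) (G'.ind X) := by
  refine ⟨h.small.ind X, fun Y hY hc => ?_⟩
  refine Hemi.congr (ind_ind_iso G X Y).symm (ind_ind_iso G' X Y).symm (h.hemi _ (hY.image _) ?_)
  rwa [ncard_image_of_injective _ Subtype.val_injective]

theorem Good.exists_perm (h : Good G G') {n : ℕ} (hn : n ≤ 5) {p : Fin n → V}
    (hp : Injective p) : ∃ σ : Fin n → Fin n, Injective σ ∧
      ((∀ i j, G.Arc (p i) (p j) ↔ G'.Arc (p (σ i)) (p (σ j))) ∨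
        ∀ i j, G.Arc (p j) (p i) ↔ G'.Arc (p (σ i)) (p (σ j))) := by
  rcases h.hemi (range p) (finite_range p) ((ncard_range_fin hp).trans_le hn) with h' | h'
  · obtain ⟨σ, hσ, hσ'⟩ := iso_ind_range hp hp h'
    exact ⟨σ, hσ, Or.inl hσ'⟩
  · obtain ⟨σ, hσ, hσ'⟩ := iso_ind_range (G := G.dual) hp hp h'
    exact ⟨σ, hσ, Or.inr hσ'⟩

theorem Good.pair (h : Good G G') (x y : V) : (G.Dir x y ↔ G'.Dir x y) ∧
    (¬ G.Dir x y → (G.Arc x y ↔ G'.Arc x y)) := by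
  by_cases hxy : x = y
  · subst hxy
    simp [Dir, G.irrefl, G'.irrefl]
  have hp : Injective ![x, y] := by
    intro i j
    fin_cases i <;> fin_cases j <;> simp [hxy, Ne.symm hxy]
  obtain ⟨σ, hσ, hσ'⟩ := h.exists_perm (by norm_num) hp
  have hne := hσ.ne (show (0 : Fin 2) ≠ 1 by decide)
  have key : ∀ a b : Fin 2, a ≠ b → (a = 0 ∧ b = 1) ∨ (a = 1 ∧ b = 0) := by decide
  rcases hσ' with hσ' | hσ' <;> have h01 := hσ' 0 1 <;> have h10 := hσ' 1 0 <;>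
    rcases key _ _ hne with ⟨h0, h1⟩ | ⟨h0, h1⟩ <;> simp [h0, h1] at h01 h10 <;>
    simp only [Dir, h01, h10] <;> tauto

theorem Good.dir_iff (h : Good G G') : G.Dir x y ↔ G'.Dir x y := (h.pair x y).1

theorem Good.rev_or_rev (h : Good G G') (hd : G.Dir x y) : Rev G G' x y ∨ Rev G G'.dual x y := by
  have h1 : G.To x y ∨ G.To y x := hd
  have h2 : G'.To x y ∨ G'.To y x := h.dir_iff.1 hd
  have h3 : ∀ x y, G'.dual.To x y ↔ G'.To y x := fun _ _ => Iff.rfl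
  unfold Rev
  rw [h3, h3]
  tauto

theorem Good.arc_iff (h : Good G G') (hr : ¬ Rev G G' x y) : G.Arc x y ↔ G'.Arc x y := by
  by_cases hd : G.Dir x y
  · rcases (h.rev_or_rev hd).resolve_left hr with h' | h'
    · exact iff_of_true h'.1.1 h'.2.1
    · exact iff_of_false h'.1.2 h'.2.2
  · exact (h.pair x y).2 hd

theorem Good.cyc (h : Good G G') (hc : G.Cyc x y z) : G'.Cyc x y z ∨ G'.Cyc z y x := by
  obtain ⟨σ, hσ, hσ'⟩ := h.exists_perm (by norm_num)
    (injective_three hc.1.ne hc.2.2.ne.symm hc.2.1.ne)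
  obtain ⟨⟨a1, b1⟩, ⟨a2, b2⟩, ⟨a3, b3⟩⟩ := hc
  have n01 := hσ.ne (show (0 : Fin 3) ≠ 1 by decide)
  have n02 := hσ.ne (show (0 : Fin 3) ≠ 2 by decide)
  have n12 := hσ.ne (show (1 : Fin 3) ≠ 2 by decide)
  have key : ∀ a b c : Fin 3, a ≠ b → a ≠ c → b ≠ c → (a = 0 ∧ b = 1 ∧ c = 2) ∨
      (a = 0 ∧ b = 2 ∧ c = 1) ∨ (a = 1 ∧ b = 0 ∧ c = 2) ∨ (a = 1 ∧ b = 2 ∧ c = 0) ∨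
      (a = 2 ∧ b = 0 ∧ c = 1) ∨ (a = 2 ∧ b = 1 ∧ c = 0) := by decide
  have hk := key _ _ _ n01 n02 n12
  unfold Cyc To
  rcases hσ' with hσ' | hσ' <;>
  · have h01 := hσ' 0 1
    have h02 := hσ' 0 2
    have h12 := hσ' 1 2
    have h10 := hσ' 1 0
    have h20 := hσ' 2 0
    have h21 := hσ' 2 1
    rcases hk with ⟨e0, e1, e2⟩ | ⟨e0, e1, e2⟩ | ⟨e0, e1, e2⟩ | ⟨e0, e1, e2⟩ | ⟨e0, e1, e2⟩ |
      ⟨e0, e1, e2⟩ <;> simp [e0, e1, e2] at h01 h02 h12 h10 h20 h21 <;> simp_all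

theorem Good.rev_of_cyc (h : Good G G') (hc : G.Cyc x y z) :
    (Rev G G' x y ∧ Rev G G' y z ∧ Rev G G' z x) ∨
      (Rev G G'.dual x y ∧ Rev G G'.dual y z ∧ Rev G G'.dual z x) := by
  rcases h.cyc hc with hcyc | hcyc
  · exact Or.inr ⟨Or.inl ⟨hc.1, hcyc.1⟩, Or.inl ⟨hc.2.1, hcyc.2.1⟩, Or.inl ⟨hc.2.2, hcyc.2.2⟩⟩
  · exact Or.inl ⟨Or.inl ⟨hc.1, hcyc.2.1⟩, Or.inl ⟨hc.2.1, hcyc.1⟩, Or.inl ⟨hc.2.2, hcyc.2.2⟩⟩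

/-! ### Triples of vertices -/

theorem Good.dir_of_rev (h : Good G G') (h1 : Rev G G' x y) (h2 : Rev G G'.dual x z) :
    G.Dir y z := by
  have hne : y ≠ z := by rintro rfl; exact h1.not_rev_dual h2
  have hs' := h.symm.small
  rcases h1 with h1 | h1 <;> rcases h2 with h2 | h2
  · exact h.small.no_peak_out hne h1.1 h2.1
  · exact h.dir_iff.2 (hs'.no_peak_in hne h1.2 h2.2)
  · exact h.dir_iff.2 (hs'.no_peak_out hne h1.2 h2.2)
  · exact h.small.no_peak_in hne h1.1 h2.1

/-- If `{x, y}` and `{x, z}` are reversed but not `{y, z}`, then `x` does not separate `y`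
from `z`. -/
theorem Good.to_iff_of_apex (h : Good G G') (h1 : Rev G G' x y) (h2 : Rev G G' x z)
    (h3 : Rev G G'.dual y z) : G.To x y ↔ G.To x z := by
  have key : ∀ {y z}, Rev G G' x y → Rev G G' x z → Rev G G'.dual y z → G.To x y → G.To x z := by
    intro y z h1 h2 h3 hxy
    by_contra hn
    have hzx : G.To z x := (Or.resolve_left (show G.To x z ∨ G.To z x from h2.dir) hn)
    have h1' := h1.to_iff.1 hxy
    have h2' := h2.symm.to_iff.1 hzx
    rcases h3 with h3 | h3
    · rcases h.rev_of_cyc ⟨hxy, h3.1, hzx⟩ with h' | h'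
      · exact h'.2.1.not_rev_dual (Or.inl h3)
      · exact h1.not_rev_dual h'.1
    · have h3' : G'.To z y := h3.2
      rcases h.symm.cyc ⟨h2', h3', h1'⟩ with h' | h'
      · exact h'.2.2.asymm hxy
      · exact h'.1.asymm h3.1
  exact ⟨key h1 h2 h3, key h2 h1 h3.symm⟩

/-- If `{x, y}` is reversed and neither `{z, x}` nor `{z, y}` is, then `z` does not separate `x`
from `y`. -/
theorem Good.arc_iff_of_base (h : Good G G') (h1 : Rev G G' x y) (h2 : ¬ Rev G G' z x)
    (h3 : ¬ Rev G G' z y) (hzx : z ≠ x) (hzy : z ≠ y) : G.Arc z x ↔ G.Arc z y := by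
  by_cases d1 : G.Dir z x
  · have s1 := (h.rev_or_rev d1).resolve_left h2
    have d2 : G.Dir z y := (h.dir_of_rev h1 s1.symm).symm
    have s2 := (h.rev_or_rev d2).resolve_left h3
    have := h.dual_right.to_iff_of_apex s1 s2 h1
    have e1 : G.To z x ∨ G.To x z := d1
    have e2 : G.To z y ∨ G.To y z := d2
    unfold To at *
    tauto
  · by_cases d2 : G.Dir z y
    · exact absurd (h.dir_of_rev h1.symm ((h.rev_or_rev d2).resolve_left h3).symm).symm d1
    · exact h.small.no_flag h1.dir d1 d2 hzx hzy

/-! ### Classes -/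

theorem Good.arc_iff_of_revRel (h : Good G G') (hz : ¬ RevRel G G' x z) (hy : RevRel G G' x y) :
    (G.Arc z x ↔ G.Arc z y) ∧ (G.Arc x z ↔ G.Arc y z) := by
  induction hy with
  | refl => simp
  | @tail p q hp hpq ih =>
    have n1 : ¬ Rev G G' z p := fun h' => hz (hp.tail h'.symm)
    have n2 : ¬ Rev G G' z q := fun h' => hz ((hp.tail hpq).tail h'.symm)
    have n3 : z ≠ p := by rintro rfl; exact hz hp
    have n4 : z ≠ q := by rintro rfl; exact hz (hp.tail hpq)
    exact ⟨ih.1.trans (h.arc_iff_of_base hpq n1 n2 n3 n4),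
      ih.2.trans (h.dual.arc_iff_of_base hpq.dual (fun h' => n1 h'.dual)
        (fun h' => n2 h'.dual) n3 n4)⟩

theorem Good.isInterval_class (h : Good G G') (x : V) : G.IsInterval {y | RevRel G G' x y} := by
  rw [isInterval_iff]
  intro w hw y hy z hz
  have h1 := h.arc_iff_of_revRel hw hy
  have h2 := h.arc_iff_of_revRel hw hz
  exact ⟨h1.1.symm.trans h2.1, h1.2.symm.trans h2.2⟩

/-- A proper class is `G`-connected to some vertex outside. -/
theorem Good.exists_outside (h : Good G G') (hG : G.ArcConnected) {x z : V}
    (hz : ¬ RevRel G G' x z) :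
    ∃ w, ¬ RevRel G G' x w ∧ ∀ y, RevRel G G' x y → Rev G G'.dual w y := by
  obtain ⟨p, w, hp, hw, hpw⟩ : ∃ p w, RevRel G G' x p ∧ ¬ RevRel G G' x w ∧ G.Dir p w := by
    by_contra hcon
    push Not at hcon
    apply hz
    clear hz
    have := hG x z
    induction this with
    | refl => exact .refl
    | @tail p q _ hpq ih =>
      by_contra hq
      exact hcon p q ih hq hpq
  refine ⟨w, hw, fun y hy => ?_⟩
  have e1 := h.arc_iff_of_revRel hw hp
  have e2 := h.arc_iff_of_revRel hw hy
  have hd : G.Dir w y := by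
    unfold Dir at hpw ⊢
    rw [← e2.1, ← e2.2, e1.1, e1.2]
    exact hpw.symm
  exact (h.rev_or_rev hd).resolve_left fun h' => hw (hy.tail h'.symm)

theorem Good.revRel_dual (h : Good G G') (hG : G.ArcConnected) {a b : V}
    (hab : ¬ RevRel G G' a b) (x y : V) : RevRel G G'.dual x y := by
  have := hG x y
  induction this with
  | refl => exact .refl
  | @tail p q _ hpq ih =>
    refine ih.trans ?_
    rcases h.rev_or_rev hpq with h' | h'
    · obtain ⟨z, hz⟩ : ∃ z, ¬ RevRel G G' p z := by
        by_contra hcon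
        push Not at hcon
        exact hab ((hcon a).symm.trans (hcon b))
      obtain ⟨w, -, hw⟩ := h.exists_outside hG hz
      exact (Relation.ReflTransGen.single (hw p .refl).symm).tail (hw q (.single h'))
    · exact .single h'

end

section
variable {G G' : Dgraph V} {x y z a b c d u v : V}

/-! ### Diamonds and classes -/

theorem exists_sink {H : Dgraph W} {H' : Dgraph U} (h : Hemi H H') {s t : U}
    (hs : ∀ z, z ≠ s → H'.To s z) (ht : ∀ z, z ≠ t → H'.To z t) :
    ∃ r, ∀ z, z ≠ r → H.To z r := by
  rcases h with ⟨e, he⟩ | ⟨e, he⟩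
  · refine ⟨e.symm t, fun z hz => ?_⟩
    have := ht (e z) fun h' => hz (by rw [← h', e.symm_apply_apply])
    unfold To
    rwa [he, he, e.apply_symm_apply]
  · refine ⟨e.symm s, fun z hz => ?_⟩
    have := hs (e z) fun h' => hz (by rw [← h', e.symm_apply_apply])
    have e1 : H.Arc z (e.symm s) ↔ _ := he (e.symm s) z
    have e2 : H.Arc (e.symm s) z ↔ _ := he z (e.symm s)
    unfold To
    rwa [e1, e2, e.apply_symm_apply]

theorem Good.no_stack (h : Good G G') (hyd : G.To y d) (hy : G.Dom y a b c)
    (hd : G.Dom d a b c) (hc : G.Cyc a b c) (hyd' : G'.To d y) (hd' : G'.Dom d a b c)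
    (ha : G'.To a y) (hb : G'.To b y) (hcy : G'.To c y) : False := by
  classical
  let X : Finset V := {y, d, a, b, c}
  have hX : ((X : Set V)).ncard ≤ 5 := by
    rw [ncard_coe_finset]
    exact Finset.card_le_five
  have hm : ∀ {w}, w ∈ (X : Set V) ↔ w = y ∨ w = d ∨ w = a ∨ w = b ∨ w = c := by
    intro w; simp [X]
  obtain ⟨⟨r, hr⟩, hsink⟩ := exists_sink (h.hemi X X.finite_toSet hX)
    (s := ⟨d, by simp [hm]⟩) (t := ⟨y, by simp [hm]⟩)
    (by
      rintro ⟨z, hz⟩ hne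
      have hne' : z ≠ d := fun h' => hne (Subtype.ext h')
      change G'.To d z
      rcases hm.1 hz with rfl | rfl | rfl | rfl | rfl
      exacts [hyd', absurd rfl hne', hd'.1, hd'.2.1, hd'.2.2])
    (by
      rintro ⟨z, hz⟩ hne
      have hne' : z ≠ y := fun h' => hne (Subtype.ext h')
      change G'.To z y
      rcases hm.1 hz with rfl | rfl | rfl | rfl | rfl
      exacts [absurd rfl hne', hyd', ha, hb, hcy])
  have key : ∀ z, z ∈ (X : Set V) → ¬ G.To r z := fun z hz hrz =>
    hrz.asymm (hsink ⟨z, hz⟩ fun h' => hrz.ne (congrArg Subtype.val h').symm)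
  rcases hm.1 hr with rfl | rfl | rfl | rfl | rfl
  · exact key d (by simp [hm]) hyd
  · exact key a (by simp [hm]) hd.1
  · exact key b (by simp [hm]) hc.1
  · exact key c (by simp [hm]) hc.2.1
  · exact key a (by simp [hm]) hc.2.2

/-- The pairs formed by `y` and the points of a non-reversed `3`-cycle are all reversed, or all
non-reversed. -/
theorem Good.mono_of_cyc (h : Good G G') (hc : G.Cyc a b c) (h1 : Rev G G'.dual a b)
    (h2 : Rev G G'.dual b c) (h3 : Rev G G'.dual c a) (da : G.Dir y a) (db : G.Dir y b)
    (dc : G.Dir y c) (ha : Rev G G'.dual y a → G.To y a) (hb : Rev G G'.dual y b → G.To y b)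
    (hc' : Rev G G'.dual y c → G.To y c) : (Rev G G' y a ∧ Rev G G' y b ∧ Rev G G' y c) ∨
      (Rev G G'.dual y a ∧ Rev G G'.dual y b ∧ Rev G G'.dual y c) := by
  have key : ∀ {p q}, Rev G G' y p → Rev G G'.dual y q → Rev G G'.dual q p → G.To y q →
      ¬ G.To q p := fun k1 k2 k3 k4 k5 =>
    k4.asymm ((h.dual_right.to_iff_of_apex k2.symm k3 k1).2 k5)
  rcases h.rev_or_rev da with ea | ea <;> rcases h.rev_or_rev db with eb | eb <;>
    rcases h.rev_or_rev dc with ec | ec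
  · exact Or.inl ⟨ea, eb, ec⟩
  · exact (key ea ec h3 (hc' ec) hc.2.2).elim
  · exact (key ec eb h2 (hb eb) hc.2.1).elim
  · exact (key ea ec h3 (hc' ec) hc.2.2).elim
  · exact (key eb ea h1 (ha ea) hc.1).elim
  · exact (key eb ea h1 (ha ea) hc.1).elim
  · exact (key ec eb h2 (hb eb) hc.2.1).elim
  · exact Or.inr ⟨ea, eb, ec⟩

/-- `d` dominates the `3`-cycle `a b c` both in `G` and in `G'`, up to the orientation of the
cycle. -/
def DomSame (G G' : Dgraph V) (d a b c : V) : Prop :=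
  G.Dom d a b c ∧ Rev G G'.dual d a ∧ Rev G G'.dual d b ∧ Rev G G'.dual d c

theorem Good.domSame_step (h : Good G G') (hc : G.Cyc a b c) (hd : DomSame G G' d a b c)
    (hdy : Rev G G' d y) : DomSame G G' y a b c := by
  obtain ⟨hd, sa, sb, sc⟩ := hd
  have da := (h.dir_of_rev hdy sa)
  have db := (h.dir_of_rev hdy sb)
  have dc := (h.dir_of_rev hdy sc)
  have ofS : ∀ {p}, G.To d p → Rev G G'.dual d p → Rev G G'.dual y p → G.To y p := by
    intro p hp k1 k2
    have := h.dual_right.to_iff_of_apex k1.symm k2.symm hdy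
    exact (show G.To y p ∨ G.To p y from k2.dir).resolve_right fun h' => hp.asymm (this.2 h')
  have ofD : ∀ {p}, Rev G G'.dual d p → Rev G G' y p → (G.To y d ↔ G.To y p) :=
    fun k1 k2 => h.to_iff_of_apex hdy.symm k2 k1
  have fin : Rev G G'.dual y a → Rev G G'.dual y b → Rev G G'.dual y c → DomSame G G' y a b c :=
    fun ea eb ec => ⟨⟨ofS hd.1 sa ea, ofS hd.2.1 sb eb, ofS hd.2.2 sc ec⟩, ea, eb, ec⟩
  have allD : Rev G G' y a → Rev G G' y b → Rev G G' y c → False := by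
    intro ea eb ec
    have hcc := h.cyc hc
    have to' : ∀ {p}, G.To d p → Rev G G'.dual d p → G'.To d p := fun hp k =>
      Rev.to_iff k |>.1 hp
    have hd' : G'.Dom d a b c := ⟨to' hd.1 sa, to' hd.2.1 sb, to' hd.2.2 sc⟩
    rcases show G.To y d ∨ G.To d y from hdy.symm.dir with hyd | hyd
    · have ya := (ofD sa ea).1 hyd
      have yb := (ofD sb eb).1 hyd
      have yc := (ofD sc ec).1 hyd
      exact h.no_stack hyd ⟨ya, yb, yc⟩ hd hc (hdy.symm.to_iff.1 hyd) hd' (ea.to_iff.1 ya)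
        (eb.to_iff.1 yb) (ec.to_iff.1 yc)
    · have hn : ∀ {p}, Rev G G'.dual d p → Rev G G' y p → G.To p y ∧ G'.To y p := by
        intro p k1 k2
        have hp : G.To p y := (show G.To y p ∨ G.To p y from k2.dir).resolve_left fun h' =>
          hyd.asymm ((ofD k1 k2).2 h')
        exact ⟨hp, k2.symm.to_iff.1 hp⟩
      have hyd' := hdy.to_iff.1 hyd
      have ka := hn sa ea
      have kb := hn sb eb
      have kc := hn sc ec
      rcases hcc with hcc | hcc
      · exact h.symm.no_stack hyd' ⟨ka.2, kb.2, kc.2⟩ hd' hcc hyd hd ka.1 kb.1 kc.1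
      · exact h.symm.no_stack hyd' ⟨kc.2, kb.2, ka.2⟩ ⟨hd'.2.2, hd'.2.1, hd'.1⟩ hcc hyd
          ⟨hd.2.2, hd.2.1, hd.1⟩ kc.1 kb.1 ka.1
  rcases h.rev_of_cyc hc with ⟨h1, h2, h3⟩ | ⟨h1, h2, h3⟩
  · have one : ∀ {p q r}, G.Cyc p q r → Rev G G' p q → Rev G G' r p → Rev G G' y p →
        Rev G G'.dual y q → ¬ Rev G G'.dual y r := by
      intro p q r hc k1 k3 ep eq er
      have e1 := h.to_iff_of_apex ep.symm k1 eq
      have e2 := h.to_iff_of_apex ep.symm k3.symm er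
      exact hc.2.2.asymm (e2.1 (e1.2 hc.1))
    have two : ∀ {p q r}, G.Cyc p q r → Rev G G' p q → Rev G G' q r → Rev G G'.dual d p →
        Rev G G'.dual d r → Rev G G' y p → Rev G G'.dual y q → ¬ Rev G G' y r := by
      intro p q r hc k1 k2 tp tr ep eq er
      have e1 := (h.to_iff_of_apex ep.symm k1 eq).2 hc.1
      have e2 := h.to_iff_of_apex er.symm k2.symm eq
      have e3 : G.To y r := (show G.To y r ∨ G.To r y from er.dir).resolve_right fun h' =>
        hc.2.1.asymm (e2.1 h')
      exact e1.asymm ((ofD tp ep).1 ((ofD tr er).2 e3))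
    rcases h.rev_or_rev da with ea | ea <;> rcases h.rev_or_rev db with eb | eb <;>
      rcases h.rev_or_rev dc with ec | ec
    · exact (allD ea eb ec).elim
    · exact (two hc.rot h2 h3 sb sa eb ec ea).elim
    · exact (two hc h1 h2 sa sc ea eb ec).elim
    · exact (one hc h1 h3 ea eb ec).elim
    · exact (two hc.rot.rot h3 h1 sc sb ec ea eb).elim
    · exact (one hc.rot h2 h1 eb ec ea).elim
    · exact (one hc.rot.rot h3 h2 ec ea eb).elim
    · exact fin ea eb ec
  · rcases h.mono_of_cyc hc h1 h2 h3 da db dc (ofS hd.1 sa) (ofS hd.2.1 sb) (ofS hd.2.2 sc) with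
      ⟨ea, eb, ec⟩ | ⟨ea, eb, ec⟩
    · exact (allD ea eb ec).elim
    · exact fin ea eb ec

theorem Good.not_dom (h : Good G G') (h1 : RevRel G G' d a) (h2 : RevRel G G'.dual d a)
    (hc : G.Cyc a b c) : ¬ G.Dom d a b c := by
  intro hd
  have core : ∀ {G' : Dgraph V}, Good G G' → RevRel G G' d a → ¬ DomSame G G' d a b c := by
    intro G' h h1 hds
    have key : ∀ y, RevRel G G' d y → DomSame G G' y a b c := by
      intro y hy
      induction hy with
      | refl => exact hds
      | tail _ hpq ih => exact h.domSame_step hc ih hpq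
    exact not_to_self _ _ (key a h1).1.1
  have hS : ¬ (Rev G G'.dual d a ∧ Rev G G'.dual d b ∧ Rev G G'.dual d c) :=
    fun hs => core h h1 ⟨hd, hs⟩
  have hD : ¬ (Rev G G' d a ∧ Rev G G' d b ∧ Rev G G' d c) :=
    fun hs => core h.dual_right h2 ⟨hd, hs⟩
  have da : G.Dir d a := Or.inl hd.1
  have db : G.Dir d b := Or.inl hd.2.1
  have dc : G.Dir d c := Or.inl hd.2.2
  rcases h.rev_of_cyc hc with ⟨k1, k2, k3⟩ | ⟨k1, k2, k3⟩
  · exact (h.dual_right.mono_of_cyc hc k1 k2 k3 da db dc (fun _ => hd.1) (fun _ => hd.2.1)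
      fun _ => hd.2.2).elim hS hD
  · exact (h.mono_of_cyc hc k1 k2 k3 da db dc (fun _ => hd.1) (fun _ => hd.2.1)
      fun _ => hd.2.2).elim hD hS

theorem Good.not_dom' (h : Good G G') (h1 : RevRel G G' d c) (h2 : RevRel G G'.dual d c)
    (hc : G.Cyc a b c) : ¬ (G.To a d ∧ G.To b d ∧ G.To c d) := fun hd =>
  h.dual.not_dom h1.dual h2.dual hc.dual ⟨hd.2.2, hd.2.1, hd.1⟩

/-! ### The case where both relations are connected -/

theorem Good.no_cyc_of_connected (h : Good G G') (hD : ∀ x y, RevRel G G' x y)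
    (hS : ∀ x y, RevRel G G'.dual x y) (a b c : V) : ¬ G.Cyc a b c := by
  have core : ∀ {G' : Dgraph V}, Good G G' → (∀ x y, RevRel G G' x y) →
      (∀ x y, RevRel G G'.dual x y) → ∀ {a b c}, G.Cyc a b c →
      ¬ (Rev G G' a b ∧ Rev G G' b c ∧ Rev G G' c a) := by
    rintro G' h hD hS a b c hc ⟨h1, h2, h3⟩
    have key : ∀ y, RevRel G G'.dual a y → G.Cyc y b c ∧ Rev G G' y b ∧ Rev G G' c y := by
      intro y hy
      induction hy with
      | refl => exact ⟨hc, h1, h3⟩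
      | @tail p y _ hpy ih =>
        obtain ⟨hc, h1, h3⟩ := ih
        have db : G.Dir y b := (h.dir_of_rev h1 hpy).symm
        have dc : G.Dir y c := (h.dir_of_rev h3.symm hpy).symm
        have hyp := hpy.symm
        rcases h.rev_or_rev db with eb | eb <;> rcases h.rev_or_rev dc with ec | ec
        · have e1 := h.to_iff_of_apex h1.symm eb.symm hpy
          have e2 := h.to_iff_of_apex h3 ec.symm hpy
          have e3 : G.To y b := (show G.To y b ∨ G.To b y from db).resolve_right fun h' =>
            hc.1.asymm (e1.2 h')
          exact ⟨⟨e3, hc.2.1, e2.1 hc.2.2⟩, eb, ec.symm⟩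
        · have e1 := h.to_iff_of_apex eb.symm h1.symm hyp
          have e2 := h.to_iff_of_apex eb.symm h2 ec
          exact (hc.1.asymm (e1.1 (e2.2 hc.2.1))).elim
        · have e1 := h.to_iff_of_apex ec.symm h3 hyp
          have e2 := h.to_iff_of_apex ec.symm h2.symm eb
          exact (hc.2.1.asymm (e2.1 (e1.2 hc.2.2))).elim
        · have e1 := h.dual_right.to_iff_of_apex hyp eb h1
          have e2 := h.dual_right.to_iff_of_apex hyp ec h3.symm
          rcases show G.To y p ∨ G.To p y from hyp.dir with hp | hp
          · exact (h.not_dom (hD _ _) (hS _ _) hc ⟨hp, e1.1 hp, e2.1 hp⟩).elim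
          · have hb : G.To b y := (show G.To y b ∨ G.To b y from db).resolve_left fun h' =>
              hp.asymm (e1.2 h')
            have hc' : G.To c y := (show G.To y c ∨ G.To c y from dc).resolve_left fun h' =>
              hp.asymm (e2.2 h')
            exact (h.not_dom' (hD _ _) (hS _ _) hc ⟨hp, hb, hc'⟩).elim
    exact not_to_self _ _ (key b (hS _ _)).1.1
  intro hc
  exact (h.rev_of_cyc hc).elim (core h hD hS hc) (core h.dual_right hS hD hc)

theorem Good.isTournament_of_connected (h : Good G G') (hG : G.ArcConnected)
    (hD : ∀ x y, RevRel G G' x y) (hS : ∀ x y, RevRel G G'.dual x y) : G.IsTournament := by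
  have core : ∀ {G' : Dgraph V}, Good G G' → (∀ x y, RevRel G G'.dual x y) → ∀ {u y v : V},
      u ≠ v → ¬ G.Dir u v → G.To u y → G.To y v → Rev G G' u y → ¬ Rev G G' y v := by
    intro G' h hS u y v huv hn k1 k2 r1 r2
    have key : ∀ w, RevRel G G'.dual y w → (G.To u w ∧ G.To w v) ∧ Rev G G' u w ∧ Rev G G' w v := by
      intro w hw
      induction hw with
      | refl => exact ⟨⟨k1, k2⟩, r1, r2⟩
      | @tail p w _ hpw ih =>
        obtain ⟨⟨k1, k2⟩, r1, r2⟩ := ih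
        have hwp := hpw.symm
        have du : G.Dir u w := h.dir_of_rev r1.symm hpw
        have dv : G.Dir v w := h.dir_of_rev r2 hpw
        rcases h.rev_or_rev du with eu | eu <;> rcases h.rev_or_rev dv with ev | ev
        · have e1 := (h.to_iff_of_apex r1 eu hpw).1 k1
          have e2 := h.to_iff_of_apex r2.symm ev hpw
          have e3 : G.To w v := (show G.To v w ∨ G.To w v from dv).resolve_left fun h' =>
            k2.asymm (e2.2 h')
          exact ⟨⟨e1, e3⟩, eu, ev.symm⟩
        · exact absurd (h.dir_of_rev eu.symm ev.symm) hn
        · exact absurd (h.dir_of_rev ev.symm eu.symm).symm hn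
        · have e1 := h.dual_right.to_iff_of_apex hwp eu.symm r1.symm
          have e2 := h.dual_right.to_iff_of_apex hwp ev.symm r2
          have e3 := e1.symm.trans e2
          rcases show G.To w u ∨ G.To u w from du.symm with h' | h'
          · exact absurd (h.small.no_peak_out huv h' (e3.1 h')) hn
          · refine absurd (h.small.no_peak_in huv h' ?_) hn
            exact (show G.To v w ∨ G.To w v from dv).resolve_right fun h'' =>
              h'.asymm (e3.2 h'')
    exact not_to_self _ _ (key u (hS _ _)).1.1
  have core' : ∀ {u y v : V}, u ≠ v → ¬ G.Dir u v → G.To u y → ¬ G.To y v := by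
    intro u y v huv hn k1 k2
    rcases h.rev_or_rev (Or.inl k1) with r1 | r1 <;> rcases h.rev_or_rev (Or.inl k2) with r2 | r2
    · exact core h hS huv hn k1 k2 r1 r2
    · exact hn (h.dir_of_rev r1.symm r2)
    · exact hn (h.dir_of_rev r2 r1.symm).symm
    · exact core h.dual_right hD huv hn k1 k2 r1 r2
  intro x y hxy
  have key : x = y ∨ G.Dir x y := by
    have := hG x y
    clear hxy
    induction this with
    | refl => exact Or.inl rfl
    | @tail p q _ hpq ih =>
      rcases ih with rfl | ih
      · exact Or.inr hpq
      · by_contra hcon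
        push Not at hcon
        obtain ⟨hne, hn⟩ := hcon
        rcases show G.To x p ∨ G.To p x from ih with k1 | k1 <;>
          rcases show G.To p q ∨ G.To q p from hpq with k2 | k2
        · exact core' hne hn k1 k2
        · exact hn (h.small.no_peak_in hne k1 k2)
        · exact hn (h.small.no_peak_out hne k1 k2)
        · exact core' hne.symm (fun h' => hn h'.symm) k2 k1
  exact key.resolve_left hxy

end

/-! ### Arc-connected digraphs -/

/-- No `3`-cycle has a common predecessor or a common successor. -/
def NoDiamond (G : Dgraph V) : Prop :=
  ∀ d a b c, G.Cyc a b c → ¬ G.Dom d a b c ∧ ¬ (G.To a d ∧ G.To b d ∧ G.To c d)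

theorem To.of_iso {G : Dgraph V} {H : Dgraph W} {e : V ≃ W}
    (he : ∀ x y, G.Arc x y ↔ H.Arc (e x) (e y)) {i j : W} (h : H.To i j) :
    G.To (e.symm i) (e.symm j) := by
  unfold To
  rw [he, he]
  simpa using! h

theorem NoDiamond.not_isDiamond {G : Dgraph V} (h : G.NoDiamond) (X : Set V) :
    ¬ IsDiamond (G.ind X) := by
  have h1 : diamondD.To 0 1 := by simp [To, diamondD, ofRel]
  have h2 : diamondD.To 0 2 := by simp [To, diamondD, ofRel]
  have h3 : diamondD.To 0 3 := by simp [To, diamondD, ofRel]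
  have h4 : diamondD.To 1 2 := by simp [To, diamondD, ofRel]
  have h5 : diamondD.To 2 3 := by simp [To, diamondD, ofRel]
  have h6 : diamondD.To 3 1 := by simp [To, diamondD, ofRel]
  rintro (⟨e, he⟩ | ⟨e, he⟩)
  · exact (h _ _ _ _ ⟨h4.of_iso he, h5.of_iso he, h6.of_iso he⟩).1
      ⟨h1.of_iso he, h2.of_iso he, h3.of_iso he⟩
  · exact (h _ _ _ _ ⟨h6.of_iso he, h5.of_iso he, h4.of_iso he⟩).2
      ⟨h1.of_iso he, h3.of_iso he, h2.of_iso he⟩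

theorem IsInterval.image {G : Dgraph V} {X : Set V} {I : Set X} (hX : G.IsInterval X)
    (hI : (G.ind X).IsInterval I) : G.IsInterval (Subtype.val '' I) := by
  rw [isInterval_iff] at *
  rintro x hx _ ⟨y, hy, rfl⟩ _ ⟨z, hz, rfl⟩
  by_cases hxX : x ∈ X
  · exact hI ⟨x, hxX⟩ (fun h => hx ⟨_, h, rfl⟩) y hy z hz
  · exact hX x hxX y y.2 z z.2

theorem IsTournament.of_iso {G : Dgraph V} {H : Dgraph W} (h : Iso G H) (hH : H.IsTournament) :
    G.IsTournament := by
  obtain ⟨e, he⟩ := h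
  intro x y hxy
  have := hH (e x) (e y) (e.injective.ne hxy)
  unfold Dir at *
  rwa [he, he]

theorem IsChainD.of_iso {G : Dgraph V} {H : Dgraph W} (h : Iso G H) (hH : H.IsChainD) :
    G.IsChainD := by
  refine ⟨.of_iso h hH.1, ?_⟩
  obtain ⟨e, he⟩ := h
  intro x y z
  rw [he, he, he]
  exact hH.2 _ _ _

theorem FiniteChains.ind {G : Dgraph V} {X : Set V} (h : G.FiniteChains) (hX : G.IsInterval X) :
    (G.ind X).FiniteChains := fun I hI hc =>
  Set.Finite.of_finite_image (h _ (hX.image hI) (.of_iso (ind_ind_iso G X I).symm hc))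
    Subtype.val_injective.injOn

theorem FiniteChains.finite {G : Dgraph V} (h : G.FiniteChains) (hc : G.IsChainD) : Finite V :=
  finite_univ_iff.1 (h univ (fun x hx => absurd (mem_univ x) hx) (.of_iso (ind_univ_iso G) hc))

/-- Gluing isomorphisms between the classes of an equivalence relation. -/
theorem iso_glue_rel {G H : Dgraph V} {r : V → V → Prop} (hr : Equivalence r)
    (hGH : ∀ x y, ¬ r x y → (G.Arc x y ↔ H.Arc x y))
    (hH : ∀ x y z, ¬ r x z → r x y → (H.Arc z x ↔ H.Arc z y) ∧ (H.Arc x z ↔ H.Arc y z))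
    (h : ∀ x, Iso (G.ind {y | r x y}) (H.ind {y | r x y})) : Iso G H := by
  have hc : ∀ {x y}, (Quotient.mk ⟨r, hr⟩ x = Quotient.mk ⟨r, hr⟩ y) ↔ r x y :=
    fun {x y} => Quotient.eq
  refine iso_glue (Quotient.mk ⟨r, hr⟩) (fun x y hxy => hGH x y fun h' => hxy (hc.2 h')) ?_ ?_
  · intro x x' y y' hx hy hxy
    rw [hc] at hx hy
    rw [Ne, hc] at hxy
    rw [(hH x x' y hxy hx).2, (hH y y' x' (fun h' => hxy (hr.trans hx (hr.symm h'))) hy).1]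
  · intro i
    obtain ⟨x, rfl⟩ := Quotient.exists_rep i
    have : Quotient.mk ⟨r, hr⟩ ⁻¹' {Quotient.mk ⟨r, hr⟩ x} = {y | r x y} := by
      ext y
      exact hc.trans ⟨hr.symm, hr.symm⟩
    rw [this]
    exact h x

theorem RevRel.equivalence (G G' : Dgraph V) : Equivalence (RevRel G G') :=
  ⟨fun _ => .refl, RevRel.symm, Relation.ReflTransGen.trans⟩

theorem RevRel.ind {G G' : Dgraph V} {x y : V} (h : RevRel G G' x y) :
    RevRel (G.ind {y | RevRel G G' x y}) (G'.ind {y | RevRel G G' x y}) ⟨x, .refl⟩ ⟨y, h⟩ := by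
  induction h with
  | refl => exact .refl
  | @tail p q hp hpq ih => exact ih.tail hpq

theorem RevRel.ind_connected {G G' : Dgraph V} {x : V} (p q : {y | RevRel G G' x y}) :
    RevRel (G.ind {y | RevRel G G' x y}) (G'.ind {y | RevRel G G' x y}) p q :=
  RevRel.symm (RevRel.ind p.2) |>.trans (RevRel.ind q.2)

theorem Good.isChainD {G G' : Dgraph V} (h : Good G G') (hc : G.IsChainD) : G'.IsChainD := by
  refine isChainD_of_no_cyc (fun x y hxy => h.dir_iff.1 (hc.1 x y hxy)) fun x y z h' => ?_
  have key : ∀ x y z, ¬ G.Cyc x y z := fun x y z h => h.2.2.2 (hc.2 _ _ _ h.1.1 h.2.1.1)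
  exact (h.symm.cyc h').elim (key _ _ _) (key _ _ _)

theorem Good.iso_of_isChainD {G G' : Dgraph V} (h : Good G G') (hc : G.IsChainD) [Finite V] :
    Iso G' G := (h.isChainD hc).iso hc rfl

theorem Good.iso_dual_of_noDiamond {G G' : Dgraph V} (h : Good G G') (hG : G.IsTournament)
    (hnd : G.NoDiamond) (hD : ∀ x y, RevRel G G' x y) (hfin : G.FiniteChains) :
    Iso G' G.dual := by
  by_cases hS : ∀ x y, RevRel G G'.dual x y
  · have hc : G.IsChainD := isChainD_of_no_cyc hG (h.no_cyc_of_connected hD hS)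
    have := hfin.finite hc
    exact (h.iso_of_isChainD hc).trans hc.selfDual
  push Not at hS
  obtain ⟨a, b, hab⟩ := hS
  have h' := h.dual_right
  refine iso_glue_rel (RevRel.equivalence G G'.dual) ?_ ?_ ?_
  · intro x y hxy
    exact (h'.arc_iff (x := y) (y := x) fun hr => hxy (.single hr.symm)).symm
  · intro x y z hz hy
    exact (h'.arc_iff_of_revRel hz hy).symm
  · intro x
    obtain ⟨z, hz⟩ : ∃ z, ¬ RevRel G G'.dual x z := by
      by_contra hcon
      push Not at hcon
      exact hab ((hcon a).symm.trans (hcon b))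
    have hc : (G.ind {y | RevRel G G'.dual x y}).IsChainD := by
      refine isChainD_ind (fun p _ q _ => hG p q) fun p hp q hq r hr hcyc => ?_
      have hu : ∀ y, RevRel G G'.dual x y → (G.To z x ↔ G.To z y) ∧ (G.To x z ↔ G.To y z) := by
        intro y hy
        have := h'.arc_iff_of_revRel hz hy
        simp [To, this]
      have hxz : x ≠ z := by rintro rfl; exact hz .refl
      rcases show G.To x z ∨ G.To z x from hG x z hxz with h1 | h1
      · exact (hnd z p q r hcyc).2 ⟨(hu p hp).2.1 h1, (hu q hq).2.1 h1, (hu r hr).2.1 h1⟩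
      · exact (hnd z p q r hcyc).1 ⟨(hu p hp).1.1 h1, (hu q hq).1.1 h1, (hu r hr).1.1 h1⟩
    have := (hfin _ (h'.isInterval_class x) hc).to_subtype
    exact ((h.ind _).iso_of_isChainD hc).trans hc.selfDual

theorem Good.iso_or_iso_dual {G G' : Dgraph V} (h : Good G G') (hG : G.ArcConnected)
    (hfin : G.FiniteChains)
    (hu : ∀ I J : Set V, I ≠ univ → J ≠ univ → G.IsInterval I → G.IsInterval J →
      DiamondFreeTournament (G.ind I) → DiamondFreeTournament (G.ind J) →
      ¬ SelfDual (G.ind I) → ¬ SelfDual (G.ind J) → I = J)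
    (hf : ∀ I : Set V, I ≠ univ → G.IsInterval I → DiamondFreeTournament (G.ind I) →
      ¬ SelfDual (G.ind I) → ∃ e, G.Flip I e) :
    Iso G' G ∨ Iso G' G.dual := by
  have core : ∀ {G' : Dgraph V}, Good G G' → (∃ a b, ¬ RevRel G G' a b) →
      Iso G' G ∨ Iso G' G.dual := by
    rintro G' h ⟨a, b, hab⟩
    have hS := h.revRel_dual hG hab
    have hr := RevRel.equivalence G G'
    have hout : ∀ x, ∃ z, ¬ RevRel G G' x z := by
      intro x
      by_contra hcon
      push Not at hcon
      exact hab ((hcon a).symm.trans (hcon b))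
    have hne : ∀ x, {y | RevRel G G' x y} ≠ univ := fun x hx =>
      let ⟨z, hz⟩ := hout x
      hz (hx.ge (mem_univ z))
    have htour : ∀ x, (G.ind {y | RevRel G G' x y}).IsTournament := by
      intro x p q hpq
      obtain ⟨z, hz⟩ := hout x
      obtain ⟨w, hw, hwy⟩ := h.exists_outside hG hz
      have e1 := h.arc_iff_of_revRel hw p.2
      have e2 := h.arc_iff_of_revRel hw q.2
      have hpq' : (p : V) ≠ q := fun h' => hpq (Subtype.ext h')
      rcases (hwy p p.2).dir with hd | hd
      · exact h.small.no_peak_out hpq' hd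
          ⟨e2.1.1 (e1.1.2 hd.1), fun h' => hd.2 (e1.2.1 (e2.2.2 h'))⟩
      · exact h.small.no_peak_in hpq' hd
          ⟨e2.2.1 (e1.2.2 hd.1), fun h' => hd.2 (e1.1.1 (e2.1.2 h'))⟩
    have hnd : ∀ x, (G.ind {y | RevRel G G' x y}).NoDiamond := fun x d a b c hc =>
      ⟨h.not_dom (hr.trans (hr.symm d.2) a.2) (hS _ _) hc,
        h.not_dom' (hr.trans (hr.symm d.2) c.2) (hS _ _) hc⟩
    have hdf : ∀ x, DiamondFreeTournament (G.ind {y | RevRel G G' x y}) := fun x =>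
      ⟨htour x, (hnd x).not_isDiamond⟩
    have hitv := h.isInterval_class
    have hiso : ∀ x, Iso (G'.ind {y | RevRel G G' x y}) (G.ind {y | RevRel G G' x y}).dual :=
      fun x => (h.ind _).iso_dual_of_noDiamond (htour x) (hnd x) RevRel.ind_connected
        (hfin.ind (hitv x))
    have hcross : ∀ x y, ¬ RevRel G G' x y → (G'.Arc x y ↔ G.Arc x y) := fun x y hxy =>
      (h.arc_iff fun h' => hxy (.single h')).symm
    by_cases hsd : ∀ x, SelfDual (G.ind {y | RevRel G G' x y})
    · exact Or.inl (iso_glue_rel hr hcross (fun x y z hz hy => h.arc_iff_of_revRel hz hy)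
        fun x => (hiso x).trans (hsd x).symm)
    push Not at hsd
    obtain ⟨x₀, hx₀⟩ := hsd
    obtain ⟨e, he⟩ := hf _ (hne x₀) (hitv x₀) (hdf x₀) hx₀
    let H : Dgraph V := ⟨fun x y => G.Arc (e y) (e x), fun x hx => G.irrefl _ hx⟩
    have hHG : Iso H G.dual := ⟨e, fun x y => Iff.rfl⟩
    have hH : ∀ x y, ¬ (RevRel G G' x₀ x ∧ RevRel G G' x₀ y) → (G.Arc x y ↔ H.Arc x y) := he.2
    have hH' : ∀ x y, ¬ RevRel G G' x y → (G.Arc x y ↔ H.Arc x y) := fun x y hxy =>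
      hH x y fun h' => hxy (hr.trans (hr.symm h'.1) h'.2)
    refine Or.inr ((iso_glue_rel hr (fun x y hxy => (hcross x y hxy).trans (hH' x y hxy)) ?_
      fun x => ?_).trans hHG)
    · intro x y z hz hy
      have hz' : ¬ RevRel G G' y z := fun h' => hz (hr.trans hy h')
      rw [← hH' _ _ hz, ← hH' _ _ hz', ← hH' _ _ fun h' => hz (hr.symm h'),
        ← hH' _ _ fun h' => hz' (hr.symm h')]
      exact h.arc_iff_of_revRel hz hy
    · refine (hiso x).trans ?_
      by_cases hx : RevRel G G' x₀ x
      · refine ⟨Equiv.refl _, fun p q => ?_⟩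
        change G.Arc q p ↔ G.Arc (e q) (e p)
        rw [he.1 _ (hr.trans hx p.2), he.1 _ (hr.trans hx q.2)]
      · have hs : SelfDual (G.ind {y | RevRel G G' x y}) := by
          by_contra hs
          have := hu _ _ (hne x) (hne x₀) (hitv x) (hitv x₀) (hdf x) (hdf x₀) hs hx₀
          exact hx (this.le (hr.refl x))
        exact hs.symm.trans ⟨Equiv.refl _, fun p q => hH p q fun h' =>
          hx (hr.trans h'.1 (hr.symm p.2))⟩
  by_cases hD : ∀ x y, RevRel G G' x y
  · by_cases hS : ∀ x y, RevRel G G'.dual x y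
    · have hc : G.IsChainD := isChainD_of_no_cyc (h.isTournament_of_connected hG hD hS)
        (h.no_cyc_of_connected hD hS)
      have := hfin.finite hc
      exact Or.inl (h.iso_of_isChainD hc)
    · push Not at hS
      exact (core h.dual_right hS).symm.imp Iso.dual Iso.dual
  · push Not at hD
    exact core h hD

/-! ### Arc-connected components -/

theorem ACRel.symm {G : Dgraph V} {x y : V} (h : G.ACRel x y) : G.ACRel y x := by
  have : Std.Symm G.Dir := ⟨fun _ _ => Dir.symm⟩
  exact (Relation.ReflTransGen.stdSymm (r := G.Dir)).symm _ _ h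

theorem ACRel.equivalence (G : Dgraph V) : Equivalence G.ACRel :=
  ⟨fun _ => .refl, ACRel.symm, Relation.ReflTransGen.trans⟩

theorem ACRel.setOf_eq {G : Dgraph V} {x y : V} (h : G.ACRel x y) :
    {z | G.ACRel x z} = {z | G.ACRel y z} :=
  Set.ext fun _ => ⟨h.symm.trans, h.trans⟩

theorem ACRel.ind {G : Dgraph V} {x y : V} (h : G.ACRel x y) :
    (G.ind {y | G.ACRel x y}).ACRel ⟨x, .refl⟩ ⟨y, h⟩ := by
  induction h with
  | refl => exact .refl
  | @tail p q hp hpq ih => exact ih.tail hpq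

theorem ACRel.arcConnected (G : Dgraph V) (x : V) : (G.ind {y | G.ACRel x y}).ArcConnected :=
  fun p q => (ACRel.ind p.2).symm.trans (ACRel.ind q.2)

theorem Small.arc_iff_of_acRel {G : Dgraph V} (h : Small 3 G) {x y z : V} (hz : ¬ G.ACRel x z)
    (hy : G.ACRel x y) : (G.Arc z x ↔ G.Arc z y) ∧ (G.Arc x z ↔ G.Arc y z) := by
  have hd : ∀ {p}, G.ACRel x p → ¬ G.Dir z p := fun hp h' => hz (hp.tail h'.symm)
  have hne : ∀ {p}, G.ACRel x p → z ≠ p := by rintro p hp rfl; exact hz hp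
  have key : G.Arc z x ↔ G.Arc z y := by
    induction hy with
    | refl => rfl
    | @tail p q hp hpq ih =>
      have hq : G.ACRel x q := hp.tail hpq
      exact ih.trans (h.no_flag hpq (hd hp) (hd hq) (hne hp) (hne hq))
  refine ⟨key, ?_⟩
  rw [← arc_comm_of_not_dir (hd hy), ← arc_comm_of_not_dir (hd .refl)]
  exact key

theorem Small.isInterval_component {G : Dgraph V} (h : Small 3 G) (x : V) :
    G.IsInterval {y | G.ACRel x y} := by
  rw [isInterval_iff]
  intro w hw y hy z hz
  have h1 := h.arc_iff_of_acRel hw hy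
  have h2 := h.arc_iff_of_acRel hw hz
  exact ⟨h1.1.symm.trans h2.1, h1.2.symm.trans h2.2⟩

/-! ### Reflections -/

theorem ContractIsoFix.exists_flip {G : Dgraph V} {I : Set V} (h : ContractIsoFix G G.dual I)
    (hI : G.IsInterval I) : ∃ e, G.Flip I e := by
  classical
  rw [isInterval_iff] at hI
  obtain ⟨f, hf0, hf⟩ := h
  have hsome : ∀ x, f (some x) = some (Equiv.removeNone f x) := fun x =>
    (Equiv.removeNone_some f (Option.ne_none_iff_exists'.1 fun h' => by
      have := f.injective (h'.trans hf0.symm)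
      simp at this)).symm
  let e : V ≃ V := Equiv.Perm.ofSubtype (Equiv.removeNone f)
  have he : ∀ x (hx : x ∉ I), e x = Equiv.removeNone f ⟨x, hx⟩ := fun x hx =>
    Equiv.Perm.ofSubtype_apply_of_mem (p := (· ∉ I)) _ hx
  have he' : ∀ x ∈ I, e x = x := fun x hx =>
    Equiv.Perm.ofSubtype_apply_of_not_mem (p := (· ∉ I)) _ fun h => h hx
  have hout : ∀ x, x ∉ I → e x ∉ I := fun x hx => he x hx ▸ (Equiv.removeNone f ⟨x, hx⟩).2
  refine ⟨e, he', fun x y hxy => ?_⟩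
  by_cases hx : x ∈ I
  · have hy : y ∉ I := fun hy => hxy ⟨hx, hy⟩
    have := hf none (some ⟨y, hy⟩)
    rw [hf0, hsome] at this
    simp only [contract, dual, ← he] at this
    rw [he' x hx]
    exact ⟨fun h => let ⟨z, hz, h'⟩ := this.1 ⟨x, hx, h⟩; (hI _ (hout y hy) _ hz _ hx).1.1 h',
      fun h => let ⟨z, hz, h'⟩ := this.2 ⟨x, hx, h⟩; (hI _ hy _ hz _ hx).2.1 h'⟩
  · by_cases hy : y ∈ I
    · have := hf (some ⟨x, hx⟩) none
      rw [hf0, hsome] at this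
      simp only [contract, dual, ← he] at this
      rw [he' y hy]
      exact ⟨fun h => let ⟨z, hz, h'⟩ := this.1 ⟨y, hy, h⟩; (hI _ (hout x hx) _ hz _ hy).2.1 h',
        fun h => let ⟨z, hz, h'⟩ := this.2 ⟨y, hy, h⟩; (hI _ hx _ hz _ hy).1.1 h'⟩
    · have := hf (some ⟨x, hx⟩) (some ⟨y, hy⟩)
      rw [hsome, hsome] at this
      simpa only [contract, dual, ← he] using this

theorem Flip.dir_iff {G : Dgraph V} {I : Set V} {e : V ≃ V} (he : G.Flip I e) {x y : V} :
    G.Dir (e x) (e y) ↔ G.Dir x y := by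
  by_cases hxy : x ∈ I ∧ y ∈ I
  · rw [he.1 x hxy.1, he.1 y hxy.2]
  · unfold Dir
    rw [he.2 x y hxy, he.2 y x fun h => hxy h.symm, or_comm]

theorem Flip.acRel_iff {G : Dgraph V} {I : Set V} {e : V ≃ V} (he : G.Flip I e) {x y : V} :
    G.ACRel (e x) (e y) ↔ G.ACRel x y := by
  constructor
  · intro h
    have := Relation.ReflTransGen.lift (p := G.Dir) e.symm
      (fun a b hab => he.dir_iff.1 (by simpa using hab)) _ _ h
    simpa [ACRel, onFun] using this
  · exact Relation.ReflTransGen.lift (p := G.Dir) e (fun a b => he.dir_iff.2) x y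

theorem Flip.ind {G : Dgraph V} {X : Set V} {I : Set X} {e : V ≃ V}
    (he : G.Flip (Subtype.val '' I) e) (hX : ∀ x, x ∈ X ↔ e x ∈ X) :
    (G.ind X).Flip I (e.subtypeEquiv hX) :=
  ⟨fun x hx => Subtype.ext (he.1 x ⟨x, hx, rfl⟩), fun x y hxy => he.2 x y fun h =>
    hxy ⟨by simpa using h.1, by simpa using h.2⟩⟩

/-! ### Prechains -/

theorem Small.noDiamond {G : Dgraph V} (h : Small 4 G) : G.NoDiamond := fun _ _ _ _ hc =>
  ⟨h.no_diamond hc, fun hd => h.no_diamond' hc hd.1 hd.2.1 hd.2.2⟩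

theorem Small.not_isPeak {G : Dgraph V} (h : Small 3 G) (X : Set V) : ¬ IsPeak (G.ind X) := by
  have key : ∀ {P : Dgraph (Fin 3)}, P.To 0 1 → P.To 0 2 → ¬ P.Dir 1 2 → ¬ Hemi (G.ind X) P := by
    intro P h1 h2 h3 hiso
    have core : ∀ {G : Dgraph X}, Small 3 G → ¬ Iso G P := by
      rintro G h ⟨e, he⟩
      have h4 : e.symm 1 ≠ e.symm 2 := e.symm.injective.ne (by decide)
      have := h.no_peak_out h4 (h1.of_iso he) (h2.of_iso he)
      unfold Dir at this h3
      rw [he, he] at this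
      exact h3 (by simpa using this)
    exact hiso.elim (core (h.ind X)) (core (h.ind X).dual)
  rintro (h' | h')
  · exact key (by simp [To, peakD1, ofRel]) (by simp [To, peakD1, ofRel])
      (by simp [Dir, peakD1, ofRel]) h'
  · exact key (by simp [To, peakD2, ofRel]) (by simp [To, peakD2, ofRel])
      (by simp [Dir, peakD2, ofRel]) h'

theorem NeutralMatching.isPrechain {G : Dgraph V} (nm : G.NeutralMatching) (h : Small 4 G) :
    G.IsPrechain := by
  refine ⟨(h.mono (by norm_num)).not_isPeak, h.noDiamond.not_isDiamond, ?_⟩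
  rintro ⟨x, y, z, hyz, h1, h2⟩
  exact (nm x y z h1.1 h2.1 hyz).elim h1.2 h2.2

/-! ### Non-self-dual components -/

/-- Non-self-dual arc-connected components. -/
def NSDComponent (G : Dgraph V) (X : Set V) : Prop :=
  G.IsACComponent X ∧ ¬ SelfDual (G.ind X)

theorem Small.nsdComponent_isInterval {G : Dgraph V} (h : Small 3 G) {X : Set V}
    (hX : G.NSDComponent X) : G.IsInterval X := by
  obtain ⟨⟨x, rfl⟩, -⟩ := hX
  exact h.isInterval_component x

theorem Small.nsdComponent_cases {G : Dgraph V} (h : Small 4 G) {X : Set V}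
    (hX : G.NSDComponent X) :
    (G.ind X).NeutralMatching ∨ (G.ind X).OneEndInfiniteConsecutivity := by
  obtain ⟨⟨x, rfl⟩, hsd⟩ := hX
  by_contra hcon
  rw [not_or] at hcon
  exact ((h.ind _).selfDual_or_oneEnd (ACRel.arcConnected G x) hcon.1).elim hsd hcon.2

theorem eq_of_neutralMatching {G : Dgraph V} (hfin : G.FiniteChains) (hK4 : ¬ G.CondK4)
    (hK5 : ¬ G.CondK5) (hcd : 5 ≤ G.Cdual) {X Y : Set V} (hX : G.NSDComponent X)
    (hY : G.NSDComponent Y) (nX : (G.ind X).NeutralMatching) (nY : (G.ind Y).NeutralMatching) :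
    X = Y := by
  by_contra hne
  have h4 : Small 4 G := small_of_le_cdual hcd
  have hitv : ∀ {X}, G.NSDComponent X → G.IsInterval X :=
    (h4.mono (by norm_num)).nsdComponent_isInterval
  have hpre : ∀ {X}, (G.ind X).NeutralMatching → (G.ind X).IsPrechain :=
    fun n => n.isPrechain (h4.ind _)
  rcases hcd.eq_or_lt with h5 | h5
  · exact hK4 ⟨h5.symm, X, Y, hne, ⟨hX.1, hX.2, hitv hX, hpre nX⟩,
      ⟨hY.1, hY.2, hitv hY, hpre nY⟩⟩
  have h6 : ((5 + 1 : ℕ) : ℕ∞) ≤ G.Cdual := Order.add_one_le_of_lt h5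
  have hs5 : Small 5 G := small_of_le_cdual h6
  have htour : ∀ {X}, G.NSDComponent X → (G.ind X).NeutralMatching →
      (G.ind X).IsTournament := by
    intro X hX nX u v huv
    by_contra hd
    exact hX.2 (selfDual_of_neutral_pair (hs5.ind X) nX huv hd (hfin.ind (hitv hX)))
  have hdf : ∀ {X}, G.NSDComponent X → (G.ind X).NeutralMatching →
      DiamondFreeTournament (G.ind X) := fun hX nX => ⟨htour hX nX, (hpre nX).2.1⟩
  rcases h6.eq_or_lt with h6 | h6
  · exact hK5 ⟨h6.symm, X, Y, hne, ⟨hX.1, hX.2, hitv hX, hdf hX nX⟩,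
      ⟨hY.1, hY.2, hitv hY, hdf hY nY⟩⟩
  have h7 : ((6 + 1 : ℕ) : ℕ∞) ≤ G.Cdual := Order.add_one_le_of_lt h6
  exact hX.2 (selfDual_of_isTournament (htour hX nX) ((small_of_le_cdual h7).ind X)
    (hfin.ind (hitv hX)))

theorem finiteChains_of_not_condCinf {G : Dgraph V} (h : ¬ G.CondCinf) : G.FiniteChains :=
  fun I hI hc => by
    by_contra hinf
    exact h (Or.inl ⟨I, hinf, hI, hc⟩)

theorem nsdComponent_unique {G : Dgraph V} (hcinf : ¬ G.CondCinf) (hK3 : ¬ G.CondK3)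
    (hK4 : ¬ G.CondK4) (hK5 : ¬ G.CondK5) (hcd : 4 ≤ G.Cdual) {X Y : Set V}
    (hX : G.NSDComponent X) (hY : G.NSDComponent Y) : X = Y := by
  have h3 : Small 3 G := small_of_le_cdual hcd
  have hitv : ∀ {X}, G.NSDComponent X → G.IsInterval X := h3.nsdComponent_isInterval
  have hfin := finiteChains_of_not_condCinf hcinf
  by_contra hne
  rcases hcd.eq_or_lt with h4 | h4
  · exact hK3 ⟨h4.symm, X, Y, hne, ⟨hX.1, hX.2, hitv hX⟩, ⟨hY.1, hY.2, hitv hY⟩⟩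
  have h5 : 5 ≤ G.Cdual := Order.add_one_le_of_lt h4
  have hs4 : Small 4 G := small_of_le_cdual h5
  have hone : ∀ I J, G.IsInterval I → G.IsInterval J →
      (G.ind I).OneEndInfiniteConsecutivity → (G.ind J).OneEndInfiniteConsecutivity → I = J := by
    intro I J hI hJ oI oJ
    by_contra hIJ
    exact hcinf (Or.inr (Or.inl ⟨I, J, hIJ, hI, hJ, oI, oJ⟩))
  have mixed : ∀ {X Y}, G.NSDComponent X → G.NSDComponent Y → X ≠ Y →
      (G.ind X).OneEndInfiniteConsecutivity → ¬ (G.ind Y).NeutralMatching := by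
    rintro X Y hX hY hne oX nY
    have hcf : ContractIsoFix G G.dual X := by
      by_contra hcf
      exact hcinf (Or.inr (Or.inr ⟨X, hitv hX, oX, fun J hJ oJ =>
        hone J X hJ (hitv hX) oJ oX, hcf⟩))
    obtain ⟨e, he⟩ := hcf.exists_flip (hitv hX)
    obtain ⟨⟨y, rfl⟩, hYs⟩ := hY
    obtain ⟨⟨x, rfl⟩, hXs⟩ := id hX
    have hxy : ¬ G.ACRel x y := fun h => hne h.setOf_eq
    have hyx : ∀ z, G.ACRel y z → ¬ G.ACRel x z := fun z hz h => hxy (h.trans hz.symm)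
    have hiso : Iso (G.ind {z | G.ACRel y z}) (G.ind {z | G.ACRel (e y) z}).dual :=
      ⟨e.subtypeEquiv fun z => he.acRel_iff.symm, fun p q => he.2 p q fun h' => hyx p p.2 h'.1⟩
    have hZ : G.NSDComponent {z | G.ACRel (e y) z} :=
      ⟨⟨_, rfl⟩, fun h => hYs (SelfDual.of_iso hiso h.dual)⟩
    have hZX : ¬ G.ACRel x (e y) := fun h => hxy (he.acRel_iff.1 (by rwa [he.1 x .refl]))
    rcases hs4.nsdComponent_cases hZ with nZ | oZ
    · have heq := eq_of_neutralMatching hfin hK4 hK5 h5 ⟨⟨y, rfl⟩, hYs⟩ hZ nY nZ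
      rw [← heq] at hiso
      exact hYs hiso
    · have := hone _ _ (hitv hZ) (hitv hX) oZ oX
      exact hZX (this.le (show G.ACRel (e y) (e y) from .refl))
  rcases hs4.nsdComponent_cases hX with nX | oX <;> rcases hs4.nsdComponent_cases hY with nY | oY
  · exact hne (eq_of_neutralMatching hfin hK4 hK5 h5 hX hY nX nY)
  · exact mixed hY hX (Ne.symm hne) oY nX
  · exact mixed hX hY hne oX nY
  · exact hne (hone _ _ (hitv hX) (hitv hY) oX oY)

/-! ### Reconstruction of the components -/

theorem DiamondFreeTournament.of_iso {G : Dgraph V} {H : Dgraph W} (h : Iso G H)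
    (hH : H.DiamondFreeTournament) : G.DiamondFreeTournament := by
  refine ⟨.of_iso h hH.1, fun X hX => ?_⟩
  obtain ⟨e, he⟩ := h
  exact hH.2 (e '' X) (hX.congr ⟨e.image X, fun x y => he x y⟩ (.refl _))

theorem l12Int_image {G : Dgraph V} (h : Small 3 G) {x : V} {I : Set {y | G.ACRel x y}}
    (hne : I ≠ univ) (hI : (G.ind _).IsInterval I)
    (hd : DiamondFreeTournament ((G.ind _).ind I)) (hs : ¬ SelfDual ((G.ind _).ind I)) :
    G.L12Int (Subtype.val '' I) := by
  have hiso := ind_ind_iso G _ I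
  refine ⟨(h.isInterval_component x).image hI, .of_iso hiso.symm hd,
    fun h' => hs (.of_iso hiso h'), ?_⟩
  rintro ⟨z, hz⟩
  obtain ⟨z', -, rfl⟩ : z ∈ Subtype.val '' I := hz.ge (show G.ACRel z z from .refl)
  refine hne (eq_univ_of_forall fun p => ?_)
  have : (p : V) ∈ Subtype.val '' I :=
    hz.ge (show G.ACRel z' p from (ACRel.symm z'.2).trans p.2)
  exact (Subtype.val_injective.mem_set_image).1 this

theorem Good.component_iso {G G' : Dgraph V} (h : Good G G') (hfin : G.FiniteChains)
    (hL1 : ¬ G.CondL1) (hL2 : ¬ G.CondL2) (x : V) :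
    Iso (G'.ind {y | G.ACRel x y}) (G.ind {y | G.ACRel x y}) ∨
      Iso (G'.ind {y | G.ACRel x y}) (G.ind {y | G.ACRel x y}).dual := by
  have huniq : ∀ I J, G.L12Int I → G.L12Int J → I = J := by
    intro I J hI hJ
    by_contra hIJ
    exact hL1 ⟨I, J, hIJ, hI, hJ⟩
  refine (h.ind _).iso_or_iso_dual (ACRel.arcConnected G x)
    (hfin.ind (h.small.isInterval_component x)) ?_ ?_
  · intro I J hI hJ iI iJ dI dJ sI sJ
    exact image_injective.2 Subtype.val_injective (huniq _ _ (l12Int_image h.small hI iI dI sI)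
      (l12Int_image h.small hJ iJ dJ sJ))
  · intro I hI iI dI sI
    have hL := l12Int_image h.small hI iI dI sI
    have hcf : ContractIsoFix G G.dual (Subtype.val '' I) := by
      by_contra hcf
      exact hL2 ⟨_, hL, fun J hJ => huniq _ _ hJ hL, hcf⟩
    obtain ⟨e, he⟩ := hcf.exists_flip hL.1
    obtain ⟨p, hp⟩ : I.Nonempty := by
      by_contra hemp
      have : IsEmpty I := isEmpty_coe_sort.2 (not_nonempty_iff_eq_empty.1 hemp)
      exact sI iso_of_subsingleton
    refine ⟨_, he.ind fun z => ?_⟩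
    have hpe := he.1 p ⟨p, hp, rfl⟩
    have hxz : ∀ z, G.ACRel x z ↔ G.ACRel p z := fun z =>
      ⟨(ACRel.symm p.2).trans, Relation.ReflTransGen.trans p.2⟩
    change G.ACRel x z ↔ G.ACRel x (e z)
    rw [hxz, hxz, ← he.acRel_iff, hpe]

theorem LeHemi.good {G G' : Dgraph V} (h : LeHemi 6 G G') (h3 : Small 3 G) : Good G G' := by
  refine ⟨h3, fun X hX hc => ?_⟩
  rcases Nat.eq_zero_or_pos X.ncard with h0 | h0
  · have := isEmpty_coe_sort.2 ((ncard_eq_zero hX).1 h0)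
    exact Or.inl iso_of_subsingleton
  · exact h _ h0 (hc.trans (by norm_num)) X hX rfl

theorem Good.hemi_of_components {G G' : Dgraph V} (h : Good G G')
    (huniq : ∀ {X Y}, G.NSDComponent X → G.NSDComponent Y → X = Y)
    (hcomp : ∀ x, Iso (G'.ind {y | G.ACRel x y}) (G.ind {y | G.ACRel x y}) ∨
      Iso (G'.ind {y | G.ACRel x y}) (G.ind {y | G.ACRel x y}).dual) : Hemi G G' := by
  have hcross : ∀ x y, ¬ G.ACRel x y → (G'.Arc x y ↔ G.Arc x y) := fun x y hxy =>
    (h.arc_iff fun h' => hxy (.single h'.dir)).symm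
  have glue : (∀ x, Iso (G'.ind {y | G.ACRel x y}) (G.ind {y | G.ACRel x y})) → Iso G' G :=
    iso_glue_rel (ACRel.equivalence G) hcross fun x y z hz hy => h.small.arc_iff_of_acRel hz hy
  have glue' : (∀ x, Iso (G'.ind {y | G.ACRel x y}) (G.dual.ind {y | G.ACRel x y})) →
      Iso G' G.dual :=
    iso_glue_rel (ACRel.equivalence G)
      (fun x y hxy => (hcross x y hxy).trans (arc_comm_of_not_dir fun h' => hxy (.single h')))
      fun x y z hz hy => (h.small.arc_iff_of_acRel hz hy).symm
  by_cases hsd : ∀ x, SelfDual (G.ind {y | G.ACRel x y})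
  · exact Or.inl (glue fun x => (hcomp x).elim id fun h' => h'.trans (hsd x).symm).symm
  push Not at hsd
  obtain ⟨x₀, hx₀⟩ := hsd
  have hsd : ∀ x, {y | G.ACRel x y} ≠ {y | G.ACRel x₀ y} → SelfDual (G.ind {y | G.ACRel x y}) := by
    intro x hx
    by_contra hs
    exact hx (huniq ⟨⟨x, rfl⟩, hs⟩ ⟨⟨x₀, rfl⟩, hx₀⟩)
  rcases hcomp x₀ with h₀ | h₀
  · refine Or.inl (glue fun x => ?_).symm
    by_cases hx : {y | G.ACRel x y} = {y | G.ACRel x₀ y}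
    · rw [hx]; exact h₀
    · exact (hcomp x).elim id fun h' => h'.trans (hsd x hx).symm
  · refine Or.inr (glue' fun x => ?_).symm
    by_cases hx : {y | G.ACRel x y} = {y | G.ACRel x₀ y}
    · rw [hx]; exact h₀
    · exact (hcomp x).elim (fun h' => h'.trans (hsd x hx)) id

end Dgraph

open Dgraph
/-- A digraph satisfying none of C∞, K1–K5, L1–L4 with C_dual(G) ≥ 4 is
(≤6)-half-reconstructible. -/
theorem half_recon_of_cdual_ge_four {V : Type u} (G : Dgraph V)
    (hcinf : ¬ G.CondCinf) (hK1 : ¬ G.CondK1) (hK2 : ¬ G.CondK2) (hK3 : ¬ G.CondK3)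
    (hK4 : ¬ G.CondK4) (hK5 : ¬ G.CondK5) (hL1 : ¬ G.CondL1) (hL2 : ¬ G.CondL2)
    (hL3 : ¬ G.CondL3) (hL4 : ¬ G.CondL4) (hcd : 4 ≤ G.Cdual) :
    G.HalfRecon 6 := by
  intro G' hG'
  have h : Good G G' := hG'.good (small_of_le_cdual hcd)
  exact h.hemi_of_components (nsdComponent_unique hcinf hK3 hK4 hK5 hcd)
    (h.component_iso (finiteChains_of_not_condCinf hcinf) hL1 hL2)
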